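/- There exists a function B₆ : ℕ × ℕ → ℕ with the following property: for all d, ℓ ∈ ℕ, every polynomial f(x₁, …, x_ℓ, y) ∈ ℂ[x₁, …, x_ℓ, y] of degree at most d in each variable, all natural numbers n₁, …, n_ℓ, and every rational function g ∈ ℂ(x), if the one-variable polynomial f(x^{n₁}, …, x^{n_ℓ}, Y) ∈ ℂ(x)[Y] is not identically zero and f(x^{n₁}, …, x^{n_ℓ}, g(x)) = 0 identically, then N#(g) ≤ B₆(d, ℓ). -/

import Mathlib

open Polynomial

/-- `N#(g)`: the minimal total number of nonzero terms over all representations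
`g = p/q` with `p, q ∈ ℂ[x]`, `q ≠ 0` (not necessarily coprime). -/
noncomputable def Nsharp (g : RatFunc ℂ) : ℕ :=
  sInf {n : ℕ | ∃ p q : Polynomial ℂ, q ≠ 0 ∧
    g = algebraMap (Polynomial ℂ) (RatFunc ℂ) p / algebraMap (Polynomial ℂ) (RatFunc ℂ) q ∧
    n = p.support.card + q.support.card}

section Ultrametric

variable {F Ω : Type*} [Field F] [NormedField Ω] [Algebra F Ω]

theorem norm_aeval_le_one_of_trivial [IsUltrametricDist Ω]
    (hF : ∀ a : F, a ≠ 0 → ‖algebraMap F Ω a‖ = 1) (p : F[X]) {u : Ω} {c : ℝ} (hc : 0 ≤ c)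
    (h : ∀ i ≤ p.natDegree, p.coeff i ≠ 0 → ‖u‖ ^ i ≤ c) : ‖aeval u p‖ ≤ c := by
  rw [aeval_eq_sum_range]
  refine IsUltrametricDist.norm_sum_le_of_forall_le_of_nonneg hc fun i hi => ?_
  rw [Algebra.smul_def, norm_mul, norm_pow]
  by_cases h0 : p.coeff i = 0
  · simpa [h0] using hc
  · rw [hF _ h0, one_mul]
    exact h i (by simpa [Nat.lt_succ_iff] using hi) h0

theorem norm_le_one_of_isAlgebraic [IsUltrametricDist Ω]
    (hF : ∀ a : F, a ≠ 0 → ‖algebraMap F Ω a‖ = 1) {a : Ω} (ha : IsAlgebraic F a) : ‖a‖ ≤ 1 := by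
  by_contra! hlt
  obtain ⟨p, hp, hpa⟩ := ha.isIntegral
  have hpa : aeval a p = 0 := hpa
  have hn : p.natDegree ≠ 0 := by
    intro h
    rw [hp.natDegree_eq_zero.mp h] at hpa
    simp at hpa
  have h1 : a ^ p.natDegree = - aeval a p.eraseLead := by
    have := congrArg (aeval a) p.eraseLead_add_C_mul_X_pow
    rw [hpa, hp.leadingCoeff] at this
    simp at this
    linear_combination this
  have h2 : ‖aeval a p.eraseLead‖ ≤ ‖a‖ ^ (p.natDegree - 1) := by
    refine norm_aeval_le_one_of_trivial hF _ (by positivity) fun i hi _ => ?_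
    exact pow_le_pow_right₀ hlt.le (hi.trans p.eraseLead_natDegree_le)
  rw [← norm_neg, ← h1, norm_pow] at h2
  exact absurd h2 (not_le.mpr (pow_lt_pow_right₀ hlt (by omega)))

theorem norm_eq_one_of_isAlgebraic [IsUltrametricDist Ω]
    (hF : ∀ a : F, a ≠ 0 → ‖algebraMap F Ω a‖ = 1) {a : Ω} (ha : IsAlgebraic F a)
    (h0 : a ≠ 0) : ‖a‖ = 1 := by
  refine le_antisymm (norm_le_one_of_isAlgebraic hF ha) ?_
  have := norm_le_one_of_isAlgebraic hF ha.inv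
  rw [norm_inv] at this
  exact (inv_le_one₀ (norm_pos_iff.mpr h0)).mp this

end Ultrametric

theorem exists_isAlgebraic_norm_sub_lt_one {F Ω : Type*} [Field F] [NontriviallyNormedField Ω]
    [CompleteSpace Ω] [IsUltrametricDist Ω] [CharZero Ω] [Algebra F Ω]
    (hF : ∀ a : F, a ≠ 0 → ‖algebraMap F Ω a‖ = 1) {u : Ω} {p : F[X]} (hp : p ≠ 0)
    (hu : ‖aeval u p‖ < 1) : ∃ a : Ω, IsAlgebraic F a ∧ ‖u - a‖ < 1 := by
  let C := AlgebraicClosure Ω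
  let _ : NontriviallyNormedField C := spectralNorm.nontriviallyNormedField Ω C
  let _ : NormedAlgebra Ω C := spectralNorm.normedAlgebra Ω C
  have : IsUltrametricDist C := IsUltrametricDist.of_normedAlgebra Ω
  have hFC : ∀ a : F, a ≠ 0 → ‖algebraMap F C a‖ = 1 := fun a ha => by
    rw [IsScalarTower.algebraMap_apply F Ω C, norm_algebraMap', hF a ha]
  have hsp : (p.map (algebraMap F C)).Splits := IsAlgClosed.splits _
  have hmap0 : p.map (algebraMap F C) ≠ 0 := (Polynomial.map_ne_zero_iff (algebraMap F C).injective).mpr hp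
  have hex : ∃ a ∈ (p.map (algebraMap F C)).roots, ‖algebraMap Ω C u - a‖ < 1 := by
    by_contra! hcon
    have h1 : aeval (algebraMap Ω C u) p = algebraMap F C p.leadingCoeff *
        ((p.map (algebraMap F C)).roots.map fun a => algebraMap Ω C u - a).prod := by
      rw [← eval_map_algebraMap, hsp.eval_eq_prod_roots, leadingCoeff_map]
    have h2 : ∀ s : Multiset C, (∀ a ∈ s, 1 ≤ ‖algebraMap Ω C u - a‖) →
        1 ≤ ‖(s.map fun a => algebraMap Ω C u - a).prod‖ := by
      intro s
      induction s using Multiset.induction_on with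
      | empty => simp
      | cons a s ih =>
        intro h
        rw [Multiset.map_cons, Multiset.prod_cons, norm_mul]
        exact one_le_mul_of_one_le_of_one_le (h a (by simp)) (ih fun b hb => h b (by simp [hb]))
    have h3 := h2 _ hcon
    rw [aeval_algebraMap_apply] at h1
    have h4 : ‖aeval u p‖ = _ := (norm_algebraMap' C (aeval u p)).symm.trans (congrArg norm h1)
    rw [norm_mul, hFC _ (by simpa using hp), one_mul] at h4
    linarith
  obtain ⟨a, ha, hua⟩ := hex
  have hpa : aeval a p = 0 := by
    have := (mem_roots hmap0).mp ha
    simpa [IsRoot, eval_map_algebraMap] using this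
  have hmem : a ∈ IntermediateField.adjoin Ω {algebraMap Ω C u} := by
    refine IsKrasner.krasner (K := Ω) (Algebra.IsSeparable.isSeparable Ω a) (IsAlgClosed.splits _)
      (Algebra.IsIntegral.isIntegral _) fun b hb hab => ?_
    have hpb : aeval b p = 0 := by
      have : minpoly Ω a ∣ p.map (algebraMap F Ω) :=
        minpoly.dvd _ _ (by rw [aeval_map_algebraMap, hpa])
      have h2 := Polynomial.aeval_eq_zero_of_dvd_aeval_eq_zero this hb.aeval_eq_zero
      rwa [aeval_map_algebraMap] at h2
    rw [norm_eq_one_of_isAlgebraic hFC (a := a - b)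
      (IsAlgebraic.sub ⟨p, hp, hpa⟩ ⟨p, hp, hpb⟩) (sub_ne_zero.mpr hab)]
    rwa [norm_sub_rev]
  have hbot : IntermediateField.adjoin Ω {algebraMap Ω C u} = ⊥ := by
    rw [IntermediateField.adjoin_simple_eq_bot_iff]
    exact algebraMap_mem _ u
  rw [hbot, IntermediateField.mem_bot] at hmem
  obtain ⟨b, rfl⟩ := hmem
  refine ⟨b, ⟨p, hp, ?_⟩, ?_⟩
  · rw [aeval_algebraMap_apply] at hpa
    exact (algebraMap Ω C).injective (by simpa using hpa)
  · rwa [← map_sub, norm_algebraMap'] at hua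

theorem mem_range_algebraMap_of_forall_exists_norm_sub_lt {K L : Type*} [NontriviallyNormedField K]
    [CompleteSpace K] [IsUltrametricDist K] [CharZero K] [NormedField L] [NormedAlgebra K L]
    [Algebra.IsAlgebraic K L]
    (hK : ∀ n : ℕ, n ≠ 0 → ‖(n : K)‖ = 1)
    (h : ∀ y : L, y ≠ 0 → ∃ b : K, ‖y - algebraMap K L b‖ < ‖y‖) (z : L) :
    z ∈ Set.range (algebraMap K L) := by
  set m := (minpoly K z).natDegree with hm
  have hintegral : IsIntegral K z := Algebra.IsIntegral.isIntegral z
  have hmpos : 0 < m := minpoly.natDegree_pos hintegral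
  have hmK : (m : K) ≠ 0 := by exact_mod_cast hmpos.ne'
  have key : ∀ b : K, (minpoly K (z - algebraMap K L b)).natDegree = m ∧
      (minpoly K (z - algebraMap K L b)).coeff (m - 1) = (minpoly K z).coeff (m - 1) + m * b := by
    intro b
    rw [minpoly.sub_algebraMap, natDegree_comp]
    refine ⟨by simp [hm], ?_⟩
    have h1 : (minpoly K z).comp (X + C b) = taylor b (minpoly K z) := rfl
    rw [h1, taylor_coeff]
    have h2 : hasseDeriv (m - 1) (minpoly K z) = C ((minpoly K z).coeff (m - 1)) + C (m : K) * X := by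
      ext i
      rw [hasseDeriv_coeff]
      rcases i with _ | _ | i
      · simp
      · have hlc : (minpoly K z).coeff m = 1 := minpoly.monic hintegral
        have : 0 + 1 + (m - 1) = m := by omega
        simp only [this, hlc]
        have h3 : m.choose (m - 1) = m := by
          conv_lhs => rw [show m = (m - 1) + 1 by omega]
          simp; omega
        simp [h3]
      · have : (minpoly K z).coeff (i + 1 + 1 + (m - 1)) = 0 :=
          coeff_eq_zero_of_natDegree_lt (by omega)
        simp [this]
    rw [h2]; simp
  set c : K := - (minpoly K z).coeff (m - 1) / m with hc
  by_contra hz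
  set y := z - algebraMap K L c with hy
  have hy0 : y ≠ 0 := fun h0 => hz ⟨c, (sub_eq_zero.mp h0).symm⟩
  obtain ⟨b, hb⟩ := h y hy0
  have hcb : y - algebraMap K L b = z - algebraMap K L (c + b) := by rw [hy, map_add]; ring
  have hco : (minpoly K (z - algebraMap K L (c + b))).coeff (m - 1) = m * b := by
    rw [(key _).2, hc]; field_simp; ring
  have hnorm : ‖(m * b : K)‖ ≤ spectralValue (minpoly K (z - algebraMap K L (c + b))) := by
    refine le_trans (le_of_eq ?_) (le_ciSup (spectralValueTerms_bddAbove _) (m - 1))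
    rw [spectralValueTerms_of_lt_natDegree _ (by rw [(key _).1]; omega), (key _).1, hco]
    have : ((m : ℝ) - ((m - 1 : ℕ) : ℝ)) = 1 := by
      rw [Nat.cast_sub (by omega)]; simp
    rw [this]; simp
  have hnorm' : ‖b‖ ≤ ‖y - algebraMap K L b‖ := by
    rw [hcb, NormedAlgebra.norm_eq_spectralNorm K (z - algebraMap K L (c + b)), spectralNorm]
    rwa [norm_mul, hK m hmpos.ne', one_mul] at hnorm
  have := IsUltrametricDist.of_normedAlgebra K (L := L)
  have h5 : ‖y‖ ≤ max ‖y - algebraMap K L b‖ ‖algebraMap K L b‖ := by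
    simpa using IsUltrametricDist.norm_add_le_max (y - algebraMap K L b) (algebraMap K L b)
  rw [norm_algebraMap'] at h5
  exact absurd (h5.trans (max_le le_rfl hnorm')) (not_le.mpr hb)

/-- A normed field `Ω` with a contracting derivation `D`, a subfield `F` of elements of norm `1`
stable under `D`, and a group `M` of elements with logarithmic derivatives in `F`, such that
every element of `Ω` has a leading term `a * x` with `a` algebraic over `F` and `x ∈ M`. -/
structure IsMonomialSystem {F Ω : Type*} [Field F] [NormedField Ω] [Algebra F Ω]
    (d : Derivation ℤ F F) (D : Derivation ℤ Ω Ω) (M : Subgroup Ωˣ) : Prop where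
  map_d : ∀ a : F, D (algebraMap F Ω a) = algebraMap F Ω (d a)
  norm_D_le : ∀ z : Ω, ‖D z‖ ≤ ‖z‖
  norm_algebraMap : ∀ a : F, a ≠ 0 → ‖algebraMap F Ω a‖ = 1
  exists_D_eq : ∀ x ∈ M, ∃ γ : F, D (x : Ω) = algebraMap F Ω γ * x
  norm_eq_one : ∀ a : F, a ≠ 0 → ∀ x ∈ M,
    (x : Ω) * algebraMap F Ω (d a) = algebraMap F Ω a * D (x : Ω) → ‖(x : Ω)‖ = 1
  exists_norm_sub_lt : ∀ z : Ω, z ≠ 0 → ∃ a : Ω, IsAlgebraic F a ∧ ∃ x ∈ M, ‖z - a * x‖ < ‖z‖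

section

variable {F Ω : Type*} [Field F] [Field Ω] [Algebra F Ω]
    {d : Derivation ℤ F F} {D : Derivation ℤ Ω Ω}

/-- The derivation of `F[X]` acting coefficientwise. -/
noncomputable def Derivation.polyCoeffs (d : Derivation ℤ F F) : Derivation ℤ F[X] F[X] :=
  PolynomialModule.equivPolynomialSelf.compDer d.mapCoeffs

theorem Derivation.coeff_polyCoeffs (p : F[X]) (i : ℕ) :
    (d.polyCoeffs p).coeff i = d (p.coeff i) := rfl

theorem Derivation.polyCoeffs_monomial (n : ℕ) (c : F) :
    d.polyCoeffs (monomial n c) = monomial n (d c) := by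
  ext i
  rw [coeff_polyCoeffs, coeff_monomial, coeff_monomial, apply_ite d, map_zero]

theorem Derivation.apply_aeval_of_map (h : ∀ a : F, D (algebraMap F Ω a) = algebraMap F Ω (d a))
    (a : Ω) (p : F[X]) :
    D (aeval a p) = aeval a (d.polyCoeffs p) + aeval a (derivative p) * D a := by
  induction p using Polynomial.induction_on' with
  | add p q hp hq => simp only [map_add, hp, hq]; ring
  | monomial n c =>
    rw [Derivation.polyCoeffs_monomial, derivative_monomial]
    simp only [aeval_monomial, Derivation.leibniz, Derivation.leibniz_pow, h, map_mul, _root_.map_natCast, smul_eq_mul, nsmul_eq_mul]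
    ring

theorem Derivation.mem_adjoin_of_isAlgebraic [CharZero F]
    (h : ∀ a : F, D (algebraMap F Ω a) = algebraMap F Ω (d a)) {a : Ω} (ha : IsAlgebraic F a) :
    D a ∈ IntermediateField.adjoin F {a} := by
  have h1 := Derivation.apply_aeval_of_map h a (minpoly F a)
  rw [minpoly.aeval, map_zero] at h1
  have hsep := (minpoly.irreducible ha.isIntegral).separable
  have h2 := hsep.aeval_derivative_ne_zero (minpoly.aeval F a)
  have h3 : D a = - aeval a (d.polyCoeffs (minpoly F a)) / aeval a (derivative (minpoly F a)) := by
    field_simp; linear_combination -h1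
  rw [h3]
  have : ∀ p : F[X], aeval a p ∈ IntermediateField.adjoin F {a} := fun p => by
    have := aeval_mem_adjoin_singleton F a (p := p)
    exact IntermediateField.algebra_adjoin_le_adjoin _ _ this
  exact div_mem (neg_mem (this _)) (this _)

theorem Derivation.isAlgebraic_apply [CharZero F]
    (h : ∀ a : F, D (algebraMap F Ω a) = algebraMap F Ω (d a)) {a : Ω} (ha : IsAlgebraic F a) :
    IsAlgebraic F (D a) := by
  have := Derivation.mem_adjoin_of_isAlgebraic h ha
  have h2 : IntermediateField.adjoin F {a} ≤ algebraicClosure F Ω := by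
    rw [IntermediateField.adjoin_simple_le_iff, mem_algebraicClosure_iff]; exact ha
  exact mem_algebraicClosure_iff.mp (h2 this)

theorem Derivation.exists_ne_zero_of_logDeriv
    (h : ∀ a : F, D (algebraMap F Ω a) = algebraMap F Ω (d a)) {a : Ω} (ha : IsAlgebraic F a)
    (ha0 : a ≠ 0) {γ : F} (hγ : D a = algebraMap F Ω γ * a) :
    ∃ c : F, c ≠ 0 ∧ ∃ e : ℕ, e ≠ 0 ∧ d c = e * γ * c := by
  set p := minpoly F a with hp
  have hintegral := ha.isIntegral
  have hmon := minpoly.monic hintegral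
  set e := p.natDegree with he
  have he0 : e ≠ 0 := (minpoly.natDegree_pos hintegral).ne'
  refine ⟨p.coeff 0, minpoly.coeff_zero_ne_zero hintegral ha0, e, he0, ?_⟩
  have h1 := Derivation.apply_aeval_of_map h a p
  rw [minpoly.aeval, map_zero, hγ] at h1
  set q : F[X] := d.polyCoeffs p + C γ * X * derivative p - C (e * γ) * p with hq
  have hqa : aeval a q = 0 := by
    rw [hq]
    simp only [map_add, map_sub, map_mul, aeval_C, aeval_X, minpoly.aeval, hp]
    rw [← hp]; linear_combination -h1
  have hcoef : ∀ i, q.coeff i = d (p.coeff i) + γ * (i * p.coeff i) - e * γ * p.coeff i := by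
    intro i
    rw [hq, coeff_sub, coeff_add, coeff_C_mul, mul_assoc, coeff_C_mul, Derivation.coeff_polyCoeffs]
    rcases i with _ | i
    · simp
    · rw [coeff_X_mul, coeff_derivative]; push_cast; ring
  have hq0 : q = 0 := by
    by_contra hq0
    have hdeg := natDegree_le_of_dvd (minpoly.dvd F a hqa) hq0
    rw [← hp, ← he] at hdeg
    have h3 : q.natDegree ≤ e := by
      rw [natDegree_le_iff_coeff_eq_zero]
      intro N hN
      rw [hcoef, coeff_eq_zero_of_natDegree_lt hN]; simp
    have h4 : q.coeff e = 0 := by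
      rw [hcoef, show p.coeff e = 1 from hmon]; simp; ring
    rw [le_antisymm hdeg h3] at h4
    exact hq0 (leadingCoeff_eq_zero.mp h4)
  have := hcoef 0
  rw [hq0] at this
  simp at this
  linear_combination -this

end

section DiffOp

variable (F : Type*) {Ω : Type*} [Field F] [Field Ω] [Algebra F Ω] (D : Derivation ℤ Ω Ω)

/-- Differential operators in `D` of order `< r` with coefficients algebraic over `F`. -/
noncomputable def diffOp (r : ℕ) : Submodule (algebraicClosure F Ω) (Module.End ℤ Ω) :=
  Submodule.span _ ((fun i => (D : Ω →ₗ[ℤ] Ω) ^ i) '' Set.Iio r)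

variable {F D}

theorem diffOp_mono {r s : ℕ} (h : r ≤ s) : diffOp F D r ≤ diffOp F D s :=
  Submodule.span_mono (Set.image_mono (Set.Iio_subset_Iio h))

theorem pow_mem_diffOp {r i : ℕ} (h : i < r) : (D : Ω →ₗ[ℤ] Ω) ^ i ∈ diffOp F D r :=
  Submodule.subset_span ⟨i, h, rfl⟩

theorem diffOp_zero {P : Module.End ℤ Ω} (h : P ∈ diffOp F D 0) : P = 0 := by
  simpa [diffOp] using h

theorem comp_mem_diffOp (hD : ∀ a : Ω, IsAlgebraic F a → IsAlgebraic F (D a)) {r : ℕ}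
    {P : Module.End ℤ Ω} (h : P ∈ diffOp F D r) :
    (D : Ω →ₗ[ℤ] Ω) * P ∈ diffOp F D (r + 1) := by
  induction h using Submodule.span_induction with
  | mem x hx =>
    obtain ⟨i, hi, rfl⟩ := hx
    simp only [← pow_succ']
    exact pow_mem_diffOp (Nat.succ_lt_succ hi)
  | zero => simp
  | add x y _ _ hx hy => rw [mul_add]; exact add_mem hx hy
  | smul c P hP ih =>
    have h1 : (D : Ω →ₗ[ℤ] Ω) * (c • P) = c • ((D : Ω →ₗ[ℤ] Ω) * P) +
        (⟨D c, mem_algebraicClosure_iff.mpr (hD _ (mem_algebraicClosure_iff.mp c.2))⟩ :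
          algebraicClosure F Ω) • P := by
      ext z
      simp [Algebra.smul_def, IntermediateField.algebraMap_apply, mul_comm]
    rw [h1]
    exact add_mem (Submodule.smul_mem _ _ ih)
      (Submodule.smul_mem _ _ (diffOp_mono (Nat.le_succ r) hP))

theorem pow_mul_lmul_mem_diffOp (hD : ∀ a : Ω, IsAlgebraic F a → IsAlgebraic F (D a))
    (μ : algebraicClosure F Ω) (i : ℕ) :
    (D : Ω →ₗ[ℤ] Ω) ^ i * (μ • (1 : Module.End ℤ Ω)) ∈ diffOp F D (i + 1) := by
  induction i with
  | zero =>
    rw [pow_zero, one_mul]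
    exact Submodule.smul_mem _ μ (pow_mem_diffOp (F := F) (D := D) (i := 0) zero_lt_one)
  | succ i ih =>
    rw [pow_succ', mul_assoc]
    exact comp_mem_diffOp hD ih

/-- Right division of a differential operator by `D - μ`. -/
theorem exists_eq_mul_sub_add_of_mem_diffOp
    (hD : ∀ a : Ω, IsAlgebraic F a → IsAlgebraic F (D a)) (μ : algebraicClosure F Ω) (r : ℕ)
    {P : Module.End ℤ Ω} (hP : P ∈ diffOp F D (r + 1)) :
    ∃ Q ∈ diffOp F D r, ∃ ρ : algebraicClosure F Ω,
      P = Q * ((D : Ω →ₗ[ℤ] Ω) - μ • 1) + ρ • 1 := by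
  induction r generalizing P with
  | zero =>
    refine ⟨0, zero_mem _, ?_⟩
    have : diffOp F D (0 + 1) = Submodule.span _ {(1 : Module.End ℤ Ω)} := by
      rw [diffOp]; congr 1; ext x; simp
    rw [this, Submodule.mem_span_singleton] at hP
    obtain ⟨ρ, rfl⟩ := hP
    exact ⟨ρ, by simp⟩
  | succ r ih =>
    induction hP using Submodule.span_induction with
    | mem x hx =>
      obtain ⟨i, hi, rfl⟩ := hx
      rcases i with _ | i
      · exact ⟨0, zero_mem _, 1, by simp⟩
      · have hi : i < r + 1 := by simpa using hi
        have h1 := diffOp_mono (show i + 1 ≤ r + 1 by omega) (pow_mul_lmul_mem_diffOp hD μ i)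
        obtain ⟨Q, hQ, ρ, hρ⟩ := ih h1
        refine ⟨(D : Ω →ₗ[ℤ] Ω) ^ i + Q,
          add_mem (pow_mem_diffOp hi) (diffOp_mono (Nat.le_succ r) hQ), ρ, ?_⟩
        rw [add_mul, add_assoc, ← hρ, mul_sub, sub_add_cancel]
        exact pow_succ _ _
    | zero => exact ⟨0, zero_mem _, 0, by simp⟩
    | add x y _ _ hx hy =>
      obtain ⟨Q, hQ, ρ, rfl⟩ := hx
      obtain ⟨Q', hQ', ρ', rfl⟩ := hy
      exact ⟨Q + Q', add_mem hQ hQ', ρ + ρ', by rw [add_mul, add_smul]; abel⟩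
    | smul c x _ hx =>
      obtain ⟨Q, hQ, ρ, rfl⟩ := hx
      exact ⟨c • Q, Submodule.smul_mem _ _ hQ, c * ρ, by rw [smul_add, smul_mul_assoc, mul_smul]⟩

end DiffOp

/-- A product of a nonzero element algebraic over `F` and an element of `M`. -/
def IsMono (F : Type*) {Ω : Type*} [Field F] [Field Ω] [Algebra F Ω] (M : Subgroup Ωˣ) (t : Ω) :
    Prop :=
  ∃ a : Ω, IsAlgebraic F a ∧ a ≠ 0 ∧ ∃ x ∈ M, t = a * x

namespace IsMono

variable {F Ω : Type*} [Field F] [Field Ω] [Algebra F Ω] {M : Subgroup Ωˣ} {s t : Ω}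

theorem ne_zero (ht : IsMono F M t) : t ≠ 0 := by
  obtain ⟨a, -, ha, x, -, rfl⟩ := ht
  exact mul_ne_zero ha x.ne_zero

theorem mul (hs : IsMono F M s) (ht : IsMono F M t) : IsMono F M (s * t) := by
  obtain ⟨a, ha, ha0, x, hx, rfl⟩ := hs
  obtain ⟨b, hb, hb0, y, hy, rfl⟩ := ht
  exact ⟨a * b, ha.mul hb, mul_ne_zero ha0 hb0, x * y, mul_mem hx hy, by push_cast; ring⟩

theorem inv (ht : IsMono F M t) : IsMono F M t⁻¹ := by
  obtain ⟨a, ha, ha0, x, hx, rfl⟩ := ht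
  exact ⟨a⁻¹, ha.inv, inv_ne_zero ha0, x⁻¹, inv_mem hx, by rw [mul_inv, Units.val_inv_eq_inv_val]⟩

theorem smul (ht : IsMono F M t) {a : Ω} (ha : IsAlgebraic F a) (ha0 : a ≠ 0) :
    IsMono F M (a * t) := by
  obtain ⟨b, hb, hb0, x, hx, rfl⟩ := ht
  exact ⟨a * b, ha.mul hb, mul_ne_zero ha0 hb0, x, hx, by ring⟩

end IsMono

namespace IsMonomialSystem

variable {F Ω : Type*} [Field F] [CharZero F] [NormedField Ω] [IsUltrametricDist Ω] [Algebra F Ω]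
    {d : Derivation ℤ F F} {D : Derivation ℤ Ω Ω} {M : Subgroup Ωˣ}

theorem norm_eq_one_of_isAlgebraic (H : IsMonomialSystem d D M) {a : Ω} (ha : IsAlgebraic F a)
    (h0 : a ≠ 0) : ‖a‖ = 1 :=
  _root_.norm_eq_one_of_isAlgebraic H.norm_algebraMap ha h0

theorem isAlgebraic_D (H : IsMonomialSystem d D M) {a : Ω} (ha : IsAlgebraic F a) :
    IsAlgebraic F (D a) :=
  Derivation.isAlgebraic_apply H.map_d ha

theorem exists_D_eq_of_isMono (H : IsMonomialSystem d D M) {t : Ω} (ht : IsMono F M t) :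
    ∃ l : Ω, IsAlgebraic F l ∧ D t = l * t := by
  obtain ⟨a, ha, ha0, x, hx, rfl⟩ := ht
  obtain ⟨γ, hγ⟩ := H.exists_D_eq x hx
  refine ⟨algebraMap F Ω γ + D a * a⁻¹, (isAlgebraic_algebraMap γ).add
    ((H.isAlgebraic_D ha).mul ha.inv), ?_⟩
  rw [Derivation.leibniz, hγ, smul_eq_mul, smul_eq_mul]
  field_simp

theorem norm_eq_one_of_D_eq_zero (H : IsMonomialSystem d D M) {t : Ω} (ht : IsMono F M t)
    (hD : D t = 0) : ‖t‖ = 1 := by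
  obtain ⟨a, ha, ha0, x, hx, rfl⟩ := ht
  obtain ⟨γ, hγ⟩ := H.exists_D_eq x hx
  have hDa : D a = algebraMap F Ω (-γ) * a := by
    rw [Derivation.leibniz, hγ, smul_eq_mul, smul_eq_mul] at hD
    have : (x : Ω) * (D a + algebraMap F Ω γ * a) = 0 := by linear_combination hD
    rcases mul_eq_zero.mp this with h | h
    · exact absurd h x.ne_zero
    · rw [map_neg]; linear_combination h
  obtain ⟨c, hc, e, he, hce⟩ := Derivation.exists_ne_zero_of_logDeriv H.map_d ha ha0 hDa
  have h1 := H.norm_eq_one c⁻¹ (inv_ne_zero hc) (x ^ e) (pow_mem hx e) (by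
    rw [Derivation.leibniz_inv, hce]
    simp only [Units.val_pow_eq_pow_val, Derivation.leibniz_pow, hγ, smul_eq_mul, nsmul_eq_mul]
    obtain ⟨e, rfl⟩ := Nat.exists_eq_succ_of_ne_zero he
    have hc' : algebraMap F Ω c ≠ 0 := by simpa using hc
    simp only [map_mul, map_neg, map_pow, map_inv₀, map_natCast, Nat.succ_eq_add_one,
      Nat.add_sub_cancel]
    field_simp
    push_cast
    ring)
  rw [Units.val_pow_eq_pow_val, norm_pow, pow_eq_one_iff_of_nonneg (norm_nonneg _) he] at h1
  rw [norm_mul, h1, H.norm_eq_one_of_isAlgebraic ha ha0, one_mul]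

theorem exists_apply_eq_of_isMono (H : IsMonomialSystem d D M) {t : Ω} (ht : IsMono F M t) {r : ℕ}
    {P : Module.End ℤ Ω} (hP : P ∈ diffOp F D r) : ∃ l : Ω, IsAlgebraic F l ∧ P t = l * t := by
  induction hP using Submodule.span_induction with
  | mem x hx =>
    obtain ⟨i, -, rfl⟩ := hx
    induction i with
    | zero => exact ⟨1, isAlgebraic_one, by simp⟩
    | succ i ih =>
      obtain ⟨l, hl, h⟩ := ih
      obtain ⟨m, hm, h'⟩ := H.exists_D_eq_of_isMono ht
      refine ⟨l * m + D l, (hl.mul hm).add (H.isAlgebraic_D hl), ?_⟩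
      simp only [pow_succ', Module.End.mul_apply] at h ⊢
      rw [h, Derivation.coeFn_coe, Derivation.leibniz, h']
      simp only [smul_eq_mul]; ring
  | zero => exact ⟨0, isAlgebraic_zero, by simp⟩
  | add x y _ _ hx hy =>
    obtain ⟨l, hl, h⟩ := hx
    obtain ⟨m, hm, h'⟩ := hy
    exact ⟨l + m, hl.add hm, by rw [LinearMap.add_apply, h, h', add_mul]⟩
  | smul c x _ hx =>
    obtain ⟨l, hl, h⟩ := hx
    refine ⟨c * l, (mem_algebraicClosure_iff.mp c.2).mul hl, ?_⟩
    rw [LinearMap.smul_apply, h, mul_assoc]; rfl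

theorem norm_apply_le (H : IsMonomialSystem d D M) {r : ℕ}
    {P : Module.End ℤ Ω} (hP : P ∈ diffOp F D r) (z : Ω) : ‖P z‖ ≤ ‖z‖ := by
  induction hP using Submodule.span_induction with
  | mem x hx =>
    obtain ⟨i, -, rfl⟩ := hx
    induction i with
    | zero => simp
    | succ i ih =>
      simp only [pow_succ', Module.End.mul_apply] at ih ⊢
      exact (H.norm_D_le _).trans ih
  | zero => simp
  | add x y _ _ hx hy => exact (IsUltrametricDist.norm_add_le_max _ _).trans (max_le hx hy)
  | smul c x _ hx =>
    have : (c • x) z = (c : Ω) * x z := rfl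
    rw [this, norm_mul]
    exact (mul_le_of_le_one_left (norm_nonneg _)
      (norm_le_one_of_isAlgebraic H.norm_algebraMap (mem_algebraicClosure_iff.mp c.2))).trans hx

/-- An operator of order `r` cannot kill `r + 1` monomials of pairwise distinct norms. -/
theorem exists_apply_ne_zero (H : IsMonomialSystem d D M) (r : ℕ) (c : algebraicClosure F Ω)
    (hc : c ≠ 0) {P : Module.End ℤ Ω} (hP : P ∈ diffOp F D r) (t : ℕ → Ω)
    (ht : ∀ i ≤ r, IsMono F M (t i)) (hnorm : ∀ i ≤ r, ∀ j ≤ r, ‖t i‖ = ‖t j‖ → i = j) :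
    ∃ i ≤ r, (c • (D : Ω →ₗ[ℤ] Ω) ^ r + P) (t i) ≠ 0 := by
  have hD : ∀ a : Ω, IsAlgebraic F a → IsAlgebraic F (D a) := fun a => H.isAlgebraic_D
  induction r generalizing t P with
  | zero =>
    refine ⟨0, le_rfl, ?_⟩
    rw [diffOp_zero hP]
    have : (c • (D : Ω →ₗ[ℤ] Ω) ^ 0 + 0 : Module.End ℤ Ω) (t 0) = (c : Ω) * t 0 := by
      rw [add_zero]; rfl
    rw [this]
    exact mul_ne_zero (by simpa using hc) (ht 0 le_rfl).ne_zero
  | succ r ih =>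
    by_contra! hcon
    obtain ⟨l, hl, hlt⟩ := H.exists_D_eq_of_isMono (ht 0 (Nat.zero_le _))
    set μ : algebraicClosure F Ω := ⟨l, mem_algebraicClosure_iff.mpr hl⟩ with hμ
    obtain ⟨Q, hQ, ρ, hρ⟩ := exists_eq_mul_sub_add_of_mem_diffOp hD μ r
      (add_mem hP (Submodule.smul_mem _ c (pow_mul_lmul_mem_diffOp hD μ r)))
    have hfac : c • (D : Ω →ₗ[ℤ] Ω) ^ (r + 1) + P =
        (c • (D : Ω →ₗ[ℤ] Ω) ^ r + Q) * ((D : Ω →ₗ[ℤ] Ω) - μ • 1) + ρ • 1 := by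
      rw [add_mul, add_assoc, ← hρ, smul_mul_assoc, mul_sub, pow_succ, smul_sub]
      abel
    have happ : ∀ z, (c • (D : Ω →ₗ[ℤ] Ω) ^ (r + 1) + P) z =
        (c • (D : Ω →ₗ[ℤ] Ω) ^ r + Q) (D z - l * z) + (ρ : Ω) * z := fun z => by
      rw [hfac]; rfl
    have hρ0 : (ρ : Ω) = 0 := by
      have h0 := hcon 0 (Nat.zero_le _)
      rw [happ, hlt, sub_self, map_zero, zero_add] at h0
      exact (mul_eq_zero.mp h0).resolve_right (ht 0 (Nat.zero_le _)).ne_zero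
    have hmono : ∀ j ≤ r, IsMono F M (D (t (j + 1)) - l * t (j + 1)) ∧
        ‖D (t (j + 1)) - l * t (j + 1)‖ = ‖t (j + 1)‖ := by
      intro j hj
      have htj := ht (j + 1) (by omega)
      obtain ⟨m, hm, hmt⟩ := H.exists_D_eq_of_isMono htj
      have hne : m - l ≠ 0 := by
        intro h
        have hml : m = l := sub_eq_zero.mp h
        have h0 : t 0 ≠ 0 := (ht 0 (Nat.zero_le _)).ne_zero
        have hy := H.norm_eq_one_of_D_eq_zero (htj.mul (ht 0 (Nat.zero_le _)).inv) (by
          rw [Derivation.leibniz, Derivation.leibniz_inv, hmt, hlt, hml]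
          simp only [smul_eq_mul]
          field_simp
          ring)
        rw [norm_mul, norm_inv, mul_inv_eq_one₀ (norm_ne_zero_iff.mpr h0)] at hy
        have := hnorm (j + 1) (by omega) 0 (Nat.zero_le _) hy
        omega
      rw [hmt, ← sub_mul]
      exact ⟨htj.smul (hm.sub hl) hne,
        by rw [norm_mul, H.norm_eq_one_of_isAlgebraic (hm.sub hl) hne, one_mul]⟩
    obtain ⟨j, hj, hne⟩ := ih hQ (fun j => D (t (j + 1)) - l * t (j + 1))
      (fun j hj => (hmono j hj).1) (fun i hi j hj hij => by
        simp only [(hmono i hi).2, (hmono j hj).2] at hij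
        have := hnorm _ (by omega) _ (by omega) hij
        omega)
    have := hcon (j + 1) (by omega)
    rw [happ, hρ0, zero_mul, add_zero] at this
    exact hne this

end IsMonomialSystem

/-- The algebra generated by `M` over the elements algebraic over `F`. -/
noncomputable def monoAlg (F : Type*) {Ω : Type*} [Field F] [Field Ω] [Algebra F Ω]
    (M : Subgroup Ωˣ) : Subalgebra (algebraicClosure F Ω) Ω :=
  Algebra.adjoin _ (M.toSubmonoid.map (Units.coeHom Ω) : Set Ω)

theorem toSubmodule_monoAlg {F Ω : Type*} [Field F] [Field Ω] [Algebra F Ω] (M : Subgroup Ωˣ) :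
    Subalgebra.toSubmodule (monoAlg F M) =
      Submodule.span (algebraicClosure F Ω) (M.toSubmonoid.map (Units.coeHom Ω) : Set Ω) := by
  rw [monoAlg, Algebra.adjoin_eq_span, Submonoid.closure_eq]

theorem IsMono.mem_monoAlg {F Ω : Type*} [Field F] [Field Ω] [Algebra F Ω] {M : Subgroup Ωˣ}
    {t : Ω} (ht : IsMono F M t) : t ∈ monoAlg F M := by
  obtain ⟨a, ha, -, x, hx, rfl⟩ := ht
  refine mul_mem ?_ (Algebra.subset_adjoin ⟨x, hx, rfl⟩)
  exact (monoAlg F M).algebraMap_mem ⟨a, mem_algebraicClosure_iff.mpr ha⟩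

namespace IsMonomialSystem

section NormedField

variable {F Ω : Type*} [Field F] [CharZero F] [NormedField Ω] [IsUltrametricDist Ω] [Algebra F Ω]
    {d : Derivation ℤ F F} {D : Derivation ℤ Ω Ω} {M : Subgroup Ωˣ}

theorem exists_isMono_norm_sub_lt (H : IsMonomialSystem d D M) {z : Ω} (hz : z ≠ 0) :
    ∃ t, IsMono F M t ∧ ‖z - t‖ < ‖z‖ ∧ ‖t‖ = ‖z‖ := by
  obtain ⟨a, ha, x, hx, hlt⟩ := H.exists_norm_sub_lt z hz
  have ha0 : a ≠ 0 := by rintro rfl; simp at hlt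
  refine ⟨a * x, ⟨a, ha, ha0, x, hx, rfl⟩, hlt, ?_⟩
  have := IsUltrametricDist.norm_add_eq_max_of_norm_ne_norm (x := a * x - z) (y := z)
    (by rw [norm_sub_rev]; exact hlt.ne)
  rw [sub_add_cancel, norm_sub_rev, max_eq_right hlt.le] at this
  exact this

theorem exists_stable_submodule (H : IsMonomialSystem d D M) {s : Ω} (hs : s ∈ monoAlg F M) :
    ∃ W : Submodule F Ω, W.FG ∧ s ∈ W ∧ ∀ w ∈ W, D w ∈ W := by
  have key : ∀ (c : F) (w : Ω), D (c • w) = c • D w + d c • w := fun c w => by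
    rw [Algebra.smul_def, Algebra.smul_def, Algebra.smul_def, Derivation.leibniz, H.map_d, smul_eq_mul,
      smul_eq_mul]
    ring
  rw [← Subalgebra.mem_toSubmodule, toSubmodule_monoAlg] at hs
  induction hs using Submodule.span_induction with
  | mem x hx =>
    obtain ⟨x, hx, rfl⟩ := hx
    obtain ⟨γ, hγ⟩ := H.exists_D_eq x hx
    refine ⟨Submodule.span F {(x : Ω)}, Submodule.fg_span_singleton _,
      Submodule.mem_span_singleton_self _, fun w hw => ?_⟩
    obtain ⟨c, rfl⟩ := Submodule.mem_span_singleton.mp hw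
    refine Submodule.mem_span_singleton.mpr ⟨c * γ + d c, ?_⟩
    rw [key, hγ, add_smul, mul_smul, Algebra.smul_def γ]
  | zero => exact ⟨⊥, Submodule.fg_bot, by simp, by simp⟩
  | add x y _ _ hx hy =>
    obtain ⟨W, hW, hxW, hDW⟩ := hx
    obtain ⟨V, hV, hyV, hDV⟩ := hy
    refine ⟨W ⊔ V, hW.sup hV, add_mem (Submodule.mem_sup_left hxW) (Submodule.mem_sup_right hyV),
      fun w hw => ?_⟩
    obtain ⟨u, hu, v, hv, rfl⟩ := Submodule.mem_sup.mp hw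
    rw [map_add]
    exact add_mem (Submodule.mem_sup_left (hDW _ hu)) (Submodule.mem_sup_right (hDV _ hv))
  | smul c x _ hx =>
    obtain ⟨W, hW, hxW, hDW⟩ := hx
    have hc : IsAlgebraic F (c : Ω) := mem_algebraicClosure_iff.mp c.2
    let A := (IntermediateField.adjoin F {(c : Ω)})
    have hA : (Subalgebra.toSubmodule A.toSubalgebra).FG := by
      have := IntermediateField.adjoin.finiteDimensional hc.isIntegral
      exact Module.Finite.iff_fg.mp this
    have hDA : ∀ a ∈ A, D a ∈ A := fun a ha => by
      have halg : IsAlgebraic F a := by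
        have := IntermediateField.isAlgebraic_adjoin_simple hc.isIntegral
        have h2 := this.isAlgebraic (⟨a, ha⟩ : A)
        exact h2.algebraMap (A := Ω)
      have := Derivation.mem_adjoin_of_isAlgebraic H.map_d halg
      exact IntermediateField.adjoin_simple_le_iff.mpr ha this
    refine ⟨Subalgebra.toSubmodule A.toSubalgebra * W, hA.mul hW, ?_, fun w hw => ?_⟩
    · exact Submodule.mul_mem_mul (IntermediateField.mem_adjoin_simple_self F (c : Ω)) hxW
    · induction hw using Submodule.mul_induction_on' with
      | mem_mul_mem a ha w hw =>
        rw [Derivation.leibniz, smul_eq_mul, smul_eq_mul, mul_comm w]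
        exact add_mem (Submodule.mul_mem_mul ha (hDW w hw)) (Submodule.mul_mem_mul (hDA a ha) hw)
      | add x _ y _ hx hy => rw [map_add]; exact add_mem hx hy

theorem span_le_diffOp (r : ℕ) {P : Module.End ℤ Ω}
    (hP : P ∈ Submodule.span F ((fun i => (D : Ω →ₗ[ℤ] Ω) ^ i) '' Set.Iio r)) :
    P ∈ diffOp F D r := by
  induction hP using Submodule.span_induction with
  | mem x hx => exact Submodule.subset_span hx
  | zero => exact zero_mem _
  | add x y _ _ hx hy => exact add_mem hx hy
  | smul c x _ hx =>
    have : c • x = (algebraMap F (algebraicClosure F Ω) c) • x := by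
      ext z
      simp [Algebra.smul_def]
    rw [this]
    exact Submodule.smul_mem _ _ hx

theorem exists_annihilator (H : IsMonomialSystem d D M) {s : Ω} (hs : s ∈ monoAlg F M) :
    ∃ (r : ℕ), ∃ P ∈ Submodule.span F ((fun i => (D : Ω →ₗ[ℤ] Ω) ^ i) '' Set.Iio r),
      ((D : Ω →ₗ[ℤ] Ω) ^ r + P) s = 0 := by
  obtain ⟨W, hW, hsW, hDW⟩ := H.exists_stable_submodule hs
  have : IsNoetherian F W := isNoetherian_of_fg_of_noetherian _ hW
  have hpow : ∀ i, ((D : Ω →ₗ[ℤ] Ω) ^ i) s ∈ W := fun i => by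
    induction i with
    | zero => simpa using hsW
    | succ i ih => rw [pow_succ']; exact hDW _ ih
  let v : ℕ → W := fun i => ⟨((D : Ω →ₗ[ℤ] Ω) ^ i) s, hpow i⟩
  obtain ⟨r, hr⟩ := monotone_stabilizes_iff_noetherian.mpr this
    ⟨fun r => Submodule.span F (v '' Set.Iio r), fun a b hab =>
      Submodule.span_mono (Set.image_mono (Set.Iio_subset_Iio hab))⟩
  have hr1 := hr (r + 1) (Nat.le_succ r)
  have hmem : v r ∈ Submodule.span F (v '' Set.Iio r) := by
    have : v r ∈ Submodule.span F (v '' Set.Iio (r + 1)) :=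
      Submodule.subset_span ⟨r, Nat.lt_succ_self r, rfl⟩
    rwa [show Submodule.span F (v '' Set.Iio (r + 1)) = Submodule.span F (v '' Set.Iio r) from
      hr1.symm] at this
  have hlift : ∀ w ∈ Submodule.span F (v '' Set.Iio r),
      ∃ P ∈ Submodule.span F ((fun i => (D : Ω →ₗ[ℤ] Ω) ^ i) '' Set.Iio r), P s = w := by
    intro w hw
    induction hw using Submodule.span_induction with
    | mem x hx =>
      obtain ⟨i, hi, rfl⟩ := hx
      exact ⟨_, Submodule.subset_span ⟨i, hi, rfl⟩, rfl⟩
    | zero => exact ⟨0, zero_mem _, rfl⟩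
    | add x y _ _ hx hy =>
      obtain ⟨P, hP, h⟩ := hx
      obtain ⟨Q, hQ, h'⟩ := hy
      exact ⟨P + Q, add_mem hP hQ, by simp [h, h']⟩
    | smul c x _ hx =>
      obtain ⟨P, hP, h⟩ := hx
      exact ⟨c • P, Submodule.smul_mem _ _ hP, by simp [h]⟩
  obtain ⟨P, hP, hPs⟩ := hlift _ hmem
  exact ⟨r, -P, neg_mem hP, by rw [LinearMap.add_apply, LinearMap.neg_apply, hPs, add_neg_cancel]⟩

theorem mem_monoAlg_of_apply_eq_zero (H : IsMonomialSystem d D M) {h : Ω} {r : ℕ}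
    {P : Module.End ℤ Ω} (hP : P ∈ diffOp F D r)
    (hh : ((D : Ω →ₗ[ℤ] Ω) ^ r + P) h = 0) : h ∈ monoAlg F M := by
  by_contra hmem
  set Q := (D : Ω →ₗ[ℤ] Ω) ^ r + P with hQ
  have hQm : Q ∈ diffOp F D (r + 1) :=
    add_mem (pow_mem_diffOp (Nat.lt_succ_self r)) (diffOp_mono (Nat.le_succ r) hP)
  have step : ∀ z : {z : Ω // z ∉ monoAlg F M ∧ Q z = 0}, ∃ t, IsMono F M t ∧ Q t = 0 ∧
      ‖t‖ = ‖(z : Ω)‖ ∧ ∃ w : {z : Ω // z ∉ monoAlg F M ∧ Q z = 0}, ‖(w : Ω)‖ < ‖(z : Ω)‖ := by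
    rintro ⟨z, hz, hQz⟩
    have hz0 : z ≠ 0 := by rintro rfl; exact hz (zero_mem _)
    obtain ⟨t, ht, hlt, heq⟩ := H.exists_isMono_norm_sub_lt hz0
    have hQt : Q t = 0 := by
      obtain ⟨l, hl, hlt'⟩ := H.exists_apply_eq_of_isMono ht hQm
      rw [hlt']
      by_cases hl0 : l = 0
      · simp [hl0]
      · exfalso
        have h1 : ‖Q (z - t)‖ ≤ ‖z - t‖ := H.norm_apply_le hQm _
        rw [map_sub, hQz, zero_sub, norm_neg, hlt', norm_mul,
          H.norm_eq_one_of_isAlgebraic hl hl0, one_mul, heq] at h1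
        exact absurd hlt (not_lt.mpr h1)
    exact ⟨t, ht, hQt, heq, ⟨z - t, fun hm => hz (by simpa using add_mem hm ht.mem_monoAlg),
      by rw [map_sub, hQz, hQt, sub_zero]⟩, hlt⟩
  choose t ht hQt hnorm next hnext using step
  let z : ℕ → {z : Ω // z ∉ monoAlg F M ∧ Q z = 0} := fun n => next^[n] ⟨h, hmem, hh⟩
  have hanti : StrictAnti fun n => ‖(z n : Ω)‖ := strictAnti_nat_of_succ_lt fun n => by
    simp only [z, Function.iterate_succ_apply']
    exact hnext _
  obtain ⟨i, -, hi⟩ := H.exists_apply_ne_zero r 1 one_ne_zero hP (fun n => t (z n))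
    (fun i _ => ht _) (fun i _ j _ hij => by
      rw [hnorm, hnorm] at hij
      exact hanti.injective hij)
  rw [one_smul] at hi
  exact hi (hQt _)

end NormedField

variable {F Ω : Type*} [Field F] [CharZero F] [NormedField Ω] [CharZero Ω] [CompleteSpace Ω]
    [IsUltrametricDist Ω] [Algebra F Ω]
    {d : Derivation ℤ F F} {D : Derivation ℤ Ω Ω} {M : Subgroup Ωˣ}

theorem mem_topologicalClosure (H : IsMonomialSystem d D M) (hM : ∃ x ∈ M, ‖(x : Ω)‖ ≠ 1)
    {h : Ω} {p : Polynomial Ω} (hp : p ≠ 0) (hpM : ∀ i, p.coeff i ∈ monoAlg F M)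
    (hph : p.eval h = 0) : h ∈ (monoAlg F M).topologicalClosure := by
  set S := (monoAlg F M).topologicalClosure with hS
  have hcl : IsClosed (S : Set Ω) := Subalgebra.isClosed_topologicalClosure _
  have hle : monoAlg F M ≤ S := Subalgebra.le_topologicalClosure _
  have hinv : ∀ z ∈ S, z⁻¹ ∈ S := by
    intro z hz
    by_cases hz0 : z = 0
    · simp [hz0]
    obtain ⟨t, ht, hlt, heq⟩ := H.exists_isMono_norm_sub_lt hz0
    have ht0 := ht.ne_zero
    have htinv : t⁻¹ ∈ S := hle ht.inv.mem_monoAlg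
    set ε := 1 - z * t⁻¹ with hε
    have hε1 : ‖ε‖ < 1 := by
      have : ε = -(z - t) * t⁻¹ := by rw [hε]; field_simp; ring
      rw [this, norm_mul, norm_neg, norm_inv, heq, ← div_eq_mul_inv,
        div_lt_one (norm_pos_iff.mpr hz0)]
      exact hlt
    have hεS : ε ∈ S := sub_mem (one_mem _) (mul_mem hz htinv)
    have h1 : (1 - ε)⁻¹ ∈ S := by
      rw [← tsum_geometric_of_norm_lt_one hε1]
      exact tsum_mem hcl fun i => pow_mem hεS i
    have : z⁻¹ = t⁻¹ * (1 - ε)⁻¹ := by rw [hε, sub_sub_cancel, mul_inv, inv_inv, mul_comm z⁻¹, inv_mul_cancel_left₀ ht0]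
    rw [this]
    exact mul_mem htinv h1
  let B : Subfield Ω := { S.toSubring with inv_mem' := hinv }
  have hBS : ∀ z, z ∈ B ↔ z ∈ S := fun z => Iff.rfl
  have hBcl : IsClosed (B : Set Ω) := hcl
  have hmonoB : ∀ t, IsMono F M t → t ∈ B := fun t ht => hle ht.mem_monoAlg
  let _ : NontriviallyNormedField B := NontriviallyNormedField.ofNormNeOne (𝕜 := B) (by
    obtain ⟨x, hx, hx1⟩ := hM
    refine ⟨⟨x, hmonoB _ ⟨1, isAlgebraic_one, one_ne_zero, x, hx, by simp⟩⟩, ?_, hx1⟩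
    simp [Subtype.ext_iff])
  have : CompleteSpace B := hBcl.completeSpace_coe
  let L := algebraicClosure B Ω
  let _ : NormedAlgebra B L :=
    { (inferInstance : Algebra B L) with
      norm_smul_le := fun b l => by
        rw [Algebra.smul_def]; exact (norm_mul_le _ _) }
  have : IsUltrametricDist B := inferInstance
  have halg : IsAlgebraic B h := by
    have hlift : p ∈ Polynomial.lifts (algebraMap B Ω) := by
      rw [lifts_iff_coeff_lifts]
      exact fun i => ⟨⟨p.coeff i, hle (hpM i)⟩, rfl⟩
    obtain ⟨q, rfl⟩ := (mem_lifts _).mp hlift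
    exact ⟨q, fun h0 => hp (by rw [h0, Polynomial.map_zero]), by rwa [eval_map_algebraMap] at hph⟩
  have hN : ∀ n : ℕ, n ≠ 0 → ‖(n : B)‖ = 1 := fun n hn => by
    have := H.norm_algebraMap n (by exact_mod_cast hn)
    rwa [map_natCast] at this
  obtain ⟨b, hb⟩ := mem_range_algebraMap_of_forall_exists_norm_sub_lt (K := B) (L := L) hN
    (fun y hy => by
      obtain ⟨t, ht, hlt, -⟩ := H.exists_isMono_norm_sub_lt (z := (y : Ω)) (by simpa using hy)
      exact ⟨⟨t, hmonoB t ht⟩, hlt⟩) ⟨h, mem_algebraicClosure_iff.mpr halg⟩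
  have : (b : Ω) = h := congrArg Subtype.val hb
  rw [← this]
  exact b.2

theorem mem_monoAlg (H : IsMonomialSystem d D M) (hM : ∃ x ∈ M, ‖(x : Ω)‖ ≠ 1)
    {h : Ω} {p : Polynomial Ω} (hp : p ≠ 0) (hpM : ∀ i, p.coeff i ∈ monoAlg F M)
    (hph : p.eval h = 0) {δ : ℝ} (hδ : 0 < δ)
    (hgap : ∀ P ∈ Submodule.span F (Set.range fun i => (D : Ω →ₗ[ℤ] Ω) ^ i), P h ≠ 0 → δ ≤ ‖P h‖) :
    h ∈ monoAlg F M := by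
  have hcl := H.mem_topologicalClosure hM hp hpM hph
  obtain ⟨s, hs, hhs⟩ := Metric.mem_closure_iff.mp hcl δ hδ
  rw [dist_eq_norm] at hhs
  obtain ⟨r, P, hP, hPs⟩ := H.exists_annihilator hs
  refine H.mem_monoAlg_of_apply_eq_zero (span_le_diffOp r hP) ?_
  by_contra hne
  have h1 := hgap _ (add_mem (Submodule.subset_span ⟨r, rfl⟩)
    (Submodule.span_mono (Set.image_subset_range _ _) hP)) hne
  have h2 := H.norm_apply_le (add_mem (pow_mem_diffOp (Nat.lt_succ_self r))
    (diffOp_mono (Nat.le_succ r) (span_le_diffOp r hP))) (h - s)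
  rw [map_sub, hPs, sub_zero] at h2
  linarith

end IsMonomialSystem

theorem mem_of_algebraMap_mem_monoAlg {F L Ω : Type*} [Field F] [Field L] [Field Ω] [CharZero L]
    [Algebra F L] [Algebra L Ω] [Algebra F Ω] [IsScalarTower F L Ω] {M : Subgroup Ωˣ}
    (hM : ∀ x ∈ M, ∃ y : L, algebraMap L Ω y = x) (U : AddSubgroup L)
    (hU : ∀ b y : L, IsAlgebraic F b → (∃ x ∈ M, algebraMap L Ω y = x) → b * y ∈ U)
    {h : L} (hh : algebraMap L Ω h ∈ monoAlg F M) : h ∈ U := by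
  rw [← Subalgebra.mem_toSubmodule, toSubmodule_monoAlg] at hh
  obtain ⟨n, a, x, hax⟩ := Submodule.mem_span_set'.mp hh
  have hy : ∀ i, ∃ y : L, algebraMap L Ω y = x i ∧ ∃ z ∈ M, algebraMap L Ω y = z := fun i => by
    obtain ⟨z, hz, hzx⟩ := (x i).2
    obtain ⟨y, hy⟩ := hM z hz
    exact ⟨y, hy.trans hzx, z, hz, hy⟩
  choose y hy hyM using hy
  have halg : ∀ i, IsIntegral F (a i : Ω) := fun i =>
    (mem_algebraicClosure_iff.mp (a i).2).isIntegral
  let T := IntermediateField.adjoin L (Set.range fun i => (a i : Ω))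
  have : FiniteDimensional L T := IntermediateField.finiteDimensional_adjoin (by
    rintro _ ⟨i, rfl⟩
    exact (halg i).tower_top)
  let b : Fin n → T := fun i => ⟨a i, IntermediateField.subset_adjoin _ _ ⟨i, rfl⟩⟩
  have : IsScalarTower F T Ω := IsScalarTower.of_algebraMap_eq fun c => rfl
  have hb : ∀ i, IsIntegral F (b i) := fun i => by
    have h1 := halg i
    rwa [show (a i : Ω) = algebraMap T Ω (b i) from rfl,
      isIntegral_algebraMap_iff (algebraMap T Ω).injective] at h1
  have hsum : algebraMap L T h = ∑ i, y i • b i := by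
    apply (algebraMap T Ω).injective
    rw [← IsScalarTower.algebraMap_apply, ← hax, map_sum]
    refine Finset.sum_congr rfl fun i _ => ?_
    rw [Algebra.smul_def, Algebra.smul_def, map_mul, ← IsScalarTower.algebraMap_apply, hy, mul_comm]
    rfl
  have htr := congrArg (Algebra.trace L T) hsum
  rw [Algebra.trace_algebraMap, map_sum, nsmul_eq_mul] at htr
  have he : (Module.finrank L T : L) ≠ 0 := by exact_mod_cast Module.finrank_pos.ne'
  have hfin : h = ∑ i, ((Module.finrank L T : L)⁻¹ * Algebra.trace L T (b i)) * y i := by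
    apply mul_left_cancel₀ he
    rw [htr, Finset.mul_sum]
    refine Finset.sum_congr rfl fun i _ => ?_
    rw [map_smul, smul_eq_mul]
    field_simp
  rw [hfin]
  refine sum_mem fun i _ => hU _ _ ?_ (hyM i)
  refine IsAlgebraic.mul (IsAlgebraic.inv ?_) (Algebra.isIntegral_trace (hb i)).isAlgebraic
  have := isAlgebraic_algebraMap (R := F) (A := L) (Module.finrank L T : F)
  rwa [map_natCast] at this

/-- A continuous additive map extending a derivation of a dense subfield is a derivation. -/
noncomputable def Derivation.ofDenseRange {L Ω : Type*} [Field L] [NormedField Ω] [Algebra L Ω]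
    (hdense : DenseRange (algebraMap L Ω)) (D : Derivation ℤ L L) (g : Ω →+ Ω) (hg : Continuous g)
    (h : ∀ z : L, g (algebraMap L Ω z) = algebraMap L Ω (D z)) : Derivation ℤ Ω Ω :=
  Derivation.mk' g.toIntLinearMap fun a b => by
    refine hdense.induction_on₂ (p := fun a b : Ω => g (a * b) = a * g b + b * g a)
      (isClosed_eq (by fun_prop) (by fun_prop)) (fun a b => ?_) a b
    rw [← map_mul, h, h, h, D.leibniz, smul_eq_mul, smul_eq_mul, map_add, map_mul, map_mul]

theorem mem_of_monomial_approximation_of_denseRange {F L Ω : Type*} [Field F] [NormedField L]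
    [NormedField Ω] [CompleteSpace Ω] [Algebra L Ω] [Algebra F Ω] [CharZero F]
    [CharZero L]
    [IsUltrametricDist L] [Algebra F L] {d : Derivation ℤ F F} {D : Derivation ℤ L L}
    (hFL : ∀ a : F, algebraMap F Ω a = algebraMap L Ω (algebraMap F L a))
    (hnorm : ∀ z : L, ‖algebraMap L Ω z‖ = ‖z‖) (hdense : DenseRange (algebraMap L Ω))
    (g : Ω →+ Ω) (hg : Continuous g)
    (hgc : ∀ z : L, g (algebraMap L Ω z) = algebraMap L Ω (D z))
    {M : Subgroup Lˣ} (hd : ∀ a : F, D (algebraMap F L a) = algebraMap F L (d a))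
    (hD : ∀ z : L, ‖D z‖ ≤ ‖z‖)
    (hF : ∀ a : F, a ≠ 0 → ‖algebraMap F L a‖ = 1)
    (hM : ∀ x ∈ M, ∃ γ : F, D (x : L) = algebraMap F L γ * x)
    (hFM : ∀ a : F, a ≠ 0 → ∀ x ∈ M,
      (x : L) * algebraMap F L (d a) = algebraMap F L a * D (x : L) → ‖(x : L)‖ = 1)
    (happrox : ∀ z : L, z ≠ 0 → ∃ x ∈ M, ‖z‖ = ‖(x : L)‖ ∧
      ∃ p : (algebraicClosure F L)[X], p ≠ 0 ∧ ‖aeval (z / x) p‖ < 1)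
    (hMne : ∃ x ∈ M, ‖(x : L)‖ ≠ 1)
    {h : L} {p : L[X]} (hp : p ≠ 0)
    (hpM : ∀ i, p.coeff i ∈ Algebra.adjoin F {y : L | ∃ x ∈ M, y = x})
    (hph : p.eval h = 0) {δ : ℝ} (hδ : 0 < δ)
    (hgap : ∀ P ∈ Submodule.span F (Set.range fun i => (D : L →ₗ[ℤ] L) ^ i), P h ≠ 0 → δ ≤ ‖P h‖)
    (U : AddSubgroup L)
    (hU : ∀ b y : L, IsAlgebraic F b → (∃ x ∈ M, y = x) → b * y ∈ U) : h ∈ U := by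
  let D' : Derivation ℤ Ω Ω := Derivation.ofDenseRange hdense D g hg hgc
  have hD'cont : Continuous D' := hg
  have hD'c : ∀ z : L, D' (algebraMap L Ω z) = algebraMap L Ω (D z) := hgc
  have htower : IsScalarTower F L Ω := IsScalarTower.of_algebraMap_eq hFL
  have : CharZero Ω := charZero_of_injective_algebraMap (algebraMap L Ω).injective
  have hcontL : Continuous (algebraMap L Ω) :=
    AddMonoidHomClass.continuous_of_bound _ 1 fun z => by rw [hnorm, one_mul]
  have hult : IsUltrametricDist Ω :=
    IsUltrametricDist.isUltrametricDist_of_forall_norm_add_le_max_norm fun x y =>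
      hdense.induction_on₂ (p := fun x y : Ω => ‖x + y‖ ≤ max ‖x‖ ‖y‖)
        (isClosed_le (by fun_prop) (by fun_prop)) (fun x y => by
          rw [← map_add, hnorm, hnorm, hnorm]
          exact IsUltrametricDist.norm_add_le_max x y) x y
  let M' := M.map (Units.map (algebraMap L Ω : L →* Ω))
  have hM' : ∀ x ∈ M', ∃ y ∈ M, (x : Ω) = algebraMap L Ω y := by
    rintro _ ⟨y, hy, rfl⟩
    exact ⟨y, hy, rfl⟩
  have hM'' : ∀ y ∈ M, ∃ x ∈ M', (x : Ω) = algebraMap L Ω y := fun y hy => ⟨_, ⟨y, hy, rfl⟩, rfl⟩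
  obtain ⟨x₁, hx₁, hx₁n⟩ := hMne
  have H : IsMonomialSystem (Ω := Ω) d D' M' :=
    { map_d := fun a => by
        rw [IsScalarTower.algebraMap_apply F L Ω, hD'c, hd, ← IsScalarTower.algebraMap_apply]
      norm_D_le := fun z => by
        refine hdense.induction_on (p := fun z : Ω => ‖D' z‖ ≤ ‖z‖) z
          (isClosed_le (by fun_prop) (by fun_prop)) fun z => ?_
        rw [hD'c, hnorm, hnorm]
        exact hD z
      norm_algebraMap := fun a ha => by
        rw [IsScalarTower.algebraMap_apply F L Ω, hnorm, hF a ha]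
      exists_D_eq := fun x hx => by
        obtain ⟨y, hy, hxy⟩ := hM' x hx
        obtain ⟨γ, hγ⟩ := hM y hy
        refine ⟨γ, ?_⟩
        rw [hxy, hD'c, hγ, map_mul, ← IsScalarTower.algebraMap_apply]
      norm_eq_one := fun a ha x hx heq => by
        obtain ⟨y, hy, hxy⟩ := hM' x hx
        rw [hxy, hnorm]
        refine hFM a ha y hy ?_
        rw [hxy, hD'c, IsScalarTower.algebraMap_apply F L Ω, IsScalarTower.algebraMap_apply F L Ω,
          ← map_mul, ← map_mul] at heq
        exact (algebraMap L Ω).injective heq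
      exists_norm_sub_lt := fun z hz => by
        let _ : NontriviallyNormedField Ω := NontriviallyNormedField.ofNormNeOne (𝕜 := Ω)
          ⟨algebraMap L Ω x₁, by simp, by rwa [hnorm]⟩
        obtain ⟨w, hw⟩ : ∃ w : L, ‖z - algebraMap L Ω w‖ < ‖z‖ := by
          obtain ⟨_, ⟨w, rfl⟩, hw⟩ := Metric.mem_closure_iff.mp
            (hdense.closure_range ▸ Set.mem_univ z)
            ‖z‖ (norm_pos_iff.mpr hz)
          exact ⟨w, by rwa [dist_eq_norm] at hw⟩
        have hwz : ‖w‖ = ‖z‖ := by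
          have := IsUltrametricDist.norm_add_eq_max_of_norm_ne_norm
            (x := algebraMap L Ω w - z) (y := z) (by rw [norm_sub_rev]; exact hw.ne)
          rwa [sub_add_cancel, norm_sub_rev, max_eq_right hw.le, hnorm] at this
        have hw0 : w ≠ 0 := by
          rintro rfl
          rw [norm_zero] at hwz
          exact hz (norm_eq_zero.mp hwz.symm)
        obtain ⟨x, hx, hwx, q, hq, hqlt⟩ := happrox w hw0
        have : IsScalarTower F (algebraicClosure F L) Ω :=
          IsScalarTower.of_algebraMap_eq fun c => by
            rw [IsScalarTower.algebraMap_apply F L Ω]; rfl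
        obtain ⟨a, ha, halt⟩ := exists_isAlgebraic_norm_sub_lt_one (F := algebraicClosure F L)
          (Ω := Ω) (fun a ha => by
            rw [IsScalarTower.algebraMap_apply _ L Ω, hnorm]
            exact norm_eq_one_of_isAlgebraic hF (mem_algebraicClosure_iff.mp a.2) (by simpa using ha))
          (u := algebraMap L Ω (w / x)) hq (by rwa [aeval_algebraMap_apply, hnorm])
        replace ha : IsAlgebraic F a := ha.restrictScalars F
        obtain ⟨x', hx', hxx'⟩ := hM'' x hx
        refine ⟨a, ha, x', hx', ?_⟩
        have h1 : z - a * x' = (z - algebraMap L Ω w) +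
            (algebraMap L Ω (w / x) - a) * algebraMap L Ω x := by
          rw [hxx', sub_mul, ← map_mul, div_mul_cancel₀ _ x.ne_zero]; ring
        rw [h1]
        refine (IsUltrametricDist.norm_add_le_max _ _).trans_lt (max_lt hw ?_)
        rw [norm_mul, hnorm, ← hwx, hwz]
        exact mul_lt_of_lt_one_left (norm_pos_iff.mpr hz) halt }
  have hadj : ∀ z ∈ Algebra.adjoin F {y : L | ∃ x ∈ M, y = x}, algebraMap L Ω z ∈ monoAlg F M' := by
    intro z hz
    induction hz using Algebra.adjoin_induction with
    | mem y hy =>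
      obtain ⟨x, hx, rfl⟩ := hy
      obtain ⟨x', hx', hxx'⟩ := hM'' x hx
      rw [← hxx']
      exact IsMono.mem_monoAlg ⟨1, isAlgebraic_one, one_ne_zero, x', hx', by simp⟩
    | algebraMap r =>
      rw [← IsScalarTower.algebraMap_apply]
      exact (monoAlg F M').algebraMap_mem ⟨algebraMap F Ω r,
        mem_algebraicClosure_iff.mpr (isAlgebraic_algebraMap r)⟩
    | add x y _ _ hx hy => rw [map_add]; exact add_mem hx hy
    | mul x y _ _ hx hy => rw [map_mul]; exact mul_mem hx hy
  obtain ⟨x₁', hx₁', hxx₁⟩ := hM'' x₁ hx₁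
  have hmem := H.mem_monoAlg ⟨x₁', hx₁', by rwa [hxx₁, hnorm]⟩ (h := algebraMap L Ω h)
    (p := p.map (algebraMap L Ω)) ((Polynomial.map_ne_zero_iff (algebraMap L Ω).injective).mpr hp)
    (fun i => by rw [coeff_map]; exact hadj _ (hpM i))
    (by rw [eval_map_apply, hph, map_zero]) hδ (by
      have hlift : ∀ P ∈ Submodule.span F (Set.range fun i => (D' : Ω →ₗ[ℤ] Ω) ^ i),
          ∃ Q ∈ Submodule.span F (Set.range fun i => (D : L →ₗ[ℤ] L) ^ i),
            P (algebraMap L Ω h) = algebraMap L Ω (Q h) := by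
        intro P hP
        induction hP using Submodule.span_induction with
        | mem x hx =>
          obtain ⟨i, rfl⟩ := hx
          refine ⟨_, Submodule.subset_span ⟨i, rfl⟩, ?_⟩
          induction i with
          | zero => rfl
          | succ i ih =>
            simp only [pow_succ', Module.End.mul_apply] at ih ⊢
            rw [ih]
            exact hD'c _
        | zero => exact ⟨0, zero_mem _, by simp⟩
        | add x y _ _ hx hy =>
          obtain ⟨P, hP, h⟩ := hx
          obtain ⟨Q, hQ, h'⟩ := hy
          exact ⟨P + Q, add_mem hP hQ, by rw [LinearMap.add_apply, h, h', ← map_add]; rfl⟩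
        | smul c x _ hx =>
          obtain ⟨P, hP, h⟩ := hx
          refine ⟨c • P, Submodule.smul_mem _ _ hP, ?_⟩
          rw [LinearMap.smul_apply, h, LinearMap.smul_apply, Algebra.smul_def, Algebra.smul_def,
            map_mul, ← IsScalarTower.algebraMap_apply]
      intro P hP hne
      obtain ⟨Q, hQ, hPQ⟩ := hlift P hP
      rw [hPQ] at hne ⊢
      rw [hnorm]
      exact hgap Q hQ fun h0 => hne (by rw [h0, map_zero]))
  refine mem_of_algebraMap_mem_monoAlg (F := F) (M := M') (fun x hx => ?_) U (fun b y hb hy => ?_) hmem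
  · obtain ⟨y, -, hxy⟩ := hM' x hx
    exact ⟨y, hxy.symm⟩
  · obtain ⟨x, hx, hyx⟩ := hy
    obtain ⟨y', hy', hxy⟩ := hM' x hx
    exact hU b y hb ⟨y', hy', (algebraMap L Ω).injective (hyx.trans hxy)⟩

theorem mem_of_monomial_approximation {F L : Type*} [Field F] [NormedField L] [CharZero F]
    [CharZero L]
    [IsUltrametricDist L] [Algebra F L] {d : Derivation ℤ F F} {D : Derivation ℤ L L}
    {M : Subgroup Lˣ} (hd : ∀ a : F, D (algebraMap F L a) = algebraMap F L (d a))
    (hD : ∀ z : L, ‖D z‖ ≤ ‖z‖)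
    (hF : ∀ a : F, a ≠ 0 → ‖algebraMap F L a‖ = 1)
    (hM : ∀ x ∈ M, ∃ γ : F, D (x : L) = algebraMap F L γ * x)
    (hFM : ∀ a : F, a ≠ 0 → ∀ x ∈ M,
      (x : L) * algebraMap F L (d a) = algebraMap F L a * D (x : L) → ‖(x : L)‖ = 1)
    (happrox : ∀ z : L, z ≠ 0 → ∃ x ∈ M, ‖z‖ = ‖(x : L)‖ ∧
      ∃ p : (algebraicClosure F L)[X], p ≠ 0 ∧ ‖aeval (z / x) p‖ < 1)
    (hMne : ∃ x ∈ M, ‖(x : L)‖ ≠ 1)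
    {h : L} {p : L[X]} (hp : p ≠ 0)
    (hpM : ∀ i, p.coeff i ∈ Algebra.adjoin F {y : L | ∃ x ∈ M, y = x})
    (hph : p.eval h = 0) {δ : ℝ} (hδ : 0 < δ)
    (hgap : ∀ P ∈ Submodule.span F (Set.range fun i => (D : L →ₗ[ℤ] L) ^ i), P h ≠ 0 → δ ≤ ‖P h‖)
    (U : AddSubgroup L)
    (hU : ∀ b y : L, IsAlgebraic F b → (∃ x ∈ M, y = x) → b * y ∈ U) : h ∈ U := by
  have hcont : Continuous D :=
    AddMonoidHomClass.continuous_of_bound D 1 fun z => by simpa using hD z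
  let Ω := UniformSpace.Completion L
  let _ : Algebra F Ω := ((algebraMap L Ω).comp (algebraMap F L)).toAlgebra
  exact mem_of_monomial_approximation_of_denseRange (Ω := Ω) (fun _ => rfl)
    UniformSpace.Completion.norm_coe UniformSpace.Completion.denseRange_coe
    ((D : L →ₗ[ℤ] L).toAddMonoidHom.completion hcont) (AddMonoidHom.continuous_completion _ hcont)
    (AddMonoidHom.completion_coe _ hcont) hd hD hF hM hFM happrox hMne hp hpM hph hδ hgap U hU

namespace RatFunc

variable {k : Type*} [Field k]

local notation "ι" => algebraMap (Polynomial k) (RatFunc k)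

theorem exists_div (z : RatFunc k) : ∃ p q : k[X], q ≠ 0 ∧ z = ι p / ι q :=
  ⟨z.num, z.denom, z.denom_ne_zero, z.num_div_denom.symm⟩

theorem div_eq_div_iff_mul {p q p' q' : k[X]} (hq : q ≠ 0) (hq' : q' ≠ 0) :
    ι p / ι q = ι p' / ι q' ↔ p * q' = p' * q := by
  rw [div_eq_div_iff (RatFunc.algebraMap_ne_zero hq) (RatFunc.algebraMap_ne_zero hq'), ← map_mul,
    ← map_mul]
  exact (RatFunc.algebraMap_injective k).eq_iff

/-- The order of vanishing at `0`, with value `0` at `0`. -/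
noncomputable def ordZero (z : RatFunc k) : ℤ :=
  z.num.natTrailingDegree - z.denom.natTrailingDegree

theorem ordZero_div {p q : k[X]} (hp : p ≠ 0) (hq : q ≠ 0) :
    ordZero (ι p / ι q) = p.natTrailingDegree - q.natTrailingDegree := by
  set z := ι p / ι q with hz
  have hz0 : z ≠ 0 := div_ne_zero (RatFunc.algebraMap_ne_zero hp) (RatFunc.algebraMap_ne_zero hq)
  have h := (div_eq_div_iff_mul z.denom_ne_zero hq).mp (z.num_div_denom.trans hz)
  have h2 := congrArg natTrailingDegree h
  rw [natTrailingDegree_mul (num_ne_zero hz0) hq, natTrailingDegree_mul hp z.denom_ne_zero] at h2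
  rw [ordZero]
  omega

theorem ordZero_algebraMap (p : k[X]) : ordZero (ι p) = p.natTrailingDegree := by
  by_cases hp : p = 0
  · simp [hp, ordZero]
  · simpa using ordZero_div hp (one_ne_zero (α := k[X]))

theorem ordZero_C (c : k) : ordZero (RatFunc.C c) = 0 := by
  rw [← RatFunc.algebraMap_C, ordZero_algebraMap]; simp

theorem ordZero_mul {z w : RatFunc k} (hz : z ≠ 0) (hw : w ≠ 0) :
    ordZero (z * w) = ordZero z + ordZero w := by
  obtain ⟨p, q, hq, rfl⟩ := exists_div z
  obtain ⟨p', q', hq', rfl⟩ := exists_div w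
  have hp : p ≠ 0 := by rintro rfl; simp at hz
  have hp' : p' ≠ 0 := by rintro rfl; simp at hw
  rw [div_mul_div_comm, ← map_mul, ← map_mul, ordZero_div (mul_ne_zero hp hp') (mul_ne_zero hq hq'),
    ordZero_div hp hq, ordZero_div hp' hq', natTrailingDegree_mul hp hp',
    natTrailingDegree_mul hq hq']
  push_cast; ring

theorem min_ordZero_le_ordZero_add {z w : RatFunc k} (hz : z ≠ 0) (hw : w ≠ 0) (h : z + w ≠ 0) :
    min (ordZero z) (ordZero w) ≤ ordZero (z + w) := by
  obtain ⟨p, q, hq, rfl⟩ := exists_div z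
  obtain ⟨p', q', hq', rfl⟩ := exists_div w
  have hp : p ≠ 0 := by rintro rfl; simp at hz
  have hp' : p' ≠ 0 := by rintro rfl; simp at hw
  rw [div_add_div _ _ (RatFunc.algebraMap_ne_zero hq) (RatFunc.algebraMap_ne_zero hq'), ← map_mul,
    ← map_mul, ← map_mul, ← map_add] at h ⊢
  have hs : p * q' + q * p' ≠ 0 := by
    intro h0
    rw [h0] at h
    simp at h
  rw [ordZero_div hs (mul_ne_zero hq hq'), ordZero_div hp hq, ordZero_div hp' hq',
    natTrailingDegree_mul hq hq']
  have h1 : min (p * q').natTrailingDegree (q * p').natTrailingDegree ≤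
      (p * q' + q * p').natTrailingDegree := by
    refine le_natTrailingDegree hs fun m hm => ?_
    rw [coeff_add, coeff_eq_zero_of_lt_natTrailingDegree (lt_of_lt_of_le hm (min_le_left _ _)),
      coeff_eq_zero_of_lt_natTrailingDegree (lt_of_lt_of_le hm (min_le_right _ _)), add_zero]
  rw [natTrailingDegree_mul hp hq', natTrailingDegree_mul hq hp'] at h1
  omega

theorem ordZero_X_zpow (n : ℤ) : ordZero ((RatFunc.X : RatFunc k) ^ n) = n := by
  have hnat : ∀ m : ℕ, ordZero ((RatFunc.X : RatFunc k) ^ m) = m := fun m => by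
    rw [← RatFunc.algebraMap_X, ← map_pow, ordZero_algebraMap]; simp
  have h1 := ordZero_mul (k := k) (z := RatFunc.X ^ n) (w := RatFunc.X ^ (-n))
    (zpow_ne_zero _ RatFunc.X_ne_zero) (zpow_ne_zero _ RatFunc.X_ne_zero)
  rw [← zpow_add₀ RatFunc.X_ne_zero, add_neg_cancel, zpow_zero] at h1
  have h2 : ordZero (1 : RatFunc k) = 0 := by simpa using hnat 0
  rcases le_total 0 n with h | h
  · lift n to ℕ using h
    exact_mod_cast hnat n
  · obtain ⟨m, hm⟩ := Int.eq_ofNat_of_zero_le (show 0 ≤ -n by omega)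
    rw [hm, zpow_natCast, hnat, h2] at h1
    omega

/-- The derivation `x d/dx` on polynomials. -/
noncomputable def eulerPoly : k[X] →+ k[X] :=
  (AddMonoidHom.mulLeft (Polynomial.X : k[X])).comp (Polynomial.derivative (R := k)).toAddMonoidHom

theorem eulerPoly_apply (p : k[X]) : eulerPoly p = Polynomial.X * derivative p := rfl

theorem eulerPoly_mul (p q : k[X]) : eulerPoly (p * q) = p * eulerPoly q + q * eulerPoly p := by
  simp only [eulerPoly_apply, derivative_mul]
  ring

theorem coeff_eulerPoly (p : k[X]) (n : ℕ) : (eulerPoly p).coeff n = n * p.coeff n := by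
  rw [eulerPoly_apply]
  rcases n with _ | n
  · simp
  · rw [coeff_X_mul, coeff_derivative]; push_cast; ring

theorem natDegree_eulerPoly_le (p : k[X]) : (eulerPoly p).natDegree ≤ p.natDegree := by
  rw [natDegree_le_iff_coeff_eq_zero]
  intro n hn
  rw [coeff_eulerPoly, coeff_eq_zero_of_natDegree_lt hn, mul_zero]

theorem natTrailingDegree_le_eulerPoly {p : k[X]} (h : eulerPoly p ≠ 0) :
    p.natTrailingDegree ≤ (eulerPoly p).natTrailingDegree :=
  le_natTrailingDegree h fun m hm => by
    rw [coeff_eulerPoly, coeff_eq_zero_of_lt_natTrailingDegree hm, mul_zero]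

theorem euler_div_eq_of_div_eq {p q p' q' : k[X]} (hq : q ≠ 0) (hq' : q' ≠ 0) (h : ι p / ι q = ι p' / ι q') :
    ι (eulerPoly p * q - p * eulerPoly q) / ι (q * q) =
      ι (eulerPoly p' * q' - p' * eulerPoly q') / ι (q' * q') := by
  rw [div_eq_div_iff_mul hq hq'] at h
  rw [div_eq_div_iff_mul (mul_ne_zero hq hq) (mul_ne_zero hq' hq')]
  have h1 := congrArg eulerPoly h
  rw [eulerPoly_mul, eulerPoly_mul] at h1
  linear_combination (q * q') * h1 - (eulerPoly q * q' + q * eulerPoly q') * h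

/-- The map `x d/dx` on rational functions. -/
noncomputable def eulerFun (z : RatFunc k) : RatFunc k :=
  ι (eulerPoly z.num * z.denom - z.num * eulerPoly z.denom) / ι (z.denom * z.denom)

theorem eulerFun_div {p q : k[X]} (hq : q ≠ 0) :
    eulerFun (ι p / ι q) = ι (eulerPoly p * q - p * eulerPoly q) / ι (q * q) :=
  euler_div_eq_of_div_eq (denom_ne_zero _) hq (num_div_denom _)

/-- The derivation `x d/dx` on rational functions. -/
noncomputable def euler : RatFunc k →+ RatFunc k where
  toFun := eulerFun
  map_zero' := by
    have := eulerFun_div (k := k) (p := 0) one_ne_zero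
    simpa using this
  map_add' z w := by
    obtain ⟨p, q, hq, rfl⟩ := exists_div z
    obtain ⟨p', q', hq', rfl⟩ := exists_div w
    have h1 := RatFunc.algebraMap_ne_zero hq
    have h2 := RatFunc.algebraMap_ne_zero hq'
    rw [div_add_div _ _ h1 h2, ← map_mul, ← map_mul, ← map_mul, ← map_add,
      eulerFun_div (mul_ne_zero hq hq'), eulerFun_div hq, eulerFun_div hq']
    simp only [map_add, map_sub, map_mul, eulerPoly_mul]
    field_simp
    ring

theorem euler_mul (z w : RatFunc k) : euler (z * w) = z * euler w + w * euler z := by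
  change eulerFun (z * w) = z * eulerFun w + w * eulerFun z
  obtain ⟨p, q, hq, rfl⟩ := exists_div z
  obtain ⟨p', q', hq', rfl⟩ := exists_div w
  have h1 := RatFunc.algebraMap_ne_zero hq
  have h2 := RatFunc.algebraMap_ne_zero hq'
  rw [div_mul_div_comm, ← map_mul, ← map_mul,
    eulerFun_div (mul_ne_zero hq hq'), eulerFun_div hq, eulerFun_div hq']
  simp only [map_add, map_sub, map_mul, eulerPoly_mul]
  field_simp
  ring

theorem euler_div {p q : k[X]} (hq : q ≠ 0) :
    euler (ι p / ι q) = ι (eulerPoly p * q - p * eulerPoly q) / ι (q * q) :=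
  eulerFun_div hq

theorem euler_algebraMap (p : k[X]) : euler (ι p) = ι (eulerPoly p) := by
  have := euler_div (k := k) (p := p) one_ne_zero
  simpa [eulerPoly_apply] using this

theorem ordZero_le_ordZero_euler {z : RatFunc k} (h : euler z ≠ 0) :
    ordZero z ≤ ordZero (euler z) := by
  obtain ⟨p, q, hq, rfl⟩ := exists_div z
  have hp : p ≠ 0 := by rintro rfl; simp at h
  rw [euler_div hq] at h ⊢
  have hs : eulerPoly p * q - p * eulerPoly q ≠ 0 := by
    intro h0
    rw [h0] at h
    simp at h
  rw [ordZero_div hs (mul_ne_zero hq hq), ordZero_div hp hq, natTrailingDegree_mul hq hq]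
  have h1 : p.natTrailingDegree + q.natTrailingDegree ≤
      (eulerPoly p * q - p * eulerPoly q).natTrailingDegree := by
    refine le_natTrailingDegree hs fun m hm => ?_
    have h2 : (eulerPoly p * q).coeff m = 0 := by
      by_cases h0 : eulerPoly p = 0
      · simp [h0]
      · refine coeff_eq_zero_of_lt_natTrailingDegree (hm.trans_le ?_)
        rw [natTrailingDegree_mul h0 hq]
        exact Nat.add_le_add_right (natTrailingDegree_le_eulerPoly h0) _
    have h3 : (p * eulerPoly q).coeff m = 0 := by
      by_cases h0 : eulerPoly q = 0
      · simp [h0]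
      · refine coeff_eq_zero_of_lt_natTrailingDegree (hm.trans_le ?_)
        rw [natTrailingDegree_mul hp h0]
        exact Nat.add_le_add_left (natTrailingDegree_le_eulerPoly h0) _
    rw [coeff_sub, h2, h3, sub_zero]
  omega

theorem euler_C (c : k) : euler (RatFunc.C c) = 0 := by
  rw [← RatFunc.algebraMap_C, euler_algebraMap, eulerPoly_apply]; simp

theorem euler_X_pow (n : ℕ) :
    euler ((RatFunc.X : RatFunc k) ^ n) = RatFunc.C (n : k) * RatFunc.X ^ n := by
  rw [← RatFunc.algebraMap_X, ← map_pow, euler_algebraMap, eulerPoly_apply, derivative_X_pow,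
    ← RatFunc.algebraMap_C, ← map_mul]
  congr 1
  rcases n with _ | n
  · simp
  · simp only [add_tsub_cancel_right]; ring

theorem euler_X_zpow (n : ℤ) :
    euler ((RatFunc.X : RatFunc k) ^ n) = RatFunc.C (n : k) * RatFunc.X ^ n := by
  obtain ⟨m, rfl | rfl⟩ := n.eq_nat_or_neg
  · simpa using euler_X_pow (k := k) m
  · have h0 : (RatFunc.X : RatFunc k) ^ m ≠ 0 := pow_ne_zero _ RatFunc.X_ne_zero
    have h := euler_mul (k := k) (RatFunc.X ^ m) (RatFunc.X ^ (-(m : ℤ)))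
    rw [zpow_neg, zpow_natCast, mul_inv_cancel₀ h0, euler_X_pow,
      ← map_one (RatFunc.C (K := k)), euler_C] at h
    rw [zpow_neg, zpow_natCast]
    apply mul_left_cancel₀ h0
    push_cast
    rw [map_neg]
    linear_combination -h

theorem exists_C_of_euler_eq_zero [CharZero k] {z : RatFunc k} (h : euler z = 0) :
    ∃ c, z = RatFunc.C c := by
  have hq := z.denom_ne_zero
  rw [← z.num_div_denom, euler_div hq] at h
  have h1 : eulerPoly z.num * z.denom - z.num * eulerPoly z.denom = 0 := by
    rcases div_eq_zero_iff.mp h with h | h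
    · exact (map_eq_zero_iff _ (RatFunc.algebraMap_injective k)).mp h
    · exact absurd h (RatFunc.algebraMap_ne_zero (mul_ne_zero hq hq))
  have h2 : derivative z.num * z.denom = z.num * derivative z.denom := by
    refine mul_left_cancel₀ (Polynomial.X_ne_zero (R := k)) ?_
    rw [eulerPoly_apply, eulerPoly_apply] at h1
    linear_combination h1
  have key : ∀ p : k[X], p ∣ derivative p → ∃ c, p = Polynomial.C c := fun p hp => by
    refine ⟨_, eq_C_of_derivative_eq_zero ?_⟩
    by_contra h0
    have hp0 : p ≠ 0 := by rintro rfl; simp at h0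
    exact absurd (degree_le_of_dvd hp h0) (not_le.mpr (degree_derivative_lt hp0))
  have hcop := z.isCoprime_num_denom
  obtain ⟨a, ha⟩ := key z.num (hcop.dvd_of_dvd_mul_right ⟨_, h2⟩)
  obtain ⟨b, hb⟩ := key z.denom (hcop.symm.dvd_of_dvd_mul_left ⟨derivative z.num, by rw [← h2, mul_comm]⟩)
  refine ⟨a / b, ?_⟩
  rw [← z.num_div_denom, ha, hb, RatFunc.algebraMap_C, RatFunc.algebraMap_C, map_div₀]

/-- A rational function which is a polynomial of degree at most `n`. -/
def IsPolyOfDegreeLE (z : RatFunc k) (n : ℤ) : Prop :=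
  ∃ p : k[X], z = ι p ∧ (p.natDegree : ℤ) ≤ n

namespace IsPolyOfDegreeLE

variable {z w : RatFunc k} {m n : ℤ}

theorem mono (h : IsPolyOfDegreeLE z m) (hmn : m ≤ n) : IsPolyOfDegreeLE z n := by
  obtain ⟨p, rfl, hp⟩ := h
  exact ⟨p, rfl, hp.trans hmn⟩

theorem add (h : IsPolyOfDegreeLE z n) (h' : IsPolyOfDegreeLE w n) :
    IsPolyOfDegreeLE (z + w) n := by
  obtain ⟨p, rfl, hp⟩ := h
  obtain ⟨q, rfl, hq⟩ := h'
  refine ⟨p + q, (map_add _ _ _).symm, ?_⟩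
  have := natDegree_add_le p q
  rcases le_max_iff.mp this with h | h <;> omega

theorem mul (h : IsPolyOfDegreeLE z m) (h' : IsPolyOfDegreeLE w n) :
    IsPolyOfDegreeLE (z * w) (m + n) := by
  obtain ⟨p, rfl, hp⟩ := h
  obtain ⟨q, rfl, hq⟩ := h'
  refine ⟨p * q, (map_mul _ _ _).symm, ?_⟩
  have := natDegree_mul_le (p := p) (q := q)
  omega

theorem euler (h : IsPolyOfDegreeLE z n) : IsPolyOfDegreeLE (euler z) n := by
  obtain ⟨p, rfl, hp⟩ := h
  refine ⟨eulerPoly p, euler_algebraMap p, ?_⟩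
  have := natDegree_eulerPoly_le p
  omega

theorem C (c : k) (hn : 0 ≤ n) : IsPolyOfDegreeLE (RatFunc.C c) n :=
  ⟨Polynomial.C c, (RatFunc.algebraMap_C c).symm, by simpa using hn⟩

theorem X_zpow (hm : 0 ≤ m) (hmn : m ≤ n) : IsPolyOfDegreeLE ((RatFunc.X : RatFunc k) ^ m) n := by
  lift m to ℕ using hm
  exact ⟨Polynomial.X ^ m, by simp, by simpa using hmn⟩

theorem ordZero_nonneg (h : IsPolyOfDegreeLE z n) : 0 ≤ ordZero z := by
  obtain ⟨p, rfl, hp⟩ := h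
  rw [ordZero_algebraMap]
  positivity

theorem ordZero_le (h : IsPolyOfDegreeLE z n) : ordZero z ≤ n := by
  obtain ⟨p, rfl, hp⟩ := h
  rw [ordZero_algebraMap]
  have := natTrailingDegree_le_natDegree p
  omega

theorem of_monic (m : ℕ) (c : ℕ → RatFunc k)
    (hc : ∀ i < m, IsPolyOfDegreeLE (c i) n) (hn : 0 ≤ n)
    (h : z ^ m + ∑ i ∈ Finset.range m, c i * z ^ i = 0) : IsPolyOfDegreeLE z n := by
  choose! p hp hpn using hc
  have hrel : z ^ m + ∑ i ∈ Finset.range m, ι (p i) * z ^ i = 0 := by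
    rw [← h]
    congr 1
    exact Finset.sum_congr rfl fun i hi => by rw [hp i (Finset.mem_range.mp hi)]
  have hintegral : IsIntegral k[X] z := by
    refine ⟨Polynomial.X ^ m + ∑ i ∈ Finset.range m, Polynomial.C (p i) * Polynomial.X ^ i,
      monic_X_pow_add ?_, ?_⟩
    · refine lt_of_le_of_lt (degree_sum_le _ _) ?_
      refine (Finset.sup_lt_iff (WithBot.bot_lt_coe m)).mpr fun i hi => ?_
      refine lt_of_le_of_lt (degree_C_mul_X_pow_le _ _) ?_
      exact Nat.cast_lt.mpr (Finset.mem_range.mp hi)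
    · simpa [eval₂_finsetSum] using hrel
  obtain ⟨r, hr⟩ := IsIntegrallyClosed.isIntegral_iff.mp hintegral
  refine ⟨r, hr.symm, ?_⟩
  by_contra! hlt
  have h1 : r ^ m + ∑ i ∈ Finset.range m, p i * r ^ i = 0 := by
    apply RatFunc.algebraMap_injective k
    simpa [hr] using hrel
  have hr0 : r ≠ 0 := by rintro rfl; simp at hlt; omega
  have hm : m ≠ 0 := by rintro rfl; simp at h1
  have h2 : (∑ i ∈ Finset.range m, p i * r ^ i).degree < (r ^ m).degree := by
    refine lt_of_le_of_lt (degree_sum_le _ _) ?_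
    rw [Finset.sup_lt_iff (bot_lt_iff_ne_bot.mpr (degree_ne_bot.mpr (pow_ne_zero _ hr0)))]
    intro i hi
    have hi := Finset.mem_range.mp hi
    rw [degree_eq_natDegree (pow_ne_zero _ hr0), natDegree_pow]
    refine lt_of_le_of_lt degree_le_natDegree ?_
    refine Nat.cast_lt.mpr (lt_of_le_of_lt natDegree_mul_le ?_)
    rw [natDegree_pow]
    have h3 : (p i).natDegree < r.natDegree := by have := hpn i hi; omega
    calc _ < r.natDegree + i * r.natDegree := by omega
      _ = (i + 1) * r.natDegree := by ring
      _ ≤ _ := Nat.mul_le_mul_right _ hi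
  have h4 := degree_add_eq_left_of_degree_lt h2
  rw [h1] at h4
  exact pow_ne_zero m hr0 (degree_eq_bot.mp h4.symm)

end IsPolyOfDegreeLE

end RatFunc

theorem mem_of_monomial_approximation_of_absoluteValue {F L : Type*} [Field F] [Field L]
    [CharZero F] [CharZero L] [Algebra F L] (v : AbsoluteValue L ℝ) (hv : IsNonarchimedean v)
    {d : Derivation ℤ F F} {D : Derivation ℤ L L}
    {M : Subgroup Lˣ} (hd : ∀ a : F, D (algebraMap F L a) = algebraMap F L (d a))
    (hD : ∀ z : L, v (D z) ≤ v z)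
    (hF : ∀ a : F, a ≠ 0 → v (algebraMap F L a) = 1)
    (hM : ∀ x ∈ M, ∃ γ : F, D (x : L) = algebraMap F L γ * x)
    (hFM : ∀ a : F, a ≠ 0 → ∀ x ∈ M,
      (x : L) * algebraMap F L (d a) = algebraMap F L a * D (x : L) → v (x : L) = 1)
    (happrox : ∀ z : L, z ≠ 0 → ∃ x ∈ M, v z = v (x : L) ∧
      ∃ p : (algebraicClosure F L)[X], p ≠ 0 ∧ v (aeval (z / x) p) < 1)
    (hMne : ∃ x ∈ M, v (x : L) ≠ 1)
    {h : L} {p : L[X]} (hp : p ≠ 0)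
    (hpM : ∀ i, p.coeff i ∈ Algebra.adjoin F {y : L | ∃ x ∈ M, y = x})
    (hph : p.eval h = 0) {δ : ℝ} (hδ : 0 < δ)
    (hgap : ∀ P ∈ Submodule.span F (Set.range fun i => (D : L →ₗ[ℤ] L) ^ i), P h ≠ 0 → δ ≤ v (P h))
    (U : AddSubgroup L)
    (hU : ∀ b y : L, IsAlgebraic F b → (∃ x ∈ M, y = x) → b * y ∈ U) : h ∈ U := by
  let _ := v.toNormedField
  have : IsUltrametricDist L := IsUltrametricDist.isUltrametricDist_of_isNonarchimedean_norm hv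
  exact mem_of_monomial_approximation (d := d) (D := D) (M := M) hd hD hF hM hFM happrox hMne hp
    hpM hph hδ hgap U hU

/-- A derivation mapping the image of a field embedding to itself restricts. -/
theorem Derivation.exists_restrict {F R : Type*} [Field F] [Field R] (f : F →+* R)
    (D : Derivation ℤ R R) (h : ∀ a, ∃ b, D (f a) = f b) :
    ∃ d : Derivation ℤ F F, ∀ a, D (f a) = f (d a) := by
  choose g hg using h
  refine ⟨Derivation.mk' (AddMonoidHom.toIntLinearMap ⟨⟨g, ?_⟩, ?_⟩) ?_, hg⟩
  · apply f.injective; rw [← hg, map_zero, map_zero]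
  · intro x y
    apply f.injective
    simp only [← hg, map_add]
  · intro x y
    apply f.injective
    change f (g (x * y)) = f (x * g y + y * g x)
    simp only [← hg, map_add, map_mul, Derivation.leibniz, smul_eq_mul]

theorem Subfield.mem_of_monomial_approximation {Q : Type*} [Field Q] [CharZero Q]
    (D : Derivation ℤ Q Q) {K L : Subfield Q} (hKL : K ≤ L) (hDK : ∀ a ∈ K, D a ∈ K)
    (hDL : ∀ a ∈ L, D a ∈ L) (v : Q → ℝ) (hv0 : v 0 = 0) (hvpos : ∀ z, z ≠ 0 → 0 < v z)
    (hvmul : ∀ z ∈ L, ∀ w ∈ L, v (z * w) = v z * v w)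
    (hvadd : ∀ z ∈ L, ∀ w ∈ L, v (z + w) ≤ max (v z) (v w))
    (hvD : ∀ z ∈ L, v (D z) ≤ v z) (hvK : ∀ a ∈ K, a ≠ 0 → v a = 1)
    (M : Subgroup Qˣ) (hML : ∀ x ∈ M, (x : Q) ∈ L → ∃ γ ∈ K, D (x : Q) = γ * x)
    (hKM : ∀ a ∈ K, a ≠ 0 → ∀ x ∈ M, (x : Q) ∈ L → x * D a = a * D x → v x = 1)
    (happrox : ∀ z ∈ L, z ≠ 0 → ∃ x ∈ M, (x : Q) ∈ L ∧ v z = v x ∧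
      ∃ p : Q[X], p ≠ 0 ∧ (∀ i, p.coeff i ∈ L ∧ IsAlgebraic K (p.coeff i)) ∧
        v (p.eval (z / x)) < 1)
    (hMne : ∃ x ∈ M, (x : Q) ∈ L ∧ v x ≠ 1) {h : Q} (hhL : h ∈ L) {p : Q[X]} (hp : p ≠ 0)
    (hpM : ∀ i, p.coeff i ∈
      Subring.closure {y : Q | ∃ c ∈ K, ∃ x ∈ M, (x : Q) ∈ L ∧ y = c * x})
    (hph : p.eval h = 0) {δ : ℝ} (hδ : 0 < δ)
    (hgap : ∀ P : Module.End ℤ Q,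
      P ∈ Submodule.span K (Set.range fun i => (D : Q →ₗ[ℤ] Q) ^ i) → P h ≠ 0 → δ ≤ v (P h))
    (U : AddSubgroup Q)
    (hU : ∀ b ∈ L, IsAlgebraic K b → ∀ x ∈ M, (x : Q) ∈ L → b * x ∈ U) : h ∈ U := by
  obtain ⟨d, hd⟩ := Derivation.exists_restrict K.subtype D fun a => ⟨⟨D a, hDK a a.2⟩, rfl⟩
  obtain ⟨E, hE⟩ := Derivation.exists_restrict L.subtype D fun a => ⟨⟨D a, hDL a a.2⟩, rfl⟩
  let _ : Algebra K L := (Subfield.inclusion hKL).toAlgebra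
  have _ : IsScalarTower K L Q := IsScalarTower.of_algebraMap_eq fun _ => rfl
  have halg : ∀ b : L, IsAlgebraic K b ↔ IsAlgebraic K (b : Q) := fun b =>
    (isAlgebraic_algebraMap_iff (R := K) (A := Q) (S := L) (algebraMap L Q).injective (a := b)).symm
  let w : AbsoluteValue L ℝ :=
    { toFun := fun z => v z
      map_mul' := fun z w => hvmul z z.2 w w.2
      nonneg' := fun z => by
        by_cases hz : (z : Q) = 0
        · simp [hz, hv0]
        · exact (hvpos z hz).le
      eq_zero' := fun z => by
        refine ⟨fun h => ?_, fun h => by simp [h, hv0]⟩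
        by_contra hz
        exact (hvpos z (by simpa using hz)).ne' h
      add_le' := fun z w => by
        have hnn : ∀ z : L, 0 ≤ v z := fun z => by
          by_cases hz : (z : Q) = 0
          · simp [hz, hv0]
          · exact (hvpos z hz).le
        have := hnn z
        have := hnn w
        exact (hvadd z z.2 w w.2).trans (max_le (by linarith) (by linarith)) }
  let M' : Subgroup Lˣ := M.comap (Units.map (L.subtype : L →* Q))
  have hM'2 : ∀ x ∈ M', ∃ y ∈ M, (y : Q) = ((x : L) : Q) := fun x hx => ⟨_, hx, rfl⟩
  have hM'1 : ∀ x ∈ M, ∀ hx : (x : Q) ∈ L, ∃ y ∈ M', (y : L) = ⟨x, hx⟩ := fun x hx hxL => by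
    have h1 : (⟨x, hxL⟩ : L) ≠ 0 := fun h => x.ne_zero (congrArg Subtype.val h)
    refine ⟨Units.mk0 _ h1, ?_, rfl⟩
    change Units.map (L.subtype : L →* Q) _ ∈ M
    convert hx
    ext; rfl
  obtain ⟨q, hq⟩ : ∃ q : L[X], q.map L.subtype = p := by
    have : p ∈ Polynomial.lifts L.subtype := by
      rw [Polynomial.lifts_iff_coeff_lifts]
      intro i
      have h1 : Subring.closure {y : Q | ∃ c ∈ K, ∃ x ∈ M, (x : Q) ∈ L ∧ y = c * x} ≤ L.toSubring := by
        rw [Subring.closure_le]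
        rintro y ⟨c, hc, x, -, hx, rfl⟩
        exact mul_mem (hKL hc) hx
      exact ⟨⟨_, h1 (hpM i)⟩, rfl⟩
    simpa [Polynomial.mem_lifts] using this
  have hEpow : ∀ i (z : L), ((((E : L →ₗ[ℤ] L) ^ i) z : L) : Q) = ((D : Q →ₗ[ℤ] Q) ^ i) z := by
    intro i
    induction i with
    | zero => intro z; rfl
    | succ i ih =>
      intro z
      rw [pow_succ, pow_succ, Module.End.mul_apply, Module.End.mul_apply, ih]
      congr 1
      exact (hE z).symm
  have key := mem_of_monomial_approximation_of_absoluteValue w (F := K) (L := L)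
    (fun z w => hvadd z z.2 w w.2) (d := d) (D := E) (M := M')
    (fun a => Subtype.ext ((hE _).symm.trans (hd a)))
    (fun z => by
      change v (L.subtype (E z)) ≤ v z
      rw [← hE]; exact hvD z z.2)
    (fun a ha => hvK a a.2 (by simpa using ha))
    (fun x hx => by
      obtain ⟨γ, hγ, h1⟩ := hML _ hx x.val.2
      exact ⟨⟨γ, hγ⟩, Subtype.ext ((hE _).symm.trans h1)⟩)
    (fun a ha x hx hax => by
      refine hKM a a.2 (by simpa using ha) _ hx x.val.2 ?_
      have h1 := congrArg L.subtype hax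
      rw [map_mul, map_mul, ← hE] at h1
      have h2 : L.subtype (algebraMap K L (d a)) = D a := (hd a).symm
      rw [h2] at h1
      exact h1)
    (fun z hz => by
      obtain ⟨x, hx, hxL, hzx, r, hr, hrL, hrz⟩ := happrox z z.2 (by simpa using hz)
      obtain ⟨y, hy, hyx⟩ := hM'1 x hx hxL
      refine ⟨y, hy, hzx.trans (by rw [hyx]; rfl), ?_⟩
      let ρ : algebraicClosure K L →+* Q := L.subtype.comp (algebraMap (algebraicClosure K L) L)
      have : r ∈ Polynomial.lifts ρ := by
        rw [Polynomial.lifts_iff_coeff_lifts]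
        intro i
        refine ⟨⟨⟨_, (hrL i).1⟩, mem_algebraicClosure_iff.mpr ?_⟩, rfl⟩
        exact (halg _).mpr (hrL i).2
      obtain ⟨s, hs⟩ : ∃ s : (algebraicClosure K L)[X], s.map ρ = r := by
        simpa [Polynomial.mem_lifts] using this
      refine ⟨s, fun h0 => hr (by rw [← hs, h0, Polynomial.map_zero]), ?_⟩
      convert hrz using 1
      change v (L.subtype _) = _
      congr 1
      rw [← hs, eval_map, aeval_def, hom_eval₂, map_div₀, hyx]
      rfl)
    (by
      obtain ⟨x, hx, hxL, hne⟩ := hMne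
      obtain ⟨y, hy, hyx⟩ := hM'1 x hx hxL
      exact ⟨y, hy, by rw [hyx]; exact hne⟩)
    (h := ⟨h, hhL⟩) (p := q) (fun h0 => hp (by rw [← hq, h0, Polynomial.map_zero]))
    (fun i => by
      have h1 : Subring.closure {y : Q | ∃ c ∈ K, ∃ x ∈ M, (x : Q) ∈ L ∧ y = c * x} ≤
          (Algebra.adjoin K {y : L | ∃ x ∈ M', y = x}).toSubring.map L.subtype := by
        rw [Subring.closure_le]
        rintro y ⟨c, hc, x, hx, hxL, rfl⟩
        obtain ⟨y, hy, hyx⟩ := hM'1 x hx hxL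
        refine ⟨algebraMap K L ⟨c, hc⟩ * y, mul_mem (Subalgebra.algebraMap_mem _ _)
          (Algebra.subset_adjoin ⟨y, hy, rfl⟩), ?_⟩
        rw [hyx]; rfl
      obtain ⟨y, hy, h2⟩ := h1 (hpM i)
      rw [← hq, coeff_map] at h2
      rw [← Subtype.ext h2]
      exact hy)
    (by
      apply Subtype.ext
      rw [← hq, eval_map] at hph
      rw [← coe_eval₂RingHom] at hph
      change L.subtype (eval ⟨h, hhL⟩ q) = 0
      rw [eval, hom_eval₂]
      exact hph)
    hδ
    (fun P hP => by
      have h1 : ∃ P' : Module.End ℤ Q,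
          P' ∈ Submodule.span K (Set.range fun i => (D : Q →ₗ[ℤ] Q) ^ i) ∧
            ∀ z : L, ((P z : L) : Q) = P' z := by
        induction hP using Submodule.span_induction with
        | mem x hx =>
          obtain ⟨i, rfl⟩ := hx
          exact ⟨_, Submodule.subset_span ⟨i, rfl⟩, hEpow i⟩
        | zero => exact ⟨0, zero_mem _, fun _ => rfl⟩
        | add x y _ _ hx hy =>
          obtain ⟨P, hP, h1⟩ := hx
          obtain ⟨R, hR, h2⟩ := hy
          exact ⟨P + R, add_mem hP hR, fun z => by
            rw [LinearMap.add_apply, LinearMap.add_apply, ← h1, ← h2]; rfl⟩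
        | smul c x _ hx =>
          obtain ⟨P, hP, h1⟩ := hx
          exact ⟨c • P, Submodule.smul_mem _ _ hP, fun z => by
            rw [LinearMap.smul_apply, LinearMap.smul_apply, ← h1]; rfl⟩
      obtain ⟨P', hP', h2⟩ := h1
      intro hne
      have h3 := hgap P' hP' (by
        rw [← h2 ⟨h, hhL⟩]; simpa using hne)
      rw [← h2 ⟨h, hhL⟩] at h3
      exact h3)
    (U.comap L.subtype.toAddMonoidHom)
    (fun b y hb hy => by
      obtain ⟨x, hx, rfl⟩ := hy
      exact hU b b.2 ((halg b).mp hb) _ hx x.val.2)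
  exact key

/-- An element of an ordered group is finite relative to `N` if it is bounded by a multiple
of `N`. -/
def IsFiniteRel {Z : Type*} [AddCommGroup Z] [LinearOrder Z] (N a : Z) : Prop :=
  ∃ m : ℕ, |a| ≤ m • N

/-- A standard part relative to `N`: an additive order preserving real-valued function on the
elements finite relative to `N`, normalised by `st N = 1`. -/
structure IsStandardPart {Z : Type*} [AddCommGroup Z] [LinearOrder Z] (N : Z) (st : Z → ℝ) :
    Prop where
  self : st N = 1
  add : ∀ a b, IsFiniteRel N a → IsFiniteRel N b → st (a + b) = st a + st b
  nonneg : ∀ a, IsFiniteRel N a → 0 ≤ a → 0 ≤ st a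

section

variable {Z : Type*} [AddCommGroup Z] [LinearOrder Z] [IsOrderedAddMonoid Z] {N a b : Z}

namespace IsFiniteRel

theorem of_abs_le (h : |a| ≤ |b|) (hb : IsFiniteRel N b) : IsFiniteRel N a :=
  let ⟨m, hm⟩ := hb
  ⟨m, h.trans hm⟩

theorem zero : IsFiniteRel N (0 : Z) := ⟨0, by simp⟩

theorem self (h : 0 ≤ N) : IsFiniteRel N N := ⟨1, by simp [abs_of_nonneg h]⟩

theorem add (ha : IsFiniteRel N a) (hb : IsFiniteRel N b) : IsFiniteRel N (a + b) := by
  obtain ⟨m, hm⟩ := ha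
  obtain ⟨n, hn⟩ := hb
  exact ⟨m + n, (abs_add_le a b).trans (by rw [add_nsmul]; exact add_le_add hm hn)⟩

theorem neg (ha : IsFiniteRel N a) : IsFiniteRel N (-a) := by
  obtain ⟨m, hm⟩ := ha
  exact ⟨m, by rwa [abs_neg]⟩

theorem sub (ha : IsFiniteRel N a) (hb : IsFiniteRel N b) : IsFiniteRel N (a - b) := by
  rw [sub_eq_add_neg]
  exact ha.add hb.neg

theorem nsmul (m : ℕ) (ha : IsFiniteRel N a) : IsFiniteRel N (m • a) := by
  induction m with
  | zero => rw [zero_nsmul]; exact zero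
  | succ m ih => rw [succ_nsmul]; exact ih.add ha

theorem of_nsmul {m : ℕ} (hm : m ≠ 0) (h : IsFiniteRel N (m • a)) : IsFiniteRel N a := by
  refine of_abs_le ?_ h
  rw [abs_nsmul]
  simpa using nsmul_le_nsmul_left (abs_nonneg a) (Nat.one_le_iff_ne_zero.mpr hm)

end IsFiniteRel

namespace IsStandardPart

variable {st : Z → ℝ}

theorem zero (h : IsStandardPart N st) : st 0 = 0 := by
  have := h.add 0 0 .zero .zero
  rw [add_zero] at this
  linarith

theorem neg (h : IsStandardPart N st) (ha : IsFiniteRel N a) : st (-a) = - st a := by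
  have := h.add a (-a) ha ha.neg
  rw [add_neg_cancel, h.zero] at this
  linarith

theorem sub (h : IsStandardPart N st) (ha : IsFiniteRel N a) (hb : IsFiniteRel N b) :
    st (a - b) = st a - st b := by
  rw [sub_eq_add_neg, h.add a _ ha hb.neg, h.neg hb, sub_eq_add_neg]

theorem nsmul (h : IsStandardPart N st) (ha : IsFiniteRel N a) (m : ℕ) :
    st (m • a) = m * st a := by
  induction m with
  | zero => simp [h.zero]
  | succ m ih =>
    rw [succ_nsmul, h.add _ _ (ha.nsmul m) ha, ih]
    push_cast; ring

theorem mono (h : IsStandardPart N st) (ha : IsFiniteRel N a) (hb : IsFiniteRel N b)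
    (hab : a ≤ b) : st a ≤ st b := by
  have := h.nonneg (b - a) (hb.sub ha) (sub_nonneg.mpr hab)
  rw [h.sub hb ha] at this
  linarith

end IsStandardPart

end

/-- A field `Q` with constants `C`, formal powers of a variable with exponents in `Z`, an
order of vanishing, an Euler derivation, a notion of polynomials of bounded degree, and a
subfield of quotients of polynomials with few terms. -/
structure MonomialField (Q C Z : Type*) [Field Q] [Field C] [AddCommGroup Z] [LinearOrder Z]
    [IsOrderedAddMonoid Z] where
  cst : C →+* Q
  xpow : Z → Q
  xpow_zero : xpow 0 = 1
  xpow_add : ∀ a b, xpow (a + b) = xpow a * xpow b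
  wt : Z → C
  ord : Q → Z
  ord_cst : ∀ c, ord (cst c) = 0
  ord_xpow : ∀ a, ord (xpow a) = a
  ord_mul : ∀ z w, z ≠ 0 → w ≠ 0 → ord (z * w) = ord z + ord w
  min_ord_le_ord_add : ∀ z w, z ≠ 0 → w ≠ 0 → z + w ≠ 0 → min (ord z) (ord w) ≤ ord (z + w)
  D : Derivation ℤ Q Q
  D_cst : ∀ c, D (cst c) = 0
  D_xpow : ∀ a, D (xpow a) = cst (wt a) * xpow a
  exists_cst_of_D_eq_zero : ∀ z, D z = 0 → ∃ c, z = cst c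
  ord_le_ord_D : ∀ z, D z ≠ 0 → ord z ≤ ord (D z)
  IsPoly : Q → Z → Prop
  isPoly_mono : ∀ {z m n}, IsPoly z m → m ≤ n → IsPoly z n
  isPoly_add : ∀ {z w n}, IsPoly z n → IsPoly w n → IsPoly (z + w) n
  isPoly_mul : ∀ {z w m n}, IsPoly z m → IsPoly w n → IsPoly (z * w) (m + n)
  isPoly_D : ∀ {z n}, IsPoly z n → IsPoly (D z) n
  isPoly_cst : ∀ c, IsPoly (cst c) 0
  isPoly_xpow : ∀ a, 0 ≤ a → IsPoly (xpow a) a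
  ord_nonneg_of_isPoly : ∀ {z n}, IsPoly z n → 0 ≤ ord z
  ord_le_of_isPoly : ∀ {z n}, IsPoly z n → ord z ≤ n
  isPoly_of_monic : ∀ {z n} (m : ℕ) (c : ℕ → Q), (∀ i < m, IsPoly (c i) n) → 0 ≤ n →
    z ^ m + ∑ i ∈ Finset.range m, c i * z ^ i = 0 → IsPoly z n
  sparse : Subfield Q
  cst_mem_sparse : ∀ c, cst c ∈ sparse
  xpow_mem_sparse : ∀ a, xpow a ∈ sparse
  exists_isStandardPart : ∀ N : Z, 0 < N → ∃ st : Z → ℝ, IsStandardPart N st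

namespace MonomialField

variable {Q C Z : Type*} [Field Q] [Field C] [AddCommGroup Z] [LinearOrder Z]
    [IsOrderedAddMonoid Z] (S : MonomialField Q C Z)

theorem xpow_mul_neg (a : Z) : S.xpow a * S.xpow (-a) = 1 := by
  rw [← S.xpow_add, add_neg_cancel, S.xpow_zero]

theorem xpow_ne_zero (a : Z) : S.xpow a ≠ 0 := left_ne_zero_of_mul_eq_one (S.xpow_mul_neg a)

theorem xpow_neg (a : Z) : S.xpow (-a) = (S.xpow a)⁻¹ :=
  eq_inv_of_mul_eq_one_right (S.xpow_mul_neg a)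

theorem xpow_nsmul (m : ℕ) (a : Z) : S.xpow (m • a) = S.xpow a ^ m := by
  induction m with
  | zero => rw [zero_nsmul, pow_zero, S.xpow_zero]
  | succ m ih => rw [succ_nsmul, S.xpow_add, ih, pow_succ]

theorem ord_one : S.ord 1 = 0 := by rw [← S.xpow_zero, S.ord_xpow]

theorem ord_zero : S.ord 0 = 0 := by rw [← map_zero S.cst, S.ord_cst]

theorem ord_neg (z : Q) : S.ord (-z) = S.ord z := by
  by_cases hz : z = 0
  · rw [hz, neg_zero]
  · have h : S.ord (-1) = 0 := by
      have := S.ord_cst (-1)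
      rwa [map_neg, map_one] at this
    rw [neg_eq_neg_one_mul, S.ord_mul _ _ (by simp) hz, h, zero_add]

theorem ord_pow {z : Q} (hz : z ≠ 0) (m : ℕ) : S.ord (z ^ m) = m • S.ord z := by
  induction m with
  | zero => rw [pow_zero, zero_nsmul, S.ord_one]
  | succ m ih => rw [pow_succ, S.ord_mul _ _ (pow_ne_zero _ hz) hz, ih, succ_nsmul]

theorem ord_inv (z : Q) : S.ord z⁻¹ = - S.ord z := by
  by_cases hz : z = 0
  · rw [hz, inv_zero, S.ord_zero, neg_zero]
  · have := S.ord_mul z z⁻¹ hz (inv_ne_zero hz)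
    rw [mul_inv_cancel₀ hz, S.ord_one] at this
    exact (neg_eq_of_add_eq_zero_right this.symm).symm

theorem ord_div {z w : Q} (hz : z ≠ 0) (hw : w ≠ 0) : S.ord (z / w) = S.ord z - S.ord w := by
  rw [div_eq_mul_inv, S.ord_mul _ _ hz (inv_ne_zero hw), S.ord_inv, sub_eq_add_neg]

theorem ord_add_of_lt {z w : Q} (hz : z ≠ 0) (h : w = 0 ∨ S.ord z < S.ord w) :
    z + w ≠ 0 ∧ S.ord (z + w) = S.ord z := by
  by_cases hw : w = 0
  · simpa [hw] using hz
  have h := h.resolve_left hw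
  have h0 : z + w ≠ 0 := fun h0 => by
    rw [eq_neg_of_add_eq_zero_left h0, S.ord_neg] at h
    exact lt_irrefl _ h
  refine ⟨h0, le_antisymm ?_ ?_⟩
  · have h1 := S.min_ord_le_ord_add (z + w) (-w) h0 (neg_ne_zero.mpr hw) (by simpa using hz)
    rw [add_neg_cancel_right, S.ord_neg] at h1
    exact (min_le_iff.mp h1).resolve_right (not_le.mpr h)
  · have h1 := S.min_ord_le_ord_add z w hz hw h0
    rwa [min_eq_left h.le] at h1

/-- A sum of nonzero terms of pairwise distinct orders has the least order of its terms. -/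
theorem exists_ord_sum {ι : Type*} {s : Finset ι} (hs : s.Nonempty) {a : ι → Q}
    (ha : ∀ i ∈ s, a i ≠ 0) (hinj : Set.InjOn (fun i => S.ord (a i)) s) :
    ∃ i ∈ s, ∑ j ∈ s, a j ≠ 0 ∧ S.ord (∑ j ∈ s, a j) = S.ord (a i) ∧
      ∀ j ∈ s, S.ord (a i) ≤ S.ord (a j) := by
  induction hs using Finset.Nonempty.cons_induction with
  | singleton i => exact ⟨i, by simp, by simpa using ha i (by simp), by simp, by simp⟩
  | cons i s his hs ih =>
    obtain ⟨j, hj, h1, h2, h3⟩ := ih (fun j hj => ha j (Finset.mem_cons_of_mem hj))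
      (hinj.mono fun j hj => Finset.mem_cons_of_mem hj)
    have hij : S.ord (a i) ≠ S.ord (a j) := fun h => his (by
      rwa [hinj (Finset.mem_cons_self i s) (Finset.mem_cons_of_mem hj) h])
    rw [Finset.sum_cons]
    rcases lt_or_gt_of_ne hij with h | h
    · obtain ⟨h4, h5⟩ := S.ord_add_of_lt (ha i (Finset.mem_cons_self i s)) (Or.inr (h.trans_eq h2.symm))
      refine ⟨i, Finset.mem_cons_self i s, h4, h5, fun k hk => ?_⟩
      rcases Finset.mem_cons.mp hk with rfl | hk
      · exact le_rfl
      · exact h.le.trans (h3 k hk)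
    · obtain ⟨h4, h5⟩ := S.ord_add_of_lt h1 (Or.inr (h2.trans_lt h))
      rw [add_comm]
      refine ⟨j, Finset.mem_cons_of_mem hj, h4, h5.trans h2, fun k hk => ?_⟩
      rcases Finset.mem_cons.mp hk with rfl | hk
      · exact h.le
      · exact h3 k hk

/-- Monomials with exponents in `G`. -/
def monomials (G : Submodule ℤ Z) : Submonoid Q where
  carrier := {z | ∃ c, ∃ g ∈ G, z = S.cst c * S.xpow g}
  one_mem' := ⟨1, 0, zero_mem G, by rw [map_one, S.xpow_zero, one_mul]⟩
  mul_mem' := by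
    rintro _ _ ⟨c, g, hg, rfl⟩ ⟨c', g', hg', rfl⟩
    exact ⟨c * c', g + g', add_mem hg hg', by rw [map_mul, S.xpow_add]; ring⟩

/-- Polynomials with exponents in `G`. -/
def polys (G : Submodule ℤ Z) : Subring Q := Subring.closure (S.monomials G)

/-- Rational functions with exponents in `G`. -/
def fracs (G : Submodule ℤ Z) : Subfield Q := Subfield.closure (S.monomials G)

variable {S} {G G' : Submodule ℤ Z}

theorem polys_le_fracs : S.polys G ≤ (S.fracs G).toSubring :=
  Subring.closure_le.mpr Subfield.subset_closure

theorem monomials_mono (h : G ≤ G') : S.monomials G ≤ S.monomials G' := by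
  rintro _ ⟨c, g, hg, rfl⟩
  exact ⟨c, g, h hg, rfl⟩

theorem fracs_mono (h : G ≤ G') : S.fracs G ≤ S.fracs G' :=
  Subfield.closure_mono (monomials_mono h)

theorem cst_mem_polys (c : C) : S.cst c ∈ S.polys G :=
  Subring.subset_closure ⟨c, 0, zero_mem G, by rw [S.xpow_zero, mul_one]⟩

theorem xpow_mem_polys {g : Z} (hg : g ∈ G) : S.xpow g ∈ S.polys G :=
  Subring.subset_closure ⟨1, g, hg, by rw [map_one, one_mul]⟩

theorem cst_mem_fracs (c : C) : S.cst c ∈ S.fracs G := polys_le_fracs (cst_mem_polys c)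

theorem xpow_mem_fracs {g : Z} (hg : g ∈ G) : S.xpow g ∈ S.fracs G :=
  polys_le_fracs (xpow_mem_polys hg)

theorem mem_fracs_iff {z : Q} :
    z ∈ S.fracs G ↔ ∃ f ∈ S.polys G, ∃ f' ∈ S.polys G, f / f' = z :=
  Subfield.mem_closure_iff

theorem exists_eq_div_of_mem_fracs {z : Q} (h : z ∈ S.fracs G) :
    ∃ f ∈ S.polys G, ∃ f' ∈ S.polys G, f' ≠ 0 ∧ z = f / f' := by
  obtain ⟨f, hf, f', hf', rfl⟩ := mem_fracs_iff.mp h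
  by_cases h0 : f' = 0
  · exact ⟨0, zero_mem _, 1, one_mem _, one_ne_zero, by simp [h0]⟩
  · exact ⟨f, hf, f', hf', h0, rfl⟩

theorem fracs_le_sparse : S.fracs G ≤ S.sparse := by
  refine Subfield.closure_le.mpr ?_
  rintro _ ⟨c, g, hg, rfl⟩
  exact mul_mem (S.cst_mem_sparse c) (S.xpow_mem_sparse g)

theorem exists_finsupp_of_mem_polys {z : Q} (h : z ∈ S.polys G) :
    ∃ f : Z →₀ C, (∀ g ∈ f.support, g ∈ G) ∧ z = f.sum fun g c => S.cst c * S.xpow g := by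
  classical
  rw [polys, Subring.mem_closure_iff, Submonoid.closure_eq] at h
  induction h using AddSubgroup.closure_induction with
  | mem x hx =>
    obtain ⟨c, g, hg, rfl⟩ := hx
    refine ⟨Finsupp.single g c, fun g' hg' => ?_, by simp⟩
    rw [Finset.mem_singleton.mp (Finsupp.support_single_subset hg')]
    exact hg
  | zero => exact ⟨0, by simp, by simp⟩
  | add x y _ _ hx hy =>
    obtain ⟨f, hf, rfl⟩ := hx
    obtain ⟨f', hf', rfl⟩ := hy
    refine ⟨f + f', fun g hg => ?_, ?_⟩
    · rcases Finset.mem_union.mp (Finsupp.support_add hg) with h | h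
      · exact hf g h
      · exact hf' g h
    · rw [Finsupp.sum_add_index']
      · simp
      · intro a b c; rw [map_add, add_mul]
  | neg x _ hx =>
    obtain ⟨f, hf, rfl⟩ := hx
    refine ⟨-f, fun g hg => hf g (by simpa using hg), ?_⟩
    rw [Finsupp.sum_neg_index (by simp)]
    simp [Finsupp.sum]

theorem exists_ord_polys {f : Z →₀ C} (h : f ≠ 0) :
    (f.sum fun g c => S.cst c * S.xpow g) ≠ 0 ∧
    S.ord (f.sum fun g c => S.cst c * S.xpow g) ∈ f.support ∧
    ∀ g ∈ f.support, S.ord (f.sum fun g c => S.cst c * S.xpow g) ≤ g := by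
  have h1 : ∀ g ∈ f.support, S.cst (f g) ≠ 0 := fun g hg => by simpa using hg
  have h2 : ∀ g ∈ f.support, S.ord (S.cst (f g) * S.xpow g) = g := fun g hg => by
    rw [S.ord_mul _ _ (h1 g hg) (S.xpow_ne_zero g), S.ord_cst, S.ord_xpow, zero_add]
  obtain ⟨g, hg, h3, h4, h5⟩ := S.exists_ord_sum (s := f.support)
    (Finsupp.support_nonempty_iff.mpr h) (a := fun g => S.cst (f g) * S.xpow g)
    (fun g hg => mul_ne_zero (h1 g hg) (S.xpow_ne_zero g))
    (fun g hg g' hg' hgg' => by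
      simp only at hgg'
      rwa [h2 g hg, h2 g' hg'] at hgg')
  rw [h2 g hg] at h4
  refine ⟨h3, ?_, fun g' hg' => ?_⟩
  · rw [Finsupp.sum, h4]; exact hg
  · rw [Finsupp.sum, h4]
    have := h5 g' hg'
    rwa [h2 g hg, h2 g' hg'] at this

theorem ord_mem_of_mem_polys {z : Q} (h : z ∈ S.polys G) : S.ord z ∈ G := by
  obtain ⟨f, hf, rfl⟩ := exists_finsupp_of_mem_polys h
  by_cases h0 : f = 0
  · simp [h0, S.ord_zero]
  · exact hf _ (exists_ord_polys h0).2.1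

theorem ord_mem_of_mem_fracs {z : Q} (h : z ∈ S.fracs G) : S.ord z ∈ G := by
  obtain ⟨f, hf, f', hf', h0, rfl⟩ := exists_eq_div_of_mem_fracs h
  by_cases hf0 : f = 0
  · simp [hf0, S.ord_zero]
  · rw [S.ord_div hf0 h0]
    exact sub_mem (ord_mem_of_mem_polys hf) (ord_mem_of_mem_polys hf')

theorem exists_nsmul_ord_mem_of_isAlgebraic {z : Q} (h : IsAlgebraic (S.fracs G) z) :
    ∃ m : ℕ, m ≠ 0 ∧ m • S.ord z ∈ G := by
  by_cases hz : z = 0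
  · exact ⟨1, one_ne_zero, by simp [hz, S.ord_zero]⟩
  obtain ⟨p, hp, hpz⟩ := h
  by_contra! hcon
  have h1 : ∀ i ∈ p.support, ((p.coeff i : S.fracs G) : Q) ≠ 0 := fun i hi => by simpa using hi
  have h2 : ∀ i ∈ p.support, ((p.coeff i : S.fracs G) : Q) * z ^ i ≠ 0 := fun i hi =>
    mul_ne_zero (h1 i hi) (pow_ne_zero _ hz)
  have h3 : ∀ i ∈ p.support, S.ord (((p.coeff i : S.fracs G) : Q) * z ^ i) =
      S.ord (p.coeff i : S.fracs G) + i • S.ord z := fun i hi => by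
    rw [S.ord_mul _ _ (h1 i hi) (pow_ne_zero _ hz), S.ord_pow hz]
  have hlt : ∀ i ∈ p.support, ∀ j ∈ p.support, i < j →
      S.ord (((p.coeff i : S.fracs G) : Q) * z ^ i) ≠
        S.ord (((p.coeff j : S.fracs G) : Q) * z ^ j) := fun i hi j hj hij heq => by
    rw [h3 i hi, h3 j hj] at heq
    refine hcon (j - i) (by omega) ?_
    have : (j - i) • S.ord z = S.ord (p.coeff i : S.fracs G) - S.ord (p.coeff j : S.fracs G) := by
      rw [eq_sub_iff_add_eq, ← add_right_cancel_iff (a := i • S.ord z), heq, add_assoc,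
        add_comm, add_assoc, ← add_nsmul]
      congr 2
      omega
    rw [this]
    exact sub_mem (ord_mem_of_mem_fracs (p.coeff i).2) (ord_mem_of_mem_fracs (p.coeff j).2)
  obtain ⟨i, -, h4, -⟩ := S.exists_ord_sum (support_nonempty.mpr hp) h2
    (fun i hi j hj hij => by
      by_contra hne
      rcases lt_or_gt_of_ne hne with h | h
      · exact hlt i hi j hj h hij
      · exact hlt j hj i hi h hij.symm)
  apply h4
  rw [aeval_def, eval₂_eq_sum, sum_def] at hpz
  exact hpz

theorem D_mem_fracs {z : Q} (h : z ∈ S.fracs G) : S.D z ∈ S.fracs G := by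
  induction h using Subfield.closure_induction with
  | mem x hx =>
    obtain ⟨c, g, hg, rfl⟩ := hx
    rw [Derivation.leibniz, S.D_cst, S.D_xpow, smul_zero, add_zero, smul_eq_mul]
    exact mul_mem (cst_mem_fracs c) (mul_mem (cst_mem_fracs _) (xpow_mem_fracs hg))
  | one => rw [Derivation.map_one_eq_zero]; exact zero_mem _
  | add x y _ _ hx hy => rw [map_add]; exact add_mem hx hy
  | neg x _ hx => rw [map_neg]; exact neg_mem hx
  | inv x hx h =>
    rw [Derivation.leibniz_inv, smul_eq_mul]
    exact mul_mem (neg_mem (pow_mem (inv_mem hx) _)) h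
  | mul x y hx hy h h' =>
    rw [Derivation.leibniz, smul_eq_mul, smul_eq_mul]
    exact add_mem (mul_mem hx h') (mul_mem hy h)

theorem isAlgebraic_D [CharZero Q] {z : Q} (h : IsAlgebraic (S.fracs G) z) :
    IsAlgebraic (S.fracs G) (S.D z) := by
  obtain ⟨d, hd⟩ := Derivation.exists_restrict (S.fracs G).subtype S.D
    fun a => ⟨⟨S.D a, D_mem_fracs a.2⟩, rfl⟩
  exact Derivation.isAlgebraic_apply hd h

theorem exists_cst_of_isAlgebraic [CharZero Q] {z : Q}
    (h : IsAlgebraic (S.fracs (⊥ : Submodule ℤ Z)) z) : ∃ c, z = S.cst c := by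
  refine S.exists_cst_of_D_eq_zero z ?_
  have hle : S.fracs (⊥ : Submodule ℤ Z) ≤ S.cst.fieldRange := by
    refine Subfield.closure_le.mpr ?_
    rintro _ ⟨c, g, hg, rfl⟩
    rw [(Submodule.mem_bot ℤ).mp hg, S.xpow_zero, mul_one]
    exact ⟨c, rfl⟩
  have h1 := Derivation.apply_aeval_of_map (F := S.fracs (⊥ : Submodule ℤ Z)) (d := 0) (D := S.D)
    (fun a => by
      obtain ⟨c, hc⟩ := hle a.2
      change S.D a = _
      rw [← hc, S.D_cst]; simp) z
  have h2 := h1 (minpoly _ z)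
  have h3 : Derivation.polyCoeffs (0 : Derivation ℤ (S.fracs (⊥ : Submodule ℤ Z)) _)
      (minpoly _ z) = 0 := by
    ext i; rw [Derivation.coeff_polyCoeffs]; rfl
  rw [minpoly.aeval, map_zero, h3, map_zero, zero_add] at h2
  exact (mul_eq_zero.mp h2.symm).resolve_left
    ((minpoly.irreducible h.isIntegral).separable.aeval_derivative_ne_zero (minpoly.aeval _ z))

end MonomialField

namespace MonomialField

variable {Q C Z : Type*} [Field Q] [Field C] [AddCommGroup Z] [LinearOrder Z]
    [IsOrderedAddMonoid Z] {S : MonomialField Q C Z} {G G' : Submodule ℤ Z}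

theorem isPoly_zero {n : Z} (hn : 0 ≤ n) : S.IsPoly 0 n := by
  have := S.isPoly_mono (S.isPoly_cst 0) hn
  rwa [map_zero] at this

theorem isPoly_one : S.IsPoly 1 0 := by
  have := S.isPoly_cst 1
  rwa [map_one] at this

theorem isPoly_pow {z : Q} {n : Z} (h : S.IsPoly z n) (m : ℕ) : S.IsPoly (z ^ m) (m • n) := by
  induction m with
  | zero => rw [pow_zero, zero_nsmul]; exact isPoly_one
  | succ m ih => rw [pow_succ, succ_nsmul]; exact S.isPoly_mul ih h

theorem exists_isPoly_of_mem_polys {f : Q} (hf : f ∈ S.polys G) :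
    ∃ s ∈ G, 0 ≤ s ∧ ∀ s', s ≤ s' → S.IsPoly (S.xpow s' * f) (s' + s) := by
  rw [polys, Subring.mem_closure_iff, Submonoid.closure_eq] at hf
  induction hf using AddSubgroup.closure_induction with
  | mem x hx =>
    obtain ⟨c, g, hg, rfl⟩ := hx
    refine ⟨|g|, ?_, abs_nonneg g, fun s' hs => ?_⟩
    · rcases abs_choice g with h | h <;> rw [h]
      · exact hg
      · exact neg_mem hg
    · have h1 := S.isPoly_mul (S.isPoly_cst c) (S.isPoly_xpow (s' + g)
        (by have := neg_abs_le g; have := add_le_add hs this; simpa using this))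
      rw [zero_add, S.xpow_add] at h1
      have h2 := S.isPoly_mono h1 (add_le_add le_rfl (le_abs_self g))
      convert h2 using 1
      ring
  | zero => exact ⟨0, zero_mem _, le_rfl, fun s' hs => by
      rw [mul_zero, add_zero]; exact isPoly_zero hs⟩
  | add x y _ _ hx hy =>
    obtain ⟨s, hs, hs0, h⟩ := hx
    obtain ⟨t, ht, ht0, h'⟩ := hy
    refine ⟨s + t, add_mem hs ht, add_nonneg hs0 ht0, fun s' hs' => ?_⟩
    rw [mul_add]
    refine S.isPoly_add (S.isPoly_mono (h s' ((le_add_of_nonneg_right ht0).trans hs')) ?_)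
      (S.isPoly_mono (h' s' ((le_add_of_nonneg_left hs0).trans hs')) ?_)
    · exact add_le_add le_rfl (le_add_of_nonneg_right ht0)
    · exact add_le_add le_rfl (le_add_of_nonneg_left hs0)
  | neg x _ hx =>
    obtain ⟨s, hs, hs0, h⟩ := hx
    refine ⟨s, hs, hs0, fun s' hs' => ?_⟩
    have := S.isPoly_mul (S.isPoly_cst (-1)) (h s' hs')
    rw [zero_add, map_neg, map_one] at this
    convert this using 1
    ring

theorem exists_isPoly_div_of_mem_fracs {c : Q} (hc : c ∈ S.fracs G) :
    ∃ s ∈ G, 0 ≤ s ∧ ∃ a b, b ≠ 0 ∧ c = a / b ∧ S.IsPoly a s ∧ S.IsPoly b s := by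
  obtain ⟨f, hf, f', hf', h0, rfl⟩ := exists_eq_div_of_mem_fracs hc
  obtain ⟨s, hs, hs0, h⟩ := exists_isPoly_of_mem_polys hf
  obtain ⟨t, ht, ht0, h'⟩ := exists_isPoly_of_mem_polys hf'
  have h1 : s ≤ s + t := le_add_of_nonneg_right ht0
  have h2 : t ≤ s + t := le_add_of_nonneg_left hs0
  refine ⟨(s + t) + (s + t), add_mem (add_mem hs ht) (add_mem hs ht),
    add_nonneg (hs0.trans h1) (hs0.trans h1), S.xpow (s + t) * f, S.xpow (s + t) * f',
    mul_ne_zero (S.xpow_ne_zero _) h0, (mul_div_mul_left _ _ (S.xpow_ne_zero _)).symm,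
    S.isPoly_mono (h _ h1) (add_le_add le_rfl h1), S.isPoly_mono (h' _ h2) (add_le_add le_rfl h2)⟩

theorem exists_common_denominator {ι : Type*} (s : Finset ι) (a : ι → Q)
    (ha : ∀ i ∈ s, a i ∈ S.fracs G) :
    ∃ b ∈ S.polys G, b ≠ 0 ∧ ∀ i ∈ s, b * a i ∈ S.polys G := by
  classical
  induction s using Finset.induction_on with
  | empty => exact ⟨1, one_mem _, one_ne_zero, by simp⟩
  | insert i s his ih =>
    obtain ⟨b, hb, hb0, h⟩ := ih fun j hj => ha j (Finset.mem_insert_of_mem hj)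
    obtain ⟨f, hf, f', hf', h0, hi⟩ := exists_eq_div_of_mem_fracs (ha i (Finset.mem_insert_self i s))
    refine ⟨b * f', mul_mem hb hf', mul_ne_zero hb0 h0, fun j hj => ?_⟩
    rcases Finset.mem_insert.mp hj with rfl | hj
    · rw [hi, mul_assoc, mul_div_cancel₀ _ h0]
      exact mul_mem hb hf
    · have := mul_mem hf' (h j hj)
      convert this using 1
      ring

theorem exists_polynomial_of_isAlgebraic {z : Q} (h : IsAlgebraic (S.fracs G) z) :
    ∃ r : Q[X], r ≠ 0 ∧ (∀ i, r.coeff i ∈ S.polys G) ∧ r.eval z = 0 := by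
  obtain ⟨p, hp, hpz⟩ := h
  obtain ⟨b, hb, hb0, h1⟩ := exists_common_denominator p.support
    (fun i => ((p.coeff i : S.fracs G) : Q)) fun i _ => (p.coeff i).2
  refine ⟨Polynomial.C b * p.map (S.fracs G).subtype, ?_, fun i => ?_, ?_⟩
  · refine mul_ne_zero (Polynomial.C_ne_zero.mpr hb0) ?_
    rwa [Ne, Polynomial.map_eq_zero]
  · rw [coeff_C_mul, coeff_map]
    by_cases hi : i ∈ p.support
    · exact h1 i hi
    · rw [notMem_support_iff.mp hi, map_zero, mul_zero]; exact zero_mem _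
  · rw [eval_mul, eval_map]
    have : eval₂ (S.fracs G).subtype z p = 0 := hpz
    rw [this, mul_zero]

/-- An element algebraic over the field of fractions is, up to a factor, a polynomial. -/
theorem exists_isPoly_mul_of_isAlgebraic {N : Z} (hfin : ∀ g ∈ G, IsFiniteRel N g) (hN : N ∈ G)
    (hN0 : 0 < N) {z : Q} (h : IsAlgebraic (S.fracs G) z) :
    ∃ b ∈ S.polys G, b ≠ 0 ∧ ∃ B : ℕ, S.IsPoly (b * z) (B • N) ∧
      ∃ r : Q[X], r ≠ 0 ∧ (∀ i, r.coeff i ∈ S.polys G) ∧ r.eval (b * z) = 0 := by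
  obtain ⟨r, hr, hrG, hrz⟩ := exists_polynomial_of_isAlgebraic h
  obtain ⟨k, hk⟩ : ∃ k : ℕ, ∀ i, S.IsPoly (S.xpow (k • N) * r.coeff i) ((2 * k) • N) := by
    have h1 : ∀ i, ∃ k : ℕ, ∀ m, k ≤ m → S.IsPoly (S.xpow (m • N) * r.coeff i) ((2 * m) • N) := by
      intro i
      obtain ⟨s, hs, hs0, h1⟩ := exists_isPoly_of_mem_polys (hrG i)
      obtain ⟨k, hk⟩ := hfin s hs
      have hk := (le_abs_self s).trans hk
      refine ⟨k, fun m hm => ?_⟩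
      have hsm : s ≤ m • N := hk.trans (nsmul_le_nsmul_left hN0.le hm)
      refine S.isPoly_mono (h1 _ hsm) ?_
      rw [two_mul, add_nsmul]
      exact add_le_add le_rfl hsm
    choose k hk using h1
    refine ⟨(Finset.range (r.natDegree + 1)).sup k, fun i => ?_⟩
    by_cases hi : i ∈ Finset.range (r.natDegree + 1)
    · exact hk i _ (Finset.le_sup hi)
    · rw [coeff_eq_zero_of_natDegree_lt (by simpa using hi), mul_zero]
      exact isPoly_zero (nsmul_nonneg hN0.le _)
  have hx0 := S.xpow_ne_zero (k • N)
  set t := Polynomial.C (S.xpow (k • N)) * r with ht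
  have ht0 : t ≠ 0 := mul_ne_zero (Polynomial.C_ne_zero.mpr hx0) hr
  have htG : ∀ i, t.coeff i ∈ S.polys G := fun i => by
    rw [ht, coeff_C_mul]
    exact mul_mem (xpow_mem_polys (nsmul_mem hN k)) (hrG i)
  have htz : t.eval z = 0 := by rw [ht, eval_mul, hrz, mul_zero]
  have htP : ∀ i, S.IsPoly (t.coeff i) ((2 * k) • N) := fun i => by
    rw [ht, coeff_C_mul]; exact hk i
  set n := t.natDegree with hn
  set b := t.leadingCoeff with hb
  have hb0 : b ≠ 0 := leadingCoeff_ne_zero.mpr ht0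
  have hn0 : n ≠ 0 := fun h0 => by
    have h1 := eq_C_of_natDegree_eq_zero (p := t) (hn ▸ h0)
    have h2 : t.eval z = t.coeff 0 := by conv_lhs => rw [h1, eval_C]
    exact hb0 (by rw [hb, leadingCoeff, ← hn, h0, ← h2, htz])
  have hI : t.integralNormalization.eval (b * z) = 0 := by
    have := integralNormalization_eval₂_eq_zero (p := t) (RingHom.id Q) (z := z)
      (by rw [eval₂_id, htz]) fun x hx => hx
    rwa [eval₂_id] at this
  have hIc : ∀ i, i < n → t.integralNormalization.coeff i = t.coeff i * b ^ (n - 1 - i) :=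
    fun i hi => integralNormalization_coeff_ne_natDegree (by omega)
  have hIn : t.integralNormalization.coeff n = 1 :=
    integralNormalization_coeff_natDegree ht0
  have hId : t.integralNormalization.natDegree = n := natDegree_integralNormalization
  refine ⟨b, htG _, hb0, n * (2 * k), ?_, t.integralNormalization, ?_, fun i => ?_, hI⟩
  · refine S.isPoly_of_monic n (fun i => t.coeff i * b ^ (n - 1 - i)) (fun i hi => ?_)
      (nsmul_nonneg hN0.le _) ?_
    · have h1 := S.isPoly_mul (htP i) (isPoly_pow (htP n) (n - 1 - i))
      refine S.isPoly_mono h1 ?_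
      rw [← mul_nsmul', ← add_nsmul]
      refine nsmul_le_nsmul_left hN0.le ?_
      have : n - 1 - i + 1 ≤ n := by omega
      calc 2 * k + (n - 1 - i) * (2 * k) = (n - 1 - i + 1) * (2 * k) := by ring
        _ ≤ _ := Nat.mul_le_mul_right _ this
    · rw [eval_eq_sum_range, hId, Finset.sum_range_succ, hIn, one_mul] at hI
      rw [add_comm, ← hI]
      congr 1
      exact Finset.sum_congr rfl fun i hi => by rw [hIc i (Finset.mem_range.mp hi)]
  · intro h0
    rw [h0, coeff_zero] at hIn
    exact zero_ne_one hIn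
  · rcases lt_trichotomy i n with hi | hi | hi
    · rw [hIc i hi]
      exact mul_mem (htG i) (pow_mem (htG n) _)
    · rw [hi, hIn]; exact one_mem _
    · rw [coeff_eq_zero_of_natDegree_lt (by omega)]; exact zero_mem _

end MonomialField

namespace MonomialField

variable {Q C Z : Type*} [Field Q] [Field C] [AddCommGroup Z] [LinearOrder Z]
    [IsOrderedAddMonoid Z] {S : MonomialField Q C Z} {G G₀ : Submodule ℤ Z} {N : Z} {st : Z → ℝ}
    {L : Subfield Q}

open Classical in
variable (S st) in
/-- The real absolute value attached to a standard part. -/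
noncomputable def val (z : Q) : ℝ := if z = 0 then 0 else Real.exp (-(st (S.ord z)))

theorem val_zero : S.val st 0 = 0 := if_pos rfl

theorem val_of_ne_zero {z : Q} (hz : z ≠ 0) : S.val st z = Real.exp (-(st (S.ord z))) := if_neg hz

theorem val_pos {z : Q} (hz : z ≠ 0) : 0 < S.val st z := by
  rw [val_of_ne_zero hz]; exact Real.exp_pos _

theorem val_nonneg (z : Q) : 0 ≤ S.val st z := by
  by_cases hz : z = 0
  · rw [hz, val_zero]
  · exact (val_pos hz).le

theorem val_xpow (g : Z) : S.val st (S.xpow g) = Real.exp (-(st g)) := by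
  rw [val_of_ne_zero (S.xpow_ne_zero g), S.ord_xpow]

theorem val_neg (z : Q) : S.val st (-z) = S.val st z := by
  by_cases hz : z = 0
  · rw [hz, neg_zero]
  · rw [val_of_ne_zero hz, val_of_ne_zero (neg_ne_zero.mpr hz), S.ord_neg]

theorem val_mul (hst : IsStandardPart N st) (hL : ∀ z ∈ L, IsFiniteRel N (S.ord z))
    {z w : Q} (hz : z ∈ L) (hw : w ∈ L) : S.val st (z * w) = S.val st z * S.val st w := by
  by_cases hz0 : z = 0
  · rw [hz0, zero_mul, val_zero, zero_mul]
  by_cases hw0 : w = 0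
  · rw [hw0, mul_zero, val_zero, mul_zero]
  rw [val_of_ne_zero hz0, val_of_ne_zero hw0, val_of_ne_zero (mul_ne_zero hz0 hw0),
    S.ord_mul _ _ hz0 hw0, hst.add _ _ (hL z hz) (hL w hw), ← Real.exp_add]
  congr 1
  ring

theorem val_add_le (hst : IsStandardPart N st) (hL : ∀ z ∈ L, IsFiniteRel N (S.ord z))
    {z w : Q} (hz : z ∈ L) (hw : w ∈ L) :
    S.val st (z + w) ≤ max (S.val st z) (S.val st w) := by
  by_cases hz0 : z = 0
  · simp [hz0]
  by_cases hw0 : w = 0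
  · simp [hw0]
  by_cases h0 : z + w = 0
  · rw [h0, val_zero]
    exact le_max_of_le_left (val_nonneg z)
  rw [val_of_ne_zero hz0, val_of_ne_zero hw0, val_of_ne_zero h0, le_max_iff,
    Real.exp_le_exp, Real.exp_le_exp, neg_le_neg_iff, neg_le_neg_iff]
  rcases min_le_iff.mp (S.min_ord_le_ord_add z w hz0 hw0 h0) with h | h
  · exact Or.inl (hst.mono (hL z hz) (hL _ (add_mem hz hw)) h)
  · exact Or.inr (hst.mono (hL w hw) (hL _ (add_mem hz hw)) h)

theorem val_sum_lt_one (hst : IsStandardPart N st) (hL : ∀ z ∈ L, IsFiniteRel N (S.ord z))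
    {ι : Type*} {s : Finset ι} {a : ι → Q} (haL : ∀ i ∈ s, a i ∈ L)
    (ha : ∀ i ∈ s, S.val st (a i) < 1) : S.val st (∑ i ∈ s, a i) < 1 := by
  classical
  induction s using Finset.induction_on with
  | empty => rw [Finset.sum_empty, val_zero]; exact one_pos
  | insert i s his ih =>
    rw [Finset.sum_insert his]
    refine (val_add_le hst hL (haL i (Finset.mem_insert_self i s))
      (sum_mem fun j hj => haL j (Finset.mem_insert_of_mem hj))).trans_lt (max_lt ?_ ?_)
    · exact ha i (Finset.mem_insert_self i s)
    · exact ih (fun j hj => haL j (Finset.mem_insert_of_mem hj))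
        fun j hj => ha j (Finset.mem_insert_of_mem hj)

/-- Leading coefficients of polynomials with exponents in `G`. -/
theorem exists_leadingCoeff (hst : IsStandardPart N st) (hGL : S.fracs G ≤ L)
    (hL : ∀ z ∈ L, IsFiniteRel N (S.ord z)) (hG₀ : ∀ g, g ∈ G₀ ↔ g ∈ G ∧ st g = 0)
    {f : Q} (hf : f ∈ S.polys G) (hf0 : f ≠ 0) :
    ∃ c ∈ S.fracs G₀, c ≠ 0 ∧ S.val st (f * S.xpow (-(S.ord f)) - c) < 1 := by
  classical
  have hfin : ∀ g ∈ G, IsFiniteRel N g := fun g hg => by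
    have := hL _ (hGL (xpow_mem_fracs hg))
    rwa [S.ord_xpow] at this
  obtain ⟨F, hFG, rfl⟩ := exists_finsupp_of_mem_polys hf
  have hF0 : F ≠ 0 := by rintro rfl; simp at hf0
  obtain ⟨-, h1, h2⟩ := exists_ord_polys (S := S) hF0
  set f := F.sum fun g c => S.cst c * S.xpow g with hfdef
  set g := S.ord f with hg
  have hgG := hFG g h1
  set c := ∑ g' ∈ F.support with st (g' - g) = 0, S.cst (F g') * S.xpow (g' - g) with hc
  have hlt : S.val st (f * S.xpow (-g) - c) < 1 := by
    have h3 : f * S.xpow (-g) - c =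
        ∑ g' ∈ F.support with ¬ st (g' - g) = 0, S.cst (F g') * S.xpow (g' - g) := by
      rw [sub_eq_iff_eq_add', hc, Finset.sum_filter_add_sum_filter_not, hfdef, Finsupp.sum,
        Finset.sum_mul]
      exact Finset.sum_congr rfl fun g' _ => by rw [sub_eq_add_neg, S.xpow_add, mul_assoc]
    rw [h3]
    refine val_sum_lt_one hst hL (fun g' hg' => ?_) fun g' hg' => ?_
    · exact mul_mem (hGL (cst_mem_fracs _))
        (hGL (xpow_mem_fracs (sub_mem (hFG _ (Finset.mem_filter.mp hg').1) hgG)))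
    · obtain ⟨hg'1, hg'2⟩ := Finset.mem_filter.mp hg'
      have h4 : S.cst (F g') ≠ 0 := by simpa using hg'1
      rw [val_of_ne_zero (mul_ne_zero h4 (S.xpow_ne_zero _)), S.ord_mul _ _ h4 (S.xpow_ne_zero _),
        S.ord_cst, S.ord_xpow, zero_add, Real.exp_lt_one_iff, neg_lt_zero]
      exact lt_of_le_of_ne (hst.nonneg _ (hfin _ (sub_mem (hFG _ hg'1) hgG))
        (sub_nonneg.mpr (h2 g' hg'1))) (Ne.symm hg'2)
  refine ⟨c, sum_mem fun g' hg' => ?_, ?_, hlt⟩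
  · obtain ⟨hg'1, hg'2⟩ := Finset.mem_filter.mp hg'
    exact mul_mem (cst_mem_fracs _)
      (xpow_mem_fracs ((hG₀ _).mpr ⟨sub_mem (hFG _ hg'1) hgG, hg'2⟩))
  · intro h0
    rw [h0, sub_zero, val_of_ne_zero (mul_ne_zero hf0 (S.xpow_ne_zero _)),
      S.ord_mul _ _ hf0 (S.xpow_ne_zero _), S.ord_xpow, ← hg, add_neg_cancel, hst.zero] at hlt
    simp at hlt

theorem isAlgebraic_xpow {θ : Z} {m : ℕ} (hm : m ≠ 0) (h : m • θ ∈ G) :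
    IsAlgebraic (S.fracs G) (S.xpow θ) := by
  refine IsAlgebraic.of_pow (n := m) (Nat.pos_of_ne_zero hm) ?_
  rw [← S.xpow_nsmul]
  exact isAlgebraic_algebraMap (⟨_, xpow_mem_fracs h⟩ : S.fracs G)

/-- Elements algebraic over the fractions are approximately algebraic over the fractions with
infinitesimal exponents. -/
theorem exists_approx (hst : IsStandardPart N st) (hGL : S.fracs G ≤ L)
    (hL : ∀ z ∈ L, IsFiniteRel N (S.ord z))
    (hLalg : ∀ z, IsAlgebraic (S.fracs G) z ↔ z ∈ L)
    (hG₀ : ∀ g, g ∈ G₀ ↔ g ∈ G ∧ st g = 0) {z : Q} (hz : z ∈ L) (hz0 : z ≠ 0) :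
    S.xpow (S.ord z) ∈ L ∧ ∃ p : Q[X], p ≠ 0 ∧
      (∀ i, p.coeff i ∈ L ∧ IsAlgebraic (S.fracs G₀) (p.coeff i)) ∧
        S.val st (p.eval (z / S.xpow (S.ord z))) < 1 := by
  classical
  obtain ⟨m, hm, hmo⟩ := exists_nsmul_ord_mem_of_isAlgebraic ((hLalg z).mpr hz)
  have hfin : ∀ g ∈ G, IsFiniteRel N g := fun g hg => by
    have := hL _ (hGL (xpow_mem_fracs hg))
    rwa [S.ord_xpow] at this
  set o := S.ord z with ho
  have hxL : ∀ θ, m • θ ∈ G → S.xpow θ ∈ L := fun θ hθ =>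
    (hLalg _).mp (isAlgebraic_xpow hm hθ)
  have hθfin : ∀ θ, m • θ ∈ G → IsFiniteRel N θ := fun θ hθ => (hfin _ hθ).of_nsmul hm
  refine ⟨hxL o hmo, ?_⟩
  obtain ⟨r, hr, hrG, hrz⟩ := exists_polynomial_of_isAlgebraic ((hLalg z).mpr hz)
  have hrL : ∀ i, r.coeff i ∈ L := fun i => hGL (polys_le_fracs (hrG i))
  have hrs : ∀ i ∈ r.support, r.coeff i ≠ 0 := fun i hi => mem_support_iff.mp hi
  -- the exponents of the terms
  set θ : ℕ → Z := fun i => S.ord (r.coeff i) + i • o with hθ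
  have hθG : ∀ i, m • θ i ∈ G := fun i => by
    rw [hθ]
    simp only
    rw [nsmul_add, ← mul_nsmul', mul_comm, mul_nsmul']
    exact add_mem (nsmul_mem (ord_mem_of_mem_polys (hrG i)) m) (nsmul_mem hmo i)
  obtain ⟨i₀, hi₀, hmin⟩ := Finset.exists_min_image r.support (fun i => st (θ i))
    (support_nonempty.mpr hr)
  have hθ₀ : ∀ i, m • (θ i - θ i₀) ∈ G := fun i => by
    rw [nsmul_sub]; exact sub_mem (hθG i) (hθG i₀)
  have hstθ : ∀ i, st (θ i - θ i₀) = st (θ i) - st (θ i₀) := fun i =>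
    hst.sub (hθfin _ (hθG i)) (hθfin _ (hθG i₀))
  choose! c hcG hc0 hclt using fun i (hi : i ∈ r.support) =>
    exists_leadingCoeff hst hGL hL hG₀ (hrG i) (hrs i hi)
  have hG₀G : S.fracs G₀ ≤ S.fracs G := fracs_mono fun g hg => ((hG₀ g).mp hg).1
  set e : ℕ → Q := fun i => if st (θ i - θ i₀) = 0 then S.xpow (θ i - θ i₀) * c i else 0 with he
  have heL : ∀ i ∈ r.support, e i ∈ L ∧ IsAlgebraic (S.fracs G₀) (e i) := fun i hi => by
    by_cases h0 : st (θ i - θ i₀) = 0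
    · rw [he]
      simp only [if_pos h0]
      refine ⟨mul_mem (hxL _ (hθ₀ i)) (hGL (hG₀G (hcG i hi))), IsAlgebraic.mul ?_
        (isAlgebraic_algebraMap (⟨_, hcG i hi⟩ : S.fracs G₀))⟩
      refine isAlgebraic_xpow hm ((hG₀ _).mpr ⟨hθ₀ i, ?_⟩)
      rw [hst.nsmul (hθfin _ (hθ₀ i)), h0, mul_zero]
    · rw [he]
      simp only [if_neg h0]
      exact ⟨zero_mem _, isAlgebraic_zero⟩
  have hcoef : ∀ i, (∑ j ∈ r.support, monomial j (e j)).coeff i =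
      if i ∈ r.support then e i else 0 := fun i => by
    simp only [finsetSum_coeff, coeff_monomial, Finset.sum_ite_eq']
  have hx0 := S.xpow_ne_zero o
  set y := z / S.xpow o with hy
  have hyL : y ∈ L := div_mem hz (hxL o hmo)
  have hy1 : S.val st y = 1 := by
    rw [val_of_ne_zero (div_ne_zero hz0 hx0), S.ord_div hz0 hx0, S.ord_xpow, ← ho, sub_self,
      hst.zero, neg_zero, Real.exp_zero]
  refine ⟨∑ j ∈ r.support, monomial j (e j), ?_, fun i => ?_, ?_⟩
  · intro h0
    have h1 := hcoef i₀
    rw [h0, coeff_zero, if_pos hi₀, he] at h1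
    simp only [sub_self, hst.zero, if_true, S.xpow_zero, one_mul] at h1
    exact hc0 i₀ hi₀ h1.symm
  · rw [hcoef]
    by_cases hi : i ∈ r.support
    · rw [if_pos hi]; exact heL i hi
    · rw [if_neg hi]; exact ⟨zero_mem _, isAlgebraic_zero⟩
  · -- the unit part of the `i`-th coefficient
    set u : ℕ → Q := fun i => r.coeff i * S.xpow (-(S.ord (r.coeff i))) with hu
    have huL : ∀ i, u i ∈ L := fun i => mul_mem (hrL i) (hGL (xpow_mem_fracs
      (neg_mem (ord_mem_of_mem_polys (hrG i)))))
    have hsum : ∑ i ∈ r.support, u i * S.xpow (θ i - θ i₀) * y ^ i = 0 := by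
      have h1 : ∀ i, u i * S.xpow (θ i - θ i₀) * y ^ i = S.xpow (-θ i₀) * (r.coeff i * z ^ i) :=
        fun i => by
          have h2 : S.xpow (θ i - θ i₀) =
              S.xpow (S.ord (r.coeff i)) * S.xpow o ^ i * S.xpow (-θ i₀) := by
            rw [sub_eq_add_neg, S.xpow_add, hθ]
            simp only
            rw [S.xpow_add, S.xpow_nsmul]
          rw [h2, hu, hy, div_pow]
          simp only
          rw [S.xpow_neg (S.ord _)]
          have := S.xpow_ne_zero (S.ord (r.coeff i))
          field_simp
      rw [Finset.sum_congr rfl fun i _ => h1 i, ← Finset.mul_sum]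
      rw [eval_eq_sum, sum_def] at hrz
      rw [hrz, mul_zero]
    have h3 : (∑ j ∈ r.support, monomial j (e j)).eval y =
        ∑ i ∈ r.support, (e i - u i * S.xpow (θ i - θ i₀)) * y ^ i := by
      rw [eval_finsetSum]
      simp only [sub_mul, Finset.sum_sub_distrib, hsum, sub_zero, eval_monomial]
    rw [h3]
    have hwL : ∀ i, S.xpow (θ i - θ i₀) ∈ L := fun i => hxL _ (hθ₀ i)
    have huv : ∀ i ∈ r.support, S.val st (u i) = 1 := fun i hi => by
      rw [val_of_ne_zero (mul_ne_zero (hrs i hi) (S.xpow_ne_zero _)),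
        S.ord_mul _ _ (hrs i hi) (S.xpow_ne_zero _), S.ord_xpow, add_neg_cancel, hst.zero,
        neg_zero, Real.exp_zero]
    have hyv : ∀ i : ℕ, S.val st (y ^ i) = 1 := fun i => by
      induction i with
      | zero => rw [pow_zero, val_of_ne_zero one_ne_zero, S.ord_one, hst.zero, neg_zero,
          Real.exp_zero]
      | succ i ih => rw [pow_succ, val_mul hst hL (pow_mem hyL i) hyL, ih, hy1, one_mul]
    refine val_sum_lt_one hst hL (fun i hi => ?_) fun i hi => ?_
    · exact mul_mem (sub_mem (heL i hi).1 (mul_mem (huL i) (hwL i))) (pow_mem hyL i)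
    · rw [val_mul hst hL (sub_mem (heL i hi).1 (mul_mem (huL i) (hwL i))) (pow_mem hyL i), hyv,
        mul_one]
      by_cases h0 : st (θ i - θ i₀) = 0
      · have h4 : e i - u i * S.xpow (θ i - θ i₀) = -((u i - c i) * S.xpow (θ i - θ i₀)) := by
          rw [he]
          simp only [if_pos h0]
          ring
        rw [h4, val_neg, val_mul hst hL (sub_mem (huL i) (hGL (hG₀G (hcG i hi)))) (hwL i),
          val_xpow, h0, neg_zero, Real.exp_zero, mul_one]
        exact hclt i hi
      · have h4 : e i - u i * S.xpow (θ i - θ i₀) = -(u i * S.xpow (θ i - θ i₀)) := by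
          rw [he]
          simp only [if_neg h0]
          ring
        rw [h4, val_neg, val_mul hst hL (huL i) (hwL i), huv i hi, one_mul, val_xpow,
          Real.exp_lt_one_iff, neg_lt_zero]
        refine lt_of_le_of_ne ?_ (Ne.symm h0)
        rw [hstθ, sub_nonneg]
        exact hmin i hi

end MonomialField

namespace MonomialField

variable {Q C Z : Type*} [Field Q] [Field C] [AddCommGroup Z] [LinearOrder Z]
    [IsOrderedAddMonoid Z] {S : MonomialField Q C Z} {G G₀ : Submodule ℤ Z} {N : Z} {st : Z → ℝ}
    {L : Subfield Q}

theorem val_D_le (hst : IsStandardPart N st) (hL : ∀ z ∈ L, IsFiniteRel N (S.ord z))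
    (hDL : ∀ z ∈ L, S.D z ∈ L) {z : Q} (hz : z ∈ L) : S.val st (S.D z) ≤ S.val st z := by
  by_cases h0 : S.D z = 0
  · rw [h0, val_zero]
    exact val_nonneg z
  have hz0 : z ≠ 0 := by rintro rfl; exact h0 (map_zero _)
  rw [val_of_ne_zero h0, val_of_ne_zero hz0, Real.exp_le_exp, neg_le_neg_iff]
  exact hst.mono (hL z hz) (hL _ (hDL z hz)) (S.ord_le_ord_D z h0)

theorem val_of_mem_fracs (hG₀ : ∀ g, g ∈ G₀ ↔ g ∈ G ∧ st g = 0) {z : Q} (hz : z ∈ S.fracs G₀)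
    (hz0 : z ≠ 0) : S.val st z = 1 := by
  rw [val_of_ne_zero hz0, ((hG₀ _).mp (ord_mem_of_mem_fracs hz)).2, neg_zero, Real.exp_zero]

variable (S) in
/-- The powers of the variable, as units. -/
def powers : Subgroup Qˣ where
  carrier := {u | ∃ g, (u : Q) = S.xpow g}
  one_mem' := ⟨0, by rw [S.xpow_zero, Units.val_one]⟩
  mul_mem' := by
    rintro u u' ⟨g, hg⟩ ⟨g', hg'⟩
    exact ⟨g + g', by rw [Units.val_mul, hg, hg', S.xpow_add]⟩
  inv_mem' := by
    rintro u ⟨g, hg⟩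
    exact ⟨-g, by rw [Units.val_inv_eq_inv_val, hg, S.xpow_neg]⟩

/-- If `c * x ^ (-g)` is a constant for `c` with exponents in `G₀`, then `g ∈ G₀`. -/
theorem mem_of_mul_D_eq {c : Q} (hc : c ∈ S.fracs G₀) (hc0 : c ≠ 0) {g : Z}
    (h : S.xpow g * S.D c = c * S.D (S.xpow g)) : g ∈ G₀ := by
  obtain ⟨a, ha⟩ := S.exists_cst_of_D_eq_zero (c / S.xpow g) (by
    rw [Derivation.leibniz_div, smul_eq_mul, smul_eq_mul, smul_eq_mul, h, sub_self, mul_zero])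
  have h1 := ord_mem_of_mem_fracs hc
  have h2 := S.ord_cst a
  rw [← ha, S.ord_div hc0 (S.xpow_ne_zero g), S.ord_xpow, sub_eq_zero] at h2
  rwa [h2] at h1

theorem exp_neg_le_val_of_isPoly (hst : IsStandardPart N st)
    (hN : 0 ≤ N) {B : ℕ} {z q : Q} (hz : z ≠ 0) (hzfin : IsFiniteRel N (S.ord z)) (hq : q ≠ 0)
    {s : Z} (hs : IsFiniteRel N s) (hs0 : st s = 0) (hqs : S.IsPoly q s)
    (hqz : S.IsPoly (q * z) (B • N + s)) : Real.exp (-B) ≤ S.val st z := by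
  rw [val_of_ne_zero hz, Real.exp_le_exp, neg_le_neg_iff]
  have h1 := S.ord_le_of_isPoly hqz
  rw [S.ord_mul _ _ hq hz] at h1
  have hN' := (IsFiniteRel.self hN).nsmul B
  have h2 := hst.mono hzfin (hN'.add hs)
    ((le_add_of_nonneg_left (S.ord_nonneg_of_isPoly hqs)).trans h1)
  rw [hst.add _ _ hN' hs, hst.nsmul (.self hN), hst.self, hs0] at h2
  simpa using h2

/-- Values of differential operators of a polynomial are bounded away from zero. -/
theorem exp_neg_le_val_of_mem_span (hst : IsStandardPart N st) (hN : 0 ≤ N)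
    (hGL : S.fracs G ≤ L) (hL : ∀ z ∈ L, IsFiniteRel N (S.ord z)) (hDL : ∀ z ∈ L, S.D z ∈ L)
    (hG₀ : ∀ g, g ∈ G₀ ↔ g ∈ G ∧ st g = 0) {h : Q} (hh : h ∈ L) {B : ℕ}
    (hB : S.IsPoly h (B • N)) {P : Module.End ℤ Q}
    (hP : P ∈ Submodule.span (S.fracs G₀) (Set.range fun i => (S.D : Q →ₗ[ℤ] Q) ^ i))
    (hP0 : P h ≠ 0) : Real.exp (-B) ≤ S.val st (P h) := by
  have hG₀G : S.fracs G₀ ≤ S.fracs G := fracs_mono fun g hg => ((hG₀ g).mp hg).1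
  have hfin : ∀ g ∈ G₀, IsFiniteRel N g := fun g hg => by
    have := hL _ (hGL (hG₀G (xpow_mem_fracs hg)))
    rwa [S.ord_xpow] at this
  have key : P h ∈ L ∧ ∃ q s, q ≠ 0 ∧ s ∈ G₀ ∧ 0 ≤ s ∧ S.IsPoly q s ∧
      S.IsPoly (q * P h) (B • N + s) := by
    clear hP0
    induction hP using Submodule.span_induction with
    | mem P hP =>
      obtain ⟨i, rfl⟩ := hP
      have h1 : ((S.D : Q →ₗ[ℤ] Q) ^ i) h ∈ L ∧ S.IsPoly (((S.D : Q →ₗ[ℤ] Q) ^ i) h) (B • N) := by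
        induction i with
        | zero => simpa using ⟨hh, hB⟩
        | succ i ih =>
          rw [pow_succ', Module.End.mul_apply]
          exact ⟨hDL _ ih.1, S.isPoly_D ih.2⟩
      exact ⟨h1.1, 1, 0, one_ne_zero, zero_mem _, le_rfl, isPoly_one, by simpa using h1.2⟩
    | zero =>
      exact ⟨by simp, 1, 0, one_ne_zero, zero_mem _, le_rfl, isPoly_one, by
        simpa using isPoly_zero (nsmul_nonneg hN B)⟩
    | add P P' _ _ ih ih' =>
      obtain ⟨h1, q, s, hq, hs, hs0, h2, h3⟩ := ih
      obtain ⟨h1', q', s', hq', hs', hs0', h2', h3'⟩ := ih'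
      refine ⟨add_mem h1 h1', q * q', s + s', mul_ne_zero hq hq', add_mem hs hs',
        add_nonneg hs0 hs0', S.isPoly_mul h2 h2', ?_⟩
      have h4 : q * q' * (P + P') h = q * P h * q' + q * (q' * P' h) := by
        rw [LinearMap.add_apply]; ring
      rw [h4]
      refine S.isPoly_add ?_ ?_
      · rw [← add_assoc]; exact S.isPoly_mul h3 h2'
      · rw [add_left_comm]; exact S.isPoly_mul h2 h3'
    | smul c P _ ih =>
      obtain ⟨h1, q, s, hq, hs, hs0, h2, h3⟩ := ih
      obtain ⟨t, ht, ht0, a, b, hb, hc, h4, h5⟩ := exists_isPoly_div_of_mem_fracs c.2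
      refine ⟨mul_mem (hGL (hG₀G c.2)) h1, q * b, s + t, mul_ne_zero hq hb, add_mem hs ht,
        add_nonneg hs0 ht0, S.isPoly_mul h2 h5, ?_⟩
      have h6 : q * b * (c • P) h = q * P h * a := by
        change q * b * ((c : Q) * P h) = _
        rw [hc]; field_simp
      rw [h6, ← add_assoc]
      exact S.isPoly_mul h3 h4
  obtain ⟨h1, q, s, hq, hs, -, h2, h3⟩ := key
  exact exp_neg_le_val_of_isPoly hst hN hP0 (hL _ h1) hq (hfin s hs) ((hG₀ s).mp hs).2 h2 h3

theorem mem_sparse_of_isAlgebraic_of_submodule [CharZero Q] (hst : IsStandardPart N st) (hN : N ∈ G)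
    (hN0 : 0 < N) (hfin : ∀ g ∈ G, IsFiniteRel N g)
    (hG₀ : ∀ g, g ∈ G₀ ↔ g ∈ G ∧ st g = 0)
    (ih : ∀ z, IsAlgebraic (S.fracs G₀) z → z ∈ S.sparse) {z : Q}
    (hz : IsAlgebraic (S.fracs G) z) : z ∈ S.sparse := by
  let L : Subfield Q := (algebraicClosure (S.fracs G) Q).toSubfield
  have hLalg : ∀ z, IsAlgebraic (S.fracs G) z ↔ z ∈ L := fun z => mem_algebraicClosure_iff.symm
  have hGL : S.fracs G ≤ L := fun x hx =>
    (hLalg x).mp (isAlgebraic_algebraMap (⟨x, hx⟩ : S.fracs G))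
  have hL : ∀ z ∈ L, IsFiniteRel N (S.ord z) := fun z hz => by
    obtain ⟨m, hm, h⟩ := exists_nsmul_ord_mem_of_isAlgebraic ((hLalg z).mpr hz)
    exact (hfin _ h).of_nsmul hm
  have hDL : ∀ z ∈ L, S.D z ∈ L := fun z hz =>
    (hLalg _).mp (isAlgebraic_D ((hLalg z).mpr hz))
  have hG₀G : S.fracs G₀ ≤ S.fracs G := fracs_mono fun g hg => ((hG₀ g).mp hg).1
  have hpow : ∀ g, ∃ x ∈ S.powers, (x : Q) = S.xpow g := fun g =>
    ⟨Units.mk0 _ (S.xpow_ne_zero g), ⟨g, rfl⟩, rfl⟩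
  obtain ⟨b, hb, hb0, B, hB, r, hr, hrG, hrz⟩ := exists_isPoly_mul_of_isAlgebraic hfin hN hN0 hz
  have hbz : b * z ∈ L := mul_mem (hGL (polys_le_fracs hb)) ((hLalg z).mp hz)
  have key : b * z ∈ S.sparse.toSubring.toAddSubgroup := by
    refine Subfield.mem_of_monomial_approximation S.D (hG₀G.trans hGL) (fun _ => D_mem_fracs) hDL
      (S.val st) val_zero (fun _ => val_pos) (fun _ hz _ hw => val_mul hst hL hz hw)
      (fun _ hz _ hw => val_add_le hst hL hz hw) (fun _ hz => val_D_le hst hL hDL hz)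
      (fun _ ha ha0 => val_of_mem_fracs hG₀ ha ha0) S.powers ?_ ?_ ?_ ?_ hbz hr ?_ hrz
      (Real.exp_pos (-B))
      (fun P hP hP0 => exp_neg_le_val_of_mem_span hst hN0.le hGL hL hDL hG₀ hbz hB hP hP0) _ ?_
    · rintro x ⟨g, hg⟩ -
      exact ⟨S.cst (S.wt g), cst_mem_fracs _, by rw [hg, S.D_xpow]⟩
    · rintro a ha ha0 x ⟨g, hg⟩ - h
      rw [hg] at h ⊢
      rw [val_xpow, ((hG₀ g).mp (mem_of_mul_D_eq ha ha0 h)).2, neg_zero, Real.exp_zero]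
    · intro w hw hw0
      obtain ⟨h1, h2⟩ := exists_approx hst hGL hL hLalg hG₀ hw hw0
      obtain ⟨x, hx, hxo⟩ := hpow (S.ord w)
      refine ⟨x, hx, hxo ▸ h1, ?_, hxo ▸ h2⟩
      rw [hxo, val_xpow, val_of_ne_zero hw0]
    · obtain ⟨x, hx, hxN⟩ := hpow N
      refine ⟨x, hx, hxN ▸ hGL (xpow_mem_fracs hN), ?_⟩
      rw [hxN, val_xpow, hst.self]
      exact (Real.exp_lt_one_iff.mpr (by norm_num)).ne
    · intro i
      refine Subring.closure_mono ?_ (hrG i)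
      rintro _ ⟨c, g, hg, rfl⟩
      obtain ⟨x, hx, hxg⟩ := hpow g
      exact ⟨S.cst c, cst_mem_fracs c, x, hx, hxg ▸ hGL (xpow_mem_fracs hg), by rw [hxg]⟩
    · rintro w - hw x ⟨g, hg⟩ -
      rw [hg]
      exact S.sparse.mul_mem (ih w hw) (S.xpow_mem_sparse g)
  have h1 : b * z / b ∈ S.sparse := div_mem key (fracs_le_sparse (polys_le_fracs hb))
  rwa [mul_div_cancel_left₀ _ hb0] at h1

theorem exists_isFiniteRel_of_fg (hG : G.FG) (hG0 : G ≠ ⊥) :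
    ∃ N ∈ G, 0 < N ∧ ∀ g ∈ G, IsFiniteRel N g := by
  obtain ⟨T, rfl⟩ := hG
  have hT : ∀ t ∈ T, |t| ≤ ∑ t ∈ T, |t| := fun t ht =>
    Finset.single_le_sum (f := fun t => |t|) (fun i _ => abs_nonneg i) ht
  have hN0 : 0 ≤ ∑ t ∈ T, |t| := Finset.sum_nonneg fun i _ => abs_nonneg i
  refine ⟨∑ t ∈ T, |t|, sum_mem fun t ht => ?_, lt_of_le_of_ne hN0 fun h0 => hG0 ?_, ?_⟩
  · have := Submodule.subset_span (R := ℤ) (Finset.mem_coe.mpr ht)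
    rcases abs_choice t with h | h <;> rw [h]
    · exact this
    · exact neg_mem this
  · refine Submodule.span_eq_bot.mpr fun t ht => ?_
    have := hT t ht
    rw [← h0] at this
    exact abs_nonpos_iff.mp this
  · intro g hg
    induction hg using Submodule.span_induction with
    | mem t ht => exact ⟨1, by rw [one_nsmul]; exact hT t ht⟩
    | zero => exact .zero
    | add x y _ _ hx hy => exact hx.add hy
    | smul m x _ hx =>
      obtain ⟨k, rfl | rfl⟩ := m.eq_nat_or_neg
      · rw [natCast_zsmul]; exact hx.nsmul k
      · rw [neg_smul, natCast_zsmul]; exact (hx.nsmul k).neg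

/-- The elements of `G` with vanishing standard part form a group of smaller rank. -/
theorem exists_submodule_finrank_lt (hst : IsStandardPart N st) (hN : N ∈ G)
    (hfin : ∀ g ∈ G, IsFiniteRel N g) (hG : G.FG) :
    ∃ G₀ : Submodule ℤ Z, G₀.FG ∧ Module.finrank ℤ G₀ < Module.finrank ℤ G ∧
      ∀ g, g ∈ G₀ ↔ g ∈ G ∧ st g = 0 := by
  let φ : G →+ ℝ := AddMonoidHom.mk' (fun g => st g) fun a b =>
    hst.add _ _ (hfin _ a.2) (hfin _ b.2)
  let ψ : G →ₗ[ℤ] ℝ := φ.toIntLinearMap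
  have hψ : ∀ g, ψ g = st g := fun g => rfl
  have := Module.Finite.iff_fg.mpr hG
  refine ⟨(LinearMap.ker ψ).map G.subtype, (IsNoetherian.noetherian (LinearMap.ker ψ)).map _, ?_, ?_⟩
  · have h1 := (LinearMap.ker ψ).finrank_quotient_add_finrank
    rw [ψ.quotKerEquivRange.finrank_eq] at h1
    have h2 : Module.finrank ℤ ((LinearMap.ker ψ).map G.subtype) =
        Module.finrank ℤ (LinearMap.ker ψ) :=
      ((LinearMap.ker ψ).equivMapOfInjective G.subtype G.injective_subtype).finrank_eq.symm
    have h3 : 0 < Module.finrank ℤ (LinearMap.range ψ) := by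
      have : Nontrivial (LinearMap.range ψ) := by
        refine ⟨⟨⟨ψ ⟨N, hN⟩, ⟨_, rfl⟩⟩, 0, fun h => ?_⟩⟩
        have h4 := congrArg Subtype.val h
        rw [ZeroMemClass.coe_zero] at h4
        change ψ ⟨N, hN⟩ = 0 at h4
        rw [hψ, hst.self] at h4
        exact one_ne_zero h4
      exact Module.finrank_pos
    omega
  · intro g
    constructor
    · rintro ⟨g, hg, rfl⟩
      exact ⟨g.2, hg⟩
    · rintro ⟨hg, h⟩
      exact ⟨⟨g, hg⟩, h, rfl⟩

/-- Elements algebraic over the fractions with exponents in a finitely generated group are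
sparse. -/
theorem mem_sparse_of_isAlgebraic [CharZero Q] (hG : G.FG) {z : Q}
    (hz : IsAlgebraic (S.fracs G) z) : z ∈ S.sparse := by
  induction h : Module.finrank ℤ G using Nat.strong_induction_on generalizing G z with
  | _ r ih =>
  by_cases hG0 : G = ⊥
  · subst hG0
    obtain ⟨c, rfl⟩ := exists_cst_of_isAlgebraic hz
    exact S.cst_mem_sparse c
  obtain ⟨N, hN, hN0, hfin⟩ := exists_isFiniteRel_of_fg hG hG0
  obtain ⟨st, hst⟩ := S.exists_isStandardPart N hN0
  obtain ⟨G₀, hfg, hlt, hG₀⟩ := exists_submodule_finrank_lt hst hN hfin hG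
  exact mem_sparse_of_isAlgebraic_of_submodule hst hN hN0 hfin hG₀
    (fun w hw => ih _ (h ▸ hlt) hfg hw rfl) hz

end MonomialField

namespace RatFunc

variable {k : Type*} [Field k] {z w : RatFunc k} {m n : ℕ}

local notation "ι" => algebraMap (Polynomial k) (RatFunc k)

/-- A rational function is sparse if it is a quotient of polynomials with few terms. -/
def IsSparse (n : ℕ) (z : RatFunc k) : Prop :=
  ∃ p q : k[X], q ≠ 0 ∧ z = ι p / ι q ∧ p.support.card ≤ n ∧ q.support.card ≤ n

namespace IsSparse

theorem mono (h : IsSparse m z) (hmn : m ≤ n) : IsSparse n z := by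
  obtain ⟨p, q, hq, hz, h1, h2⟩ := h
  exact ⟨p, q, hq, hz, h1.trans hmn, h2.trans hmn⟩

theorem mul (h : IsSparse m z) (h' : IsSparse n w) : IsSparse (m * n) (z * w) := by
  obtain ⟨p, q, hq, rfl, h1, h2⟩ := h
  obtain ⟨p', q', hq', rfl, h1', h2'⟩ := h'
  exact ⟨p * p', q * q', mul_ne_zero hq hq', by rw [map_mul, map_mul, div_mul_div_comm],
    card_support_mul_le.trans (Nat.mul_le_mul h1 h1'),
    card_support_mul_le.trans (Nat.mul_le_mul h2 h2')⟩

theorem add (h : IsSparse m z) (h' : IsSparse n w) : IsSparse (2 * (m * n)) (z + w) := by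
  obtain ⟨p, q, hq, rfl, h1, h2⟩ := h
  obtain ⟨p', q', hq', rfl, h1', h2'⟩ := h'
  refine ⟨p * q' + q * p', q * q', mul_ne_zero hq hq', ?_, ?_, ?_⟩
  · rw [div_add_div _ _ (algebraMap_ne_zero hq) (algebraMap_ne_zero hq'), map_add, map_mul,
      map_mul, map_mul]
  · refine (Finset.card_le_card support_add).trans ((Finset.card_union_le _ _).trans ?_)
    rw [two_mul]
    exact add_le_add (card_support_mul_le.trans (Nat.mul_le_mul h1 h2'))
      (card_support_mul_le.trans (Nat.mul_le_mul h2 h1'))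
  · exact (card_support_mul_le.trans (Nat.mul_le_mul h2 h2')).trans (Nat.le_mul_of_pos_left _ two_pos)

theorem neg (h : IsSparse n z) : IsSparse n (-z) := by
  obtain ⟨p, q, hq, rfl, h1, h2⟩ := h
  exact ⟨-p, q, hq, by rw [map_neg, neg_div], by rwa [support_neg], h2⟩

theorem algebraMap_monomial (i : ℕ) (c : k) : IsSparse 1 (ι (monomial i c)) :=
  ⟨_, 1, one_ne_zero, by rw [map_one, div_one],
    card_support_le_one_iff_monomial.mpr ⟨i, c, rfl⟩,
    card_support_le_one_iff_monomial.mpr ⟨0, 1, rfl⟩⟩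

theorem C (c : k) : IsSparse 1 (RatFunc.C c) := by
  rw [← algebraMap_C, ← monomial_zero_left]
  exact algebraMap_monomial 0 c

theorem inv (h : IsSparse n z) : IsSparse (max n 1) z⁻¹ := by
  obtain ⟨p, q, hq, rfl, h1, h2⟩ := h
  by_cases hp : p = 0
  · rw [hp, map_zero, zero_div, inv_zero, ← map_zero (RatFunc.C (K := k))]
    exact (IsSparse.C 0).mono (le_max_right _ _)
  · exact ⟨q, p, hp, by rw [inv_div], h2.trans (le_max_left _ _), h1.trans (le_max_left _ _)⟩

theorem X_pow (n : ℕ) : IsSparse 1 ((X : RatFunc k) ^ n) := by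
  rw [← algebraMap_X, ← map_pow, ← monomial_one_right_eq_X_pow]
  exact algebraMap_monomial n 1

theorem X_zpow (n : ℤ) : IsSparse 1 ((X : RatFunc k) ^ n) := by
  obtain ⟨m, rfl | rfl⟩ := n.eq_nat_or_neg
  · rw [zpow_natCast]
    exact X_pow m
  · rw [zpow_neg, zpow_natCast]
    exact (X_pow m).inv

end IsSparse

end RatFunc

/-- An additive map satisfying the Leibniz rule, as a derivation. -/
def Derivation.ofAddMonoidHom {Q : Type*} [Field Q] (δ : Q →+ Q)
    (h : ∀ z w, δ (z * w) = z * δ w + w * δ z) : Derivation ℤ Q Q :=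
  Derivation.mk' δ.toIntLinearMap h

namespace Filter.Germ

/-- The ring homomorphism induced on germs. -/
def mapRingHom {α R R' : Type*} (l : Filter α) [Semiring R] [Semiring R'] (f : R →+* R') :
    Germ l R →+* Germ l R' where
  toFun := Germ.map f
  map_one' := congrArg ofFun (funext fun _ => map_one f)
  map_zero' := congrArg ofFun (funext fun _ => map_zero f)
  map_mul' a b := Germ.inductionOn₂ a b fun _ _ => congrArg ofFun (funext fun _ => map_mul f _ _)
  map_add' a b := Germ.inductionOn₂ a b fun _ _ => congrArg ofFun (funext fun _ => map_add f _ _)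

/-- The additive homomorphism induced on germs. -/
def mapAddMonoidHom {α A A' : Type*} (l : Filter α) [AddMonoid A] [AddMonoid A'] (f : A →+ A') :
    Germ l A →+ Germ l A' where
  toFun := Germ.map f
  map_zero' := congrArg ofFun (funext fun _ => map_zero f)
  map_add' a b := Germ.inductionOn₂ a b fun _ _ => congrArg ofFun (funext fun _ => map_add f _ _)

theorem coe_ne {α β : Type*} {φ : Ultrafilter α} {f g : α → β} :
    (f : Germ (φ : Filter α) β) ≠ g ↔ ∀ᶠ x in φ, f x ≠ g x :=
  (not_congr coe_eq).trans Ultrafilter.eventually_not.symm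

variable {α : Type*} {φ : Ultrafilter α}

theorem charZero {K : Type*} [Field K] [CharZero K] : CharZero (Germ (φ : Filter α) K) :=
  charZero_of_injective_ringHom
    (((coeRingHom (φ : Filter α)).comp (Pi.constRingHom α K)).injective)

theorem map_intCast_le {a b : Germ (φ : Filter α) ℤ} (h : a ≤ b) :
    mapRingHom (φ : Filter α) (Int.castRingHom ℝ) a ≤ mapRingHom (φ : Filter α) (Int.castRingHom ℝ) b := by
  revert h
  refine Germ.inductionOn₂ a b fun a b h => ?_
  refine coe_le.mpr ((coe_le.mp h).mono fun x hx => ?_)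
  exact Int.cast_le.mpr hx

theorem exists_isStandardPart {N : Germ (φ : Filter α) ℤ} (hN : 0 < N) :
    ∃ st : Germ (φ : Filter α) ℤ → ℝ, IsStandardPart N st := by
  set κ := mapRingHom (φ : Filter α) (Int.castRingHom ℝ)
  have hκ : ∀ {a b}, a ≤ b → κ a ≤ κ b := map_intCast_le
  have hN0 : 0 < κ N := by
    refine lt_of_le_of_ne ?_ ?_
    · have := hκ hN.le
      rwa [map_zero] at this
    · revert hN
      refine Germ.inductionOn N fun N hN h => ?_
      refine hN.ne (coe_eq.mpr ((coe_eq.mp h).mono fun x hx => ?_))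
      exact (Int.cast_eq_zero.mp hx.symm).symm
  have hfin : ∀ a, IsFiniteRel N a → 0 ≤ ArchimedeanClass.mk (κ a / κ N) := by
    rintro a ⟨m, hm⟩
    rw [← ArchimedeanClass.mk_one, ArchimedeanClass.mk_le_mk]
    refine ⟨m, ?_⟩
    have h1 : κ a ≤ m • κ N := by
      rw [← map_nsmul]; exact hκ ((le_abs_self a).trans hm)
    have h2 : -κ a ≤ m • κ N := by
      rw [← map_nsmul, ← map_neg]; exact hκ ((neg_le_abs a).trans hm)
    rw [abs_one, abs_div, abs_of_pos hN0, div_le_iff₀ hN0, smul_mul_assoc, one_mul]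
    exact abs_le'.mpr ⟨h1, h2⟩
  refine ⟨fun a => ArchimedeanClass.stdPart (κ a / κ N), ?_, fun a b ha hb => ?_, fun a ha h0 => ?_⟩
  · rw [div_self hN0.ne', ArchimedeanClass.stdPart_one]
  · rw [map_add, add_div, ArchimedeanClass.stdPart_add (hfin a ha) (hfin b hb)]
  · rw [← ArchimedeanClass.stdPart_zero (K := Germ (φ : Filter α) ℝ)]
    refine ArchimedeanClass.stdPart_monotoneOn ?_ (hfin a ha) (div_nonneg ?_ hN0.le)
    · simp
    · have := hκ h0
      rwa [map_zero] at this

variable (φ) in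
/-- Germs of rational functions with boundedly many terms. -/
def sparse (k : Type*) [Field k] : Subfield (Germ (φ : Filter α) (RatFunc k)) where
  carrier := {z | ∃ n, LiftPred (RatFunc.IsSparse n) z}
  one_mem' := ⟨1, Eventually.of_forall fun _ => by
    have := RatFunc.IsSparse.C (1 : k)
    rwa [map_one] at this⟩
  zero_mem' := ⟨1, Eventually.of_forall fun _ => by
    have := RatFunc.IsSparse.C (0 : k)
    rwa [map_zero] at this⟩
  mul_mem' {a b} := Germ.inductionOn₂ a b fun _ _ ⟨m, hm⟩ ⟨n, hn⟩ =>
    ⟨m * n, (hm.and hn).mono fun _ h => h.1.mul h.2⟩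
  add_mem' {a b} := Germ.inductionOn₂ a b fun _ _ ⟨m, hm⟩ ⟨n, hn⟩ =>
    ⟨2 * (m * n), (hm.and hn).mono fun _ h => h.1.add h.2⟩
  neg_mem' {a} := Germ.inductionOn a fun _ ⟨m, hm⟩ => ⟨m, hm.mono fun _ h => h.neg⟩
  inv_mem' a := Germ.inductionOn a fun _ ⟨m, hm⟩ => ⟨max m 1, hm.mono fun _ h => h.inv⟩

variable (φ) in
/-- The field of germs of rational functions. -/
noncomputable def monomialField (k : Type*) [Field k] [CharZero k] :
    MonomialField (Germ (φ : Filter α) (RatFunc k)) (Germ (φ : Filter α) k)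
      (Germ (φ : Filter α) ℤ) where
  cst := mapRingHom _ RatFunc.C
  xpow := Germ.map fun n => RatFunc.X ^ n
  xpow_zero := congrArg ofFun (funext fun _ => zpow_zero _)
  xpow_add a b := Germ.inductionOn₂ a b fun _ _ =>
    congrArg ofFun (funext fun _ => zpow_add₀ RatFunc.X_ne_zero _ _)
  wt := Germ.map Int.cast
  ord := Germ.map RatFunc.ordZero
  ord_cst c := Germ.inductionOn c fun _ => congrArg ofFun (funext fun _ => RatFunc.ordZero_C _)
  ord_xpow a := Germ.inductionOn a fun _ => congrArg ofFun (funext fun _ => RatFunc.ordZero_X_zpow _)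
  ord_mul z w := Germ.inductionOn₂ z w fun _ _ hz hw =>
    coe_eq.mpr (((coe_ne.mp hz).and (coe_ne.mp hw)).mono fun _ h => RatFunc.ordZero_mul h.1 h.2)
  min_ord_le_ord_add z w := by
    rw [min_def]
    exact Germ.inductionOn₂ z w fun _ _ hz hw h =>
      coe_le.mpr (((coe_ne.mp hz).and ((coe_ne.mp hw).and (coe_ne.mp h))).mono fun _ h =>
        RatFunc.min_ordZero_le_ordZero_add h.1 h.2.1 h.2.2)
  D := Derivation.ofAddMonoidHom (mapAddMonoidHom _ RatFunc.euler) fun z w =>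
    Germ.inductionOn₂ z w fun _ _ => congrArg ofFun (funext fun _ => RatFunc.euler_mul _ _)
  D_cst c := Germ.inductionOn c fun _ => congrArg ofFun (funext fun _ => RatFunc.euler_C _)
  D_xpow a := Germ.inductionOn a fun _ => congrArg ofFun (funext fun _ => RatFunc.euler_X_zpow _)
  exists_cst_of_D_eq_zero z := Germ.inductionOn z fun z hz => by
    classical
    have h : ∀ᶠ x in φ, ∃ c, z x = RatFunc.C c :=
      (coe_eq.mp hz).mono fun x hx => RatFunc.exists_C_of_euler_eq_zero hx
    obtain ⟨c, hc⟩ := Filter.skolem.mp h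
    exact ⟨c, coe_eq.mpr hc⟩
  ord_le_ord_D z := Germ.inductionOn z fun _ hz =>
    coe_le.mpr ((coe_ne.mp hz).mono fun _ h => RatFunc.ordZero_le_ordZero_euler h)
  IsPoly := LiftRel RatFunc.IsPolyOfDegreeLE
  isPoly_mono {z m n} := Germ.inductionOn₃ z m n fun _ _ _ h h' =>
    (h.and (coe_le.mp h')).mono fun _ h => h.1.mono h.2
  isPoly_add {z w n} := Germ.inductionOn₃ z w n fun _ _ _ h h' =>
    (h.and h').mono fun _ h => h.1.add h.2
  isPoly_mul {z w m n} := Germ.inductionOn₂ z w fun _ _ => Germ.inductionOn₂ m n fun _ _ h h' =>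
    (h.and h').mono fun _ h => h.1.mul h.2
  isPoly_D {z n} := Germ.inductionOn₂ z n fun _ _ h => h.mono fun _ h => h.euler
  isPoly_cst c := Germ.inductionOn c fun _ =>
    Eventually.of_forall fun _ => RatFunc.IsPolyOfDegreeLE.C _ le_rfl
  isPoly_xpow a := Germ.inductionOn a fun _ h =>
    (coe_nonneg.mp h).mono fun _ h => RatFunc.IsPolyOfDegreeLE.X_zpow h le_rfl
  ord_nonneg_of_isPoly {z n} := Germ.inductionOn₂ z n fun _ _ h =>
    coe_nonneg.mpr (h.mono fun _ h => h.ordZero_nonneg)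
  ord_le_of_isPoly {z n} := Germ.inductionOn₂ z n fun _ _ h =>
    coe_le.mpr (h.mono fun _ h => h.ordZero_le)
  isPoly_of_monic {z n} m c := by
    obtain ⟨c, rfl⟩ : ∃ c' : ℕ → α → RatFunc k, c = fun i => (c' i : Germ (φ : Filter α) (RatFunc k)) :=
      ⟨fun i => (c i).out, funext fun i => (Quotient.out_eq (c i)).symm⟩
    refine Germ.inductionOn₂ z n fun z n hc hn h => ?_
    have h1 : ∀ᶠ x in φ, ∀ i ∈ Finset.range m, RatFunc.IsPolyOfDegreeLE (c i x) (n x) :=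
      (Filter.eventually_all_finset _).mpr fun i hi => hc i (Finset.mem_range.mp hi)
    have h2 : ((z ^ m + ∑ i ∈ Finset.range m, c i * z ^ i : α → RatFunc k) :
        Germ (φ : Filter α) (RatFunc k)) = (0 : α → RatFunc k) := by
      refine Eq.trans ?_ h
      exact (map_add (coeRingHom (φ : Filter α)) _ _).trans (congrArg₂ _ rfl (map_sum _ _ _))
    refine (h1.and ((coe_nonneg.mp hn).and (coe_eq.mp h2))).mono fun x hx => ?_
    refine RatFunc.IsPolyOfDegreeLE.of_monic m (fun i => c i x)
      (fun i hi => hx.1 i (Finset.mem_range.mpr hi)) hx.2.1 ?_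
    have := hx.2.2
    simpa using this
  sparse := sparse φ k
  cst_mem_sparse c := Germ.inductionOn c fun _ =>
    ⟨1, Eventually.of_forall fun _ => RatFunc.IsSparse.C _⟩
  xpow_mem_sparse a := Germ.inductionOn a fun _ =>
    ⟨1, Eventually.of_forall fun _ => RatFunc.IsSparse.X_zpow _⟩
  exists_isStandardPart _ hN := exists_isStandardPart hN

end Filter.Germ

namespace Filter.Germ

variable {α : Type*} {φ : Ultrafilter α}

/-- A germ of roots of polynomials of bounded degree is algebraic over any field containing the
germs of the coefficients. -/
theorem isAlgebraic_of_eval_eq_zero {K : Type*} [Field K] {F : Subfield (Germ (φ : Filter α) K)}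
    {p : α → K[X]} {g : α → K} {d : ℕ} (hp : ∀ x, p x ≠ 0) (hd : ∀ x, (p x).natDegree ≤ d)
    (hg : ∀ x, (p x).eval (g x) = 0)
    (hF : ∀ j, ((fun x => (p x).coeff j : α → K) : Germ (φ : Filter α) K) ∈ F) :
    IsAlgebraic F (g : Germ (φ : Filter α) K) := by
  refine ⟨∑ j ∈ Finset.range (d + 1), monomial j ⟨_, hF j⟩, fun h => ?_, ?_⟩
  · have h1 : ∀ j ∈ Finset.range (d + 1), ∀ᶠ x in φ, (p x).coeff j = 0 := fun j hj => by
      have h2 := congrArg (fun q => q.coeff j) h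
      simp only [finsetSum_coeff, coeff_monomial, Finset.sum_ite_eq', if_pos hj, coeff_zero] at h2
      exact coe_eq.mp (congrArg Subtype.val h2)
    obtain ⟨x, hx⟩ := ((Filter.eventually_all_finset _).mpr h1).exists
    refine hp x (Polynomial.ext fun j => ?_)
    rw [coeff_zero]
    by_cases hj : j < d + 1
    · exact hx j (Finset.mem_range.mpr hj)
    · exact coeff_eq_zero_of_natDegree_lt ((hd x).trans_lt (by omega))
  · have h1 : (∑ j ∈ Finset.range (d + 1), (fun x => (p x).coeff j : α → K) * g ^ j) = 0 := by
      ext x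
      have := hg x
      rw [eval_eq_sum_range' (Nat.lt_succ_of_le (hd x))] at this
      simpa using this
    have h2 := congrArg (coeRingHom (φ : Filter α)) h1
    rw [map_sum, map_zero] at h2
    rw [map_sum, ← h2]
    refine Finset.sum_congr rfl fun j _ => ?_
    rw [aeval_monomial]
    rfl

end Filter.Germ

namespace MvPolynomial

variable {k K σ : Type*} [Field k] [Field K] [Fintype σ] [DecidableEq σ]

theorem support_subset_Icc {τ : Type*} [Fintype τ] [DecidableEq τ] {f : MvPolynomial τ k} {d : ℕ}
    (h : ∀ i, f.degreeOf i ≤ d) :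
    f.support ⊆ Finset.Icc 0 (Finsupp.equivFunOnFinite.symm fun _ => d) := fun m hm =>
  Finset.mem_Icc.mpr ⟨bot_le, fun i => (degreeOf_le_iff.mp (h i)) m hm⟩

/-- The substitution of elements of a field for all variables but one, as a sum of monomials. -/
theorem eval₂_sumElim_eq_sum {f : MvPolynomial (σ ⊕ Unit) k} {d : ℕ} (h : ∀ i, f.degreeOf i ≤ d)
    (c : k →+* K) (x : σ → K) :
    eval₂ (Polynomial.C.comp c) (Sum.elim (fun i => Polynomial.C (x i)) fun _ => Polynomial.X) f =
      ∑ m ∈ Finset.Icc 0 (Finsupp.equivFunOnFinite.symm fun _ => d),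
        Polynomial.monomial (m (Sum.inr ())) (c (f.coeff m) * ∏ i, x i ^ m (Sum.inl i)) := by
  rw [eval₂_eq']
  refine Finset.sum_subset_zero_on_sdiff (support_subset_Icc h) (fun m hm => ?_) fun m _ => ?_
  · have := (Finset.mem_sdiff.mp hm).2
    rw [notMem_support_iff] at this
    rw [this, map_zero, zero_mul, Polynomial.monomial_zero_right]
  · rw [Fintype.prod_sum_type]
    simp only [Sum.elim_inl, Sum.elim_inr, Finset.univ_unique, Finset.prod_singleton,
      RingHom.comp_apply]
    rw [← Polynomial.C_mul_X_pow_eq_monomial, Polynomial.C_mul, map_prod, mul_assoc]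
    simp only [map_pow]

end MvPolynomial

theorem Nsharp_le_of_isSparse {n : ℕ} {z : RatFunc ℂ} (h : RatFunc.IsSparse n z) :
    Nsharp z ≤ 2 * n := by
  obtain ⟨p, q, hq, hz, h1, h2⟩ := h
  have h3 : Nsharp z ≤ p.support.card + q.support.card := Nat.sInf_le ⟨p, q, hq, hz, rfl⟩
  omega

/-- For fixed degree and number of variables the numbers of terms are bounded. -/
theorem exists_Nsharp_le (d ℓ : ℕ) :
    ∃ B : ℕ, ∀ (f : MvPolynomial (Fin ℓ ⊕ Unit) ℂ) (n : Fin ℓ → ℕ) (g : RatFunc ℂ),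
      (∀ i, f.degreeOf i ≤ d) →
      MvPolynomial.eval₂ (Polynomial.C.comp RatFunc.C)
        (Sum.elim (fun i => Polynomial.C (RatFunc.X ^ n i)) fun _ => Polynomial.X) f ≠ 0 →
      Polynomial.eval g (MvPolynomial.eval₂ (Polynomial.C.comp RatFunc.C)
        (Sum.elim (fun i => Polynomial.C (RatFunc.X ^ n i)) fun _ => Polynomial.X) f) = 0 →
      Nsharp g ≤ B := by
  by_contra! hcon
  choose f n g hd h0 hg hB using hcon
  let φ : Ultrafilter ℕ := Filter.hyperfilter ℕ
  let S := Filter.Germ.monomialField φ ℂ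
  let ν : Fin ℓ → Filter.Germ (φ : Filter ℕ) ℤ := fun i => ((fun k => (n k i : ℤ) : ℕ → ℤ))
  let G : Submodule ℤ (Filter.Germ (φ : Filter ℕ) ℤ) := Submodule.span ℤ (Set.range ν)
  have hG : G.FG := Submodule.fg_span (Set.finite_range ν)
  have hX : ∀ i, ((fun k => RatFunc.X ^ n k i : ℕ → RatFunc ℂ) :
      Filter.Germ (φ : Filter ℕ) (RatFunc ℂ)) ∈ S.fracs G := fun i => by
    have h1 : S.xpow (ν i) ∈ S.fracs G :=
      MonomialField.xpow_mem_fracs (Submodule.subset_span ⟨i, rfl⟩)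
    convert h1 using 1
    exact congrArg Filter.Germ.ofFun (funext fun k => (zpow_natCast _ _).symm)
  have := Filter.Germ.charZero (φ := φ) (K := RatFunc ℂ)
  have halg : IsAlgebraic (S.fracs G) (g : Filter.Germ (φ : Filter ℕ) (RatFunc ℂ)) := by
    refine Filter.Germ.isAlgebraic_of_eval_eq_zero (d := d) h0 (fun k => ?_) hg fun j => ?_
    · rw [MvPolynomial.eval₂_sumElim_eq_sum (hd k)]
      refine natDegree_sum_le_of_forall_le _ _ fun m hm => (natDegree_monomial_le _).trans ?_
      exact (Finset.mem_Icc.mp hm).2 _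
    · have h1 : (fun k => (MvPolynomial.eval₂ (Polynomial.C.comp RatFunc.C)
          (Sum.elim (fun i => Polynomial.C (RatFunc.X ^ n k i)) fun _ => Polynomial.X)
            (f k)).coeff j : ℕ → RatFunc ℂ) =
          ∑ m ∈ Finset.Icc 0 (Finsupp.equivFunOnFinite.symm fun _ => d),
            if m (Sum.inr ()) = j then (fun k => RatFunc.C ((f k).coeff m)) *
              ∏ i, (fun k => RatFunc.X ^ n k i : ℕ → RatFunc ℂ) ^ m (Sum.inl i) else 0 := by
        ext k
        rw [MvPolynomial.eval₂_sumElim_eq_sum (hd k), finsetSum_coeff, Finset.sum_apply]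
        refine Finset.sum_congr rfl fun m _ => ?_
        rw [coeff_monomial]
        split_ifs <;> simp
      have h2 := congrArg (Filter.Germ.coeRingHom (φ : Filter ℕ)) h1
      rw [map_sum] at h2
      change Filter.Germ.coeRingHom (φ : Filter ℕ) _ ∈ _
      rw [h2]
      refine sum_mem fun m _ => ?_
      split_ifs
      · rw [map_mul, map_prod]
        refine mul_mem ?_ (prod_mem fun i _ => ?_)
        · exact MonomialField.cst_mem_fracs (S := S) ((fun k => (f k).coeff m : ℕ → ℂ))
        · rw [map_pow]
          exact pow_mem (hX i) _
      · rw [map_zero]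
        exact zero_mem _
  obtain ⟨B, hsp⟩ := MonomialField.mem_sparse_of_isAlgebraic hG halg
  have hlarge : ∀ᶠ k in φ, 2 * B ≤ k :=
    Filter.Tendsto.eventually_ge_atTop (Nat.hyperfilter_le_atTop) _
  obtain ⟨k, hk, hk'⟩ := (Filter.Eventually.and hsp hlarge).exists
  exact absurd (hB k) (not_lt.mpr ((Nsharp_le_of_isSparse hk).trans hk'))

/-- Theorem 3(a) (Fuchs–Mantova–Zannier).  Here `f ∈ ℂ[x₁, …, x_ℓ, y]` is a
multivariate polynomial in the variables indexed by `Fin ℓ ⊕ Unit` (the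
`Fin ℓ` variables are `x₁, …, x_ℓ` and the `Unit` variable is `y`), of degree
at most `d` in each variable.  Substituting `xᵢ ↦ x^{nᵢ}` and keeping `y` as
the polynomial variable yields an element of `ℂ(x)[Y]`; assuming it is not
identically zero and vanishes at `Y = g(x)`, we get `N#(g) ≤ B₆(d, ℓ)`. -/
theorem fuchs_mantova_zannier_thm3a :
    ∃ B₆ : ℕ × ℕ → ℕ, ∀ (d ℓ : ℕ) (f : MvPolynomial (Fin ℓ ⊕ Unit) ℂ)
      (n : Fin ℓ → ℕ) (g : RatFunc ℂ),
      (∀ i, f.degreeOf i ≤ d) →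
      MvPolynomial.eval₂ (Polynomial.C.comp RatFunc.C)
        (Sum.elim (fun i => Polynomial.C (RatFunc.X ^ n i)) fun _ => Polynomial.X) f ≠ 0 →
      Polynomial.eval g (MvPolynomial.eval₂ (Polynomial.C.comp RatFunc.C)
        (Sum.elim (fun i => Polynomial.C (RatFunc.X ^ n i)) fun _ => Polynomial.X) f) = 0 →
      Nsharp g ≤ B₆ (d, ℓ) := by
  choose B hB using exists_Nsharp_le
  exact ⟨fun x => B x.1 x.2, fun d ℓ => hB d ℓ⟩
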